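/- arXiv:2406.16387 — 6 statements merged into one kernel-verified Lean document; each statement's English description precedes it below -/
import Mathlib

section
/- Let A be a finite totally ordered alphabet and σ : A → ℕ with σ(a) ≥ 2 for every a ∈ A. Then the σ-Chinese monoid Ch(A,σ) is finite and its cardinality is |Ch(A,σ)| = Σ_{B ⊆ A} ( Catalan(|B|) · Π_{b ∈ B} (σ(b) − 1) ), where the sum is over all subsets B of A and Catalan(k) is the k-th Catalan number. -/
/-- The defining relations of the σ-Chinese monoid: `cba = cab = bca` (for `a < b < c`),
`aba = baa` and `bba = bab` (for `a < b`), together with `a^(σ a) = a` for every letter. -/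
def chineseRel {A : Type*} [LinearOrder A] (σ : A → ℕ) (U V : FreeMonoid A) : Prop :=
  (∃ a b c : A, a < b ∧ b < c ∧
    U = FreeMonoid.of c * FreeMonoid.of b * FreeMonoid.of a ∧
    V = FreeMonoid.of c * FreeMonoid.of a * FreeMonoid.of b) ∨
  (∃ a b c : A, a < b ∧ b < c ∧
    U = FreeMonoid.of c * FreeMonoid.of a * FreeMonoid.of b ∧
    V = FreeMonoid.of b * FreeMonoid.of c * FreeMonoid.of a) ∨
  (∃ a b : A, a < b ∧
    U = FreeMonoid.of a * FreeMonoid.of b * FreeMonoid.of a ∧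
    V = FreeMonoid.of b * FreeMonoid.of a * FreeMonoid.of a) ∨
  (∃ a b : A, a < b ∧
    U = FreeMonoid.of b * FreeMonoid.of b * FreeMonoid.of a ∧
    V = FreeMonoid.of b * FreeMonoid.of a * FreeMonoid.of b) ∨
  (∃ a : A, U = FreeMonoid.of a ^ σ a ∧ V = FreeMonoid.of a)

/-- The congruence on the free monoid defining the σ-Chinese monoid `Ch(A, σ)`. -/
def chineseCon {A : Type*} [LinearOrder A] (σ : A → ℕ) : Con (FreeMonoid A) :=
  conGen (chineseRel σ)

/-- A family `f` in a monoid satisfying the Chinese relations and `f a ^ (k a + 1) = f a`. -/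
structure IsChineseFamily {A M : Type*} [LinearOrder A] [Monoid M] (k : A → ℕ) (f : A → M) :
    Prop where
  pos : ∀ a, 1 ≤ k a
  pow : ∀ a, f a ^ (k a + 1) = f a
  swap : ∀ a b c, a ≤ b → b ≤ c → f c * f b * f a = f c * f a * f b
  slide : ∀ a b c, a ≤ b → b ≤ c → f c * f a * f b = f b * f c * f a

namespace IsChineseFamily

open List

variable {A M : Type*} [LinearOrder A] [Monoid M] {k : A → ℕ} {f : A → M}

theorem mul_comm_after (H : IsChineseFamily k f) {x y n : A} (hx : x ≤ n) (hy : y ≤ n) :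
    f n * f x * f y = f n * f y * f x := by
  rcases le_total x y with h | h
  · exact (H.swap x y n h hy).symm
  · exact H.swap y x n h hx

theorem mul_comm_before (H : IsChineseFamily k f) {x y a : A} (hx : a ≤ x) (hy : a ≤ y) :
    f x * f y * f a = f y * f x * f a := by
  rcases le_total x y with h | h
  · rw [H.swap a x y hx h, H.slide a x y hx h]
  · rw [H.swap a y x hy h, H.slide a y x hy h]

theorem mul_eq_mul_pow (H : IsChineseFamily k f) {x n : A} (hx : x ≤ n) :
    f n * f x = f n * f x * f n ^ k n := by
  have h : Commute (f n) (f n * f x) := by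
    simpa [Commute, SemiconjBy, mul_assoc] using H.mul_comm_after (le_refl n) hx
  conv_lhs => rw [← H.pow n, pow_succ, mul_assoc, (h.pow_left (k n)).eq]

theorem mul_eq_pow_mul (H : IsChineseFamily k f) {x a : A} (hx : a ≤ x) :
    f x * f a = f a ^ k a * (f x * f a) := by
  have h : Commute (f a) (f x * f a) := by
    simpa [Commute, SemiconjBy, mul_assoc] using H.mul_comm_before (le_refl a) hx
  rw [(h.pow_left (k a)).eq, mul_assoc, ← pow_succ', H.pow]

theorem prod_perm_after (H : IsChineseFamily k f) {n : A} {l l' : List A} (hl : l ~ l')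
    (hn : ∀ x ∈ l, x ≤ n) : f n * (l.map f).prod = f n * (l'.map f).prod := by
  induction hl with
  | nil => rfl
  | @cons x l l' _ ih =>
    have ih := ih fun y hy => hn y (mem_cons_of_mem _ hy)
    obtain ⟨m, hm⟩ := Nat.exists_eq_add_of_le' (H.pos n)
    simp only [map_cons, prod_cons, ← mul_assoc]
    rw [H.mul_eq_mul_pow (hn x mem_cons_self), hm, pow_succ]
    simp only [mul_assoc, ih]
  | swap x y l =>
    simp only [map_cons, prod_cons, ← mul_assoc]
    rw [H.mul_comm_after (hn y (by simp)) (hn x (by simp))]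
  | trans h _ ih ih' => rw [ih hn, ih' fun x hx => hn x (h.mem_iff.2 hx)]

theorem prod_mul_eq_pow_mul (H : IsChineseFamily k f) {a : A} {l : List A}
    (ha : ∀ x ∈ l, a ≤ x) : (l.map f).prod * f a = f a ^ k a * ((l.map f).prod * f a) := by
  induction l with
  | nil => simp [← pow_succ, H.pow]
  | cons x l ih =>
    have ih := ih fun y hy => ha y (mem_cons_of_mem _ hy)
    obtain ⟨m, hm⟩ := Nat.exists_eq_add_of_le' (H.pos a)
    have hx := H.mul_eq_pow_mul (ha x mem_cons_self)
    have key : f x * f a ^ k a = f a ^ k a * (f x * f a ^ k a) := by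
      calc f x * f a ^ k a = f x * f a * f a ^ m := by rw [hm, pow_succ', mul_assoc]
        _ = f a ^ k a * (f x * f a) * f a ^ m := by rw [← hx]
        _ = _ := by rw [hm]; simp only [pow_succ', mul_assoc]
    calc ((x :: l).map f).prod * f a = f x * f a ^ k a * ((l.map f).prod * f a) := by
          rw [mul_assoc, ← ih, map_cons, prod_cons, mul_assoc]
      _ = f a ^ k a * (f x * (f a ^ k a * ((l.map f).prod * f a))) := by
          rw [key]; simp only [mul_assoc]
      _ = _ := by rw [← ih, map_cons, prod_cons]; simp only [mul_assoc]

theorem prod_perm_before (H : IsChineseFamily k f) {a : A} {l l' : List A} (hl : l ~ l')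
    (ha : ∀ x ∈ l, a ≤ x) : (l.map f).prod * f a = (l'.map f).prod * f a := by
  induction hl with
  | nil => rfl
  | cons x _ ih =>
    simp only [map_cons, prod_cons, mul_assoc, ih fun y hy => ha y (mem_cons_of_mem _ hy)]
  | swap x y l =>
    obtain ⟨m, hm⟩ := Nat.exists_eq_add_of_le' (H.pos a)
    simp only [map_cons, prod_cons, mul_assoc]
    rw [H.prod_mul_eq_pow_mul fun z hz => ha z (by simp [hz]), hm, pow_succ']
    have := H.mul_comm_before (ha y (by simp)) (ha x (by simp))
    simp only [← mul_assoc, this]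
  | trans h _ ih ih' => rw [ih ha, ih' fun x hx => ha x (h.mem_iff.2 hx)]

theorem prod_insert_before (H : IsChineseFamily k f) {a x : A} (hax : a ≤ x) {l : List A}
    (hl : ∀ y ∈ l, a ≤ y) :
    f x * (l.map f).prod * f a = f x * (l.map f).prod * f x ^ k x * f a := by
  have h := H.prod_perm_before (a := a) (l := replicate (k x + 1) x ++ l)
    (l' := x :: l ++ replicate (k x) x)
    (by simpa [replicate_succ] using perm_append_comm) (by
      intro y hy
      rcases mem_append.1 hy with hy | hy
      · rw [eq_of_mem_replicate hy]; exact hax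
      · exact hl y hy)
  simpa [H.pow, mul_assoc] using h

/-- Between a letter `x` and a later letter `a ≤ x`, the idempotent power of `x` may be inserted
just before `a`. -/
theorem prod_insert (H : IsChineseFamily k f) {a x : A} (hax : a ≤ x) (l s : List A)
    (hs : ∀ y ∈ s, x ≤ y) :
    f x * ((s ++ l).map f).prod * f a = f x * ((s ++ l).map f).prod * f x ^ k x * f a := by
  induction l generalizing s with
  | nil => simpa using H.prod_insert_before hax fun y hy => hax.trans (hs y (by simpa using hy))
  | cons y l ih =>
    rcases le_total x y with hxy | hyx
    · simpa using ih (s ++ [y]) (by simpa [or_imp, forall_and] using ⟨hs, hxy⟩)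
    · have hc : Commute (f x ^ k x) (f x * f y) := by
        refine Commute.pow_left ?_ _
        simpa [Commute, SemiconjBy, mul_assoc] using H.mul_comm_after (le_refl x) hyx
      have hp : f x * (s.map f).prod * f y = (s.map f).prod * (f x * f y) := by
        have := H.prod_perm_before (a := y) (l := x :: s) (l' := s ++ [x])
          (by simpa using (perm_append_comm (l₁ := [x]) (l₂ := s))) (by
            simpa using ⟨hyx, fun b hb => hyx.trans (hs b hb)⟩)
        simpa [mul_assoc] using this
      have h1 : f x * (s.map f).prod * f y = f x * (s.map f).prod * f y * f x ^ k x := by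
        rw [hp, mul_assoc, ← hc.eq, ← mul_assoc (f x ^ k x), ← pow_succ, H.pow]
      obtain ⟨m, hm⟩ := Nat.exists_eq_add_of_le' (H.pos x)
      have h2 := ih [] (by simp)
      simp only [nil_append] at h2
      have h3 : f x ^ k x * ((l.map f).prod * f a) =
          f x ^ k x * ((l.map f).prod * (f x ^ k x * f a)) := by
        calc _ = f x ^ m * (f x * (l.map f).prod * f a) := by
              rw [hm]; simp only [pow_succ, mul_assoc]
          _ = f x ^ m * (f x * (l.map f).prod * f x ^ k x * f a) := by rw [← h2]
          _ = _ := by conv_rhs => enter [1]; rw [hm, pow_succ]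
                      simp only [mul_assoc]
      simp only [map_append, map_cons, prod_append, prod_cons]
      calc _ = f x * (s.map f).prod * f y * ((l.map f).prod * f a) := by simp only [mul_assoc]
        _ = f x * (s.map f).prod * f y * (f x ^ k x * ((l.map f).prod * f a)) := by
              rw [← mul_assoc _ (f x ^ k x), ← h1]
        _ = f x * (s.map f).prod * f y * (f x ^ k x * ((l.map f).prod * (f x ^ k x * f a))) := by
              rw [h3]
        _ = f x * (s.map f).prod * f y * f x ^ k x * ((l.map f).prod * (f x ^ k x * f a)) := by
              simp only [mul_assoc]
        _ = _ := by rw [← h1]; simp only [mul_assoc]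

theorem pow_eq_pow (H : IsChineseFamily k f) {x : A} {m m' : ℕ} (hm : 1 ≤ m) (hm' : 1 ≤ m')
    (h : m ≡ m' [MOD k x]) : f x ^ m = f x ^ m' := by
  wlog hle : m ≤ m' generalizing m m'
  · exact (this hm' hm h.symm (le_of_not_ge hle)).symm
  obtain ⟨t, ht⟩ := (Nat.modEq_iff_dvd' hle).1 h
  obtain rfl : m' = m + k x * t := by omega
  clear h ht hle hm'
  induction t with
  | zero => simp
  | succ t ih =>
    obtain ⟨s, rfl⟩ := Nat.exists_eq_add_of_le' hm
    rw [ih, show s + 1 + k x * (t + 1) = s + k x * t + (k x + 1) by ring, pow_add _ _ (k x + 1),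
      H.pow, ← pow_succ]
    congr 1; ring

end IsChineseFamily

/-- Some letter `≥ j` occurs before some letter `≤ i` in the word `w`. -/
def HasInv {A : Type*} [LinearOrder A] (w : List A) (i j : A) : Prop :=
  ∃ p q, [p, q].Sublist w ∧ j ≤ p ∧ q ≤ i

/-- Two words have the same support, the same letter counts modulo `k`, and the same inversions up
to domination. -/
structure SameInv {A : Type*} [LinearOrder A] (k : A → ℕ) (w w' : List A) : Prop where
  mem : ∀ x, x ∈ w ↔ x ∈ w'
  count : ∀ x, w.count x ≡ w'.count x [MOD k x]
  inv : ∀ i j, i < j → (HasInv w i j ↔ HasInv w' i j)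

theorem HasInv.mono {A : Type*} [LinearOrder A] {w : List A} {i j i' j' : A} (h : HasInv w i j)
    (hi : i ≤ i') (hj : j' ≤ j) : HasInv w i' j' := by
  obtain ⟨p, q, hs, hp, hq⟩ := h
  exact ⟨p, q, hs, hj.trans hp, hq.trans hi⟩

theorem hasInv_append {A : Type*} [LinearOrder A] {l l' : List A} {i j : A} :
    HasInv (l ++ l') i j ↔
      HasInv l i j ∨ HasInv l' i j ∨ ((∃ p ∈ l, j ≤ p) ∧ ∃ q ∈ l', q ≤ i) := by
  constructor
  · rintro ⟨p, q, h, hp, hq⟩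
    obtain ⟨l₁, l₂, h12, h1, h2⟩ := List.sublist_append_iff.1 h
    rcases l₁ with - | ⟨a, - | ⟨b, l₁⟩⟩
    · obtain rfl : [p, q] = l₂ := by simpa using h12
      exact Or.inr (Or.inl ⟨p, q, h2, hp, hq⟩)
    · obtain ⟨rfl, rfl⟩ : a = p ∧ l₂ = [q] := by simpa [eq_comm] using h12
      exact Or.inr (Or.inr ⟨⟨a, by simpa using h1, hp⟩, ⟨q, by simpa using h2, hq⟩⟩)
    · obtain ⟨rfl, rfl, -⟩ : a = p ∧ b = q ∧ _ := by simpa [eq_comm] using h12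
      exact Or.inl ⟨a, b, (by simp : [a, b].Sublist (a :: b :: l₁)).trans h1, hp, hq⟩
  · rintro (⟨p, q, h, hp, hq⟩ | ⟨p, q, h, hp, hq⟩ | ⟨⟨p, h, hp⟩, ⟨q, h', hq⟩⟩)
    · exact ⟨p, q, h.trans (List.sublist_append_left _ _), hp, hq⟩
    · exact ⟨p, q, h.trans (List.sublist_append_right _ _), hp, hq⟩
    · exact ⟨p, q, (List.singleton_sublist.2 h).append (List.singleton_sublist.2 h'), hp, hq⟩

namespace IsChineseFamily

open List

variable {A M : Type*} [LinearOrder A] [Monoid M] {k : A → ℕ} {f : A → M}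

theorem prod_mul_pow_mul_pow_comm (H : IsChineseFamily k f) {n i : A} {l : List A}
    (hin : i ≤ n) (hl : ∀ x ∈ l, i ≤ x ∧ x ≤ n) {m r : ℕ} (hm : 1 ≤ m) (hr : 1 ≤ r) :
    (l.map f).prod * (f n ^ m * f i ^ r) = f n ^ m * f i ^ r * (l.map f).prod := by
  obtain ⟨m, rfl⟩ := Nat.exists_eq_add_of_le' hm
  obtain ⟨r, rfl⟩ := Nat.exists_eq_add_of_le' hr
  have h1 := H.prod_perm_before (a := i) (l := l ++ replicate (m + 1) n)
    (l' := replicate (m + 1) n ++ l) perm_append_comm (by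
      simp only [mem_append, mem_replicate]
      rintro x (hx | ⟨-, rfl⟩)
      exacts [(hl x hx).1, hin])
  have h2 := H.prod_perm_after (n := n) (l := l ++ replicate (r + 1) i)
    (l' := replicate (r + 1) i ++ l) perm_append_comm (by
      simp only [mem_append, mem_replicate]
      rintro x (hx | ⟨-, rfl⟩)
      exacts [(hl x hx).2, hin])
  simp only [map_append, map_replicate, prod_append, prod_replicate] at h1 h2
  calc _ = (l.map f).prod * f n ^ (m + 1) * f i * f i ^ r := by
        simp only [pow_succ' (f i), mul_assoc]
    _ = f n ^ m * (f n * ((l.map f).prod * f i ^ (r + 1))) := by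
        rw [h1]; simp only [pow_succ (f n), pow_succ' (f i), mul_assoc]
    _ = _ := by rw [h2]; simp only [pow_succ (f n), mul_assoc]

/-- All occurrences of the maximal letter `n` can be moved to the end of the word. -/
theorem prod_collapse (H : IsChineseFamily k f) {n i : A} {u v : List A} (hu : n ∉ u)
    (hin : i < n) (hv : ∀ x ∈ v, i ≤ x ∧ x ≤ n) (hiv : i ∈ v) :
    ((u ++ n :: v).map f).prod = (((u ++ n :: v).filter (· ≠ n)).map f).prod *
      (f n ^ ((u ++ n :: v).count n) * f i ^ k i) := by
  have hu' : u.filter (· ≠ n) = u := by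
    rw [filter_eq_self]; intro a ha; simpa using ne_of_mem_of_not_mem ha hu
  have hc : (u ++ n :: v).count n = v.count n + 1 := by
    simp [count_eq_zero_of_not_mem hu]
  have h1 : f n * (v.map f).prod = f n * ((v ++ replicate (k i) i).map f).prod := by
    have p1 := perm_cons_erase hiv
    have p2 : v ++ replicate (k i) i ~ replicate (k i + 1) i ++ v.erase i := by
      refine (p1.append_right _).trans ?_
      rw [replicate_succ, cons_append, cons_append]
      exact perm_append_comm.cons _
    rw [H.prod_perm_after p1 fun x hx => (hv x hx).2, H.prod_perm_after p2]
    · simp [H.pow]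
    · simp only [mem_append, mem_replicate]
      rintro x (hx | ⟨-, rfl⟩)
      exacts [(hv x hx).2, hin.le]
  have p3 : v ~ replicate (v.count n) n ++ v.filter (· ≠ n) := by
    have := (filter_append_perm (· = n) v).symm
    simpa [filter_eq] using this
  have h2 := H.prod_perm_after (n := n) (l := v ++ replicate (k i) i)
    (l' := replicate (v.count n) n ++ (replicate (k i) i ++ v.filter (· ≠ n)))
    ((p3.append_right _).trans (by
      rw [append_assoc]; exact perm_append_comm.append_left _)) (by
      simp only [mem_append, mem_replicate]
      rintro x (hx | ⟨-, rfl⟩)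
      exacts [(hv x hx).2, hin.le])
  have h3 := H.prod_mul_pow_mul_pow_comm (n := n) (i := i) (l := v.filter (· ≠ n)) hin.le
    (fun x hx => hv x (mem_of_mem_filter hx)) (m := v.count n + 1) (r := k i) (by omega) (H.pos i)
  rw [hc, filter_append, hu', filter_cons_of_neg (by simp), map_append, prod_append, map_append,
    prod_append, mul_assoc, h3, map_cons, prod_cons, h1, h2]
  simp only [map_append, map_replicate, prod_append, prod_replicate, pow_succ', mul_assoc]

theorem prod_insert_pow (H : IsChineseFamily k f) {n i x : A} {w : List A} (hx : x ∈ w)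
    (hix : i ≤ x) (hxn : x ≤ n) {m r : ℕ} (hr : 1 ≤ r) :
    (w.map f).prod * (f n ^ m * f i ^ r) =
      (w.map f).prod * f x ^ k x * (f n ^ m * f i ^ r) := by
  obtain ⟨a, b, rfl⟩ := append_of_mem hx
  obtain ⟨r, rfl⟩ := Nat.exists_eq_add_of_le' hr
  have h1 := H.prod_insert hix (b ++ replicate m n) [] (by simp)
  have h2 := H.prod_perm_before (a := i) (l := replicate m n ++ replicate (k x) x)
    (l' := replicate (k x) x ++ replicate m n) perm_append_comm (by
      simp only [mem_append, mem_replicate]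
      rintro y (⟨-, rfl⟩ | ⟨-, rfl⟩)
      exacts [hix.trans hxn, hix])
  simp only [map_append, map_replicate, prod_append, prod_replicate, nil_append, map_cons,
    prod_cons] at h1 h2 ⊢
  calc _ = (a.map f).prod * (f x * ((b.map f).prod * f n ^ m) * f i) * f i ^ r := by
        simp only [pow_succ', mul_assoc]
    _ = (a.map f).prod * f x * (b.map f).prod * (f n ^ m * f x ^ k x * f i) * f i ^ r := by
        rw [h1]; simp only [mul_assoc]
    _ = _ := by rw [h2]; simp only [pow_succ', mul_assoc]

theorem prod_insert_list (H : IsChineseFamily k f) {n i : A} {L w : List A}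
    (hL : ∀ x ∈ L, x ∈ w ∧ i ≤ x ∧ x ≤ n) {m r : ℕ} (hr : 1 ≤ r) :
    (w.map f).prod * (f n ^ m * f i ^ r) =
      ((w ++ L.flatMap fun x => replicate (k x) x).map f).prod * (f n ^ m * f i ^ r) := by
  induction L generalizing w with
  | nil => simp
  | cons x L ih =>
    obtain ⟨hx, hix, hxn⟩ := hL x mem_cons_self
    rw [flatMap_cons, ← append_assoc, ← ih fun y hy => ?_, H.prod_insert_pow hx hix hxn hr]
    · simp
    · obtain ⟨h1, h2⟩ := hL y (mem_cons_of_mem _ hy)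
      exact ⟨mem_append_left _ h1, h2⟩

end IsChineseFamily

/-- Deleting the maximal letter `n` and appending suitable letters, the inversions of the new word
depend only on those of the old one. -/
theorem hasInv_filter_append {A : Type*} [LinearOrder A] {w t : List A} {n : A} {B : Finset A}
    (hB : ∀ x ∈ B, x < n) (hw : ∀ x, x ∈ w ↔ x ∈ insert n B)
    (ht : ∀ x ∈ t, x ∈ B ∧ HasInv w x n)
    (ht' : ∀ x ∈ B, ∀ y ∈ B, x < y → HasInv w x n → HasInv t x y) {i j : A} (hij : i < j) :
    HasInv (w.filter (· ≠ n) ++ t) i j ↔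
      ∃ x ∈ B, ∃ y ∈ B, x < y ∧ x ≤ i ∧ j ≤ y ∧ HasInv w x y := by
  have hf : ∀ x ∈ w.filter (· ≠ n), x ∈ B := by
    intro x hx
    obtain ⟨h1, h2⟩ := List.mem_filter.1 hx
    exact Finset.mem_of_mem_insert_of_ne ((hw x).1 h1) (by simpa using h2)
  constructor
  · intro h
    rcases hasInv_append.1 h with ⟨p, q, h, hp, hq⟩ | ⟨p, q, h, hp, hq⟩ |
      ⟨⟨p, h, hp⟩, ⟨q, h', hq⟩⟩
    · have hs := h.subset
      exact ⟨q, hf q (hs (by simp)), p, hf p (hs (by simp)), hq.trans_lt (hij.trans_le hp), hq, hp,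
        p, q, h.trans List.filter_sublist, le_rfl, le_rfl⟩
    · have hs := h.subset
      obtain ⟨h1, h2⟩ := ht q (hs (by simp))
      obtain ⟨h3, h4⟩ := ht p (hs (by simp))
      exact ⟨q, h1, p, h3, hq.trans_lt (hij.trans_le hp), hq, hp, h2.mono le_rfl (hB p h3).le⟩
    · obtain ⟨h1, h2⟩ := ht q h'
      exact ⟨q, h1, p, hf p h, hq.trans_lt (hij.trans_le hp), hq, hp,
        h2.mono le_rfl (hB p (hf p h)).le⟩
  · rintro ⟨x, hx, y, hy, hxy, hxi, hjy, h⟩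
    obtain ⟨p, q, hs, hp, hq⟩ := h
    rcases eq_or_ne p n with rfl | hpn
    · exact hasInv_append.2 (Or.inr (Or.inl
        ((ht' x hx y hy hxy ⟨p, q, hs, le_rfl, hq⟩).mono hxi hjy)))
    · have hqn : q ≠ n := (hq.trans_lt (hB x hx)).ne
      have := hs.filter (· ≠ n)
      simp only [ne_eq, hpn, not_false_eq_true, decide_true, List.filter_cons_of_pos, hqn,
        List.filter_nil] at this
      exact hasInv_append.2 (Or.inl ⟨p, q, this, hjy.trans hp, hq.trans hxi⟩)

namespace IsChineseFamily

open List

variable {A M : Type*} [LinearOrder A] [Monoid M] {k : A → ℕ} {f : A → M}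

theorem prod_eq_of_no_inv {n : A} {w : List A} (hn : n ∈ w)
    (hw : ∀ x ∈ w, x < n → ¬ HasInv w x n) (hle : ∀ x ∈ w, x ≤ n) :
    (w.map f).prod = ((w.filter (· ≠ n)).map f).prod * f n ^ w.count n := by
  obtain ⟨u, v, rfl, hu⟩ := eq_append_cons_of_mem hn
  have hv : ∀ x ∈ v, x = n := by
    intro x hx
    by_contra hxn
    exact hw x (by simp [hx]) (lt_of_le_of_ne (hle x (by simp [hx])) hxn) (hasInv_append.2
      (Or.inr (Or.inl ⟨n, x, by simpa using hx, le_rfl, le_rfl⟩)))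
  obtain ⟨m, rfl⟩ : ∃ m, v = replicate m n := ⟨_, eq_replicate_iff.2 ⟨rfl, hv⟩⟩
  have hu' : u.filter (· ≠ n) = u := by
    rw [filter_eq_self]; intro a ha; simpa using ne_of_mem_of_not_mem ha hu
  rw [filter_append, hu', filter_cons_of_neg (by simp), count_append, count_eq_zero_of_not_mem hu]
  simp [pow_succ']

theorem prod_eq_of_min_inv (H : IsChineseFamily k f) {n i : A} {w L : List A} (hn : n ∈ w)
    (hin : i < n) (hi : HasInv w i n) (hmin : ∀ x ∈ w, x < n → HasInv w x n → i ≤ x)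
    (hle : ∀ x ∈ w, x ≤ n) (hL : ∀ x ∈ L, x ∈ w ∧ i ≤ x ∧ x < n) :
    (w.map f).prod = ((w.filter (· ≠ n) ++ L.flatMap fun x => replicate (k x) x).map f).prod *
      (f n ^ w.count n * f i ^ k i) := by
  obtain ⟨u, v, rfl, hu⟩ := eq_append_cons_of_mem hn
  have hv : ∀ x ∈ v, i ≤ x ∧ x ≤ n := by
    intro x hx
    refine ⟨?_, hle x (by simp [hx])⟩
    rcases (hle x (by simp [hx])).eq_or_lt with rfl | h
    · exact hin.le
    · exact hmin x (by simp [hx]) h (hasInv_append.2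
        (Or.inr (Or.inl ⟨n, x, by simpa using hx, le_rfl, le_rfl⟩)))
  have hiv : i ∈ v := by
    have : ∃ q ∈ v, q ≤ i := by
      rcases hasInv_append.1 hi with ⟨p, q, h, hp, hq⟩ | ⟨p, q, h, hp, hq⟩ |
        ⟨⟨p, h, hp⟩, ⟨q, h', hq⟩⟩
      · have hpu : p ∈ u := h.subset (by simp)
        exact absurd (le_antisymm hp (hle p (by simp [hpu])) ▸ hpu) hu
      · have hqv : [q] <+ v := by
          simpa using h.tail
        exact ⟨q, by simpa using hqv, hq⟩
      · refine ⟨q, ?_, hq⟩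
        rcases mem_cons.1 h' with rfl | h'
        · exact absurd hin hq.not_gt
        · exact h'
    obtain ⟨q, hqv, hq⟩ := this
    exact le_antisymm hq (hv q hqv).1 ▸ hqv
  rw [H.prod_collapse hu hin hv hiv, H.prod_insert_list (L := L) _ (H.pos i)]
  intro x hx
  obtain ⟨h1, h2, h3⟩ := hL x hx
  exact ⟨mem_filter.2 ⟨h1, by simpa using h3.ne⟩, h2, h3.le⟩

/-- The value of a word depends only on its support, letter counts and inversions. -/
theorem prod_eq_of_sameInv (H : IsChineseFamily k f) (B : Finset A) (w w' : List A)
    (hw : ∀ x, x ∈ w ↔ x ∈ B) (h : SameInv k w w') : (w.map f).prod = (w'.map f).prod := by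
  classical
  induction B using Finset.induction_on_max generalizing w w' with
  | empty =>
    have h1 : w = [] := eq_nil_iff_forall_not_mem.2 fun x => by simp [hw]
    have h2 : w' = [] := eq_nil_iff_forall_not_mem.2 fun x => by simp [← h.mem, hw]
    rw [h1, h2]
  | insert n B hB ih =>
    have hw' : ∀ x, x ∈ w' ↔ x ∈ insert n B := fun x => by rw [← h.mem, hw]
    have hle : ∀ {w : List A}, (∀ x, x ∈ w ↔ x ∈ insert n B) → ∀ x ∈ w, x ≤ n := by
      intro w hw x hx
      rcases Finset.mem_insert.1 ((hw x).1 hx) with rfl | hx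
      exacts [le_rfl, (hB x hx).le]
    have hnB : n ∉ B := fun hn => lt_irrefl _ (hB n hn)
    have hn : n ∈ w := (hw n).2 (Finset.mem_insert_self _ _)
    have hn' : n ∈ w' := (h.mem n).1 hn
    have hmemB : ∀ {w : List A}, (∀ x, x ∈ w ↔ x ∈ insert n B) → ∀ x ∈ w, x < n → x ∈ B :=
      fun hw x hx hxn => Finset.mem_of_mem_insert_of_ne ((hw x).1 hx) hxn.ne
    set S := B.filter (HasInv w · n) with hS
    have hS' : ∀ x, x ∈ S ↔ x ∈ B ∧ HasInv w' x n := by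
      intro x
      rw [hS, Finset.mem_filter, and_congr_right_iff]
      exact fun hx => h.inv x n (hB x hx)
    have hS'' : ∀ x, x ∈ S ↔ x ∈ B ∧ HasInv w x n := fun x => by rw [hS, Finset.mem_filter]
    set L := S.toList ++ S.toList with hL
    set t := L.flatMap fun x => replicate (k x) x with htdef
    have ht : ∀ x, x ∈ t ↔ x ∈ S := by
      intro x
      have := H.pos x
      simp only [htdef, hL, mem_flatMap, mem_append, Finset.mem_toList, or_self, mem_replicate]
      constructor
      · rintro ⟨a, ha, -, rfl⟩; exact ha
      · exact fun hx => ⟨x, hx, by omega, rfl⟩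
    have ht' : ∀ x ∈ S, ∀ y ∈ S, HasInv t x y := by
      intro x hx y hy
      have key : ∀ z ∈ S, z ∈ S.toList.flatMap fun x => replicate (k x) x := by
        intro z hz
        have := H.pos z
        exact mem_flatMap.2 ⟨z, by simpa using hz, by simp; omega⟩
      rw [htdef, hL, flatMap_append]
      exact hasInv_append.2 (Or.inr (Or.inr ⟨⟨y, key y hy, le_rfl⟩, ⟨x, key x hx, le_rfl⟩⟩))
    have hU : ((w.filter (· ≠ n) ++ t).map f).prod = ((w'.filter (· ≠ n) ++ t).map f).prod := by
      apply ih
      · intro x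
        rw [mem_append, mem_filter, ht, hw, hS, Finset.mem_filter, Finset.mem_insert]
        by_cases hx : x = n
        · simp [hx, hnB]
        · simp only [hx, false_or, ne_eq, not_false_eq_true, decide_true, and_true]; tauto
      · refine ⟨fun x => by simp [h.mem x], fun x => ?_, fun i j hij => ?_⟩
        · rw [count_append, count_append]
          refine Nat.ModEq.add_right _ ?_
          by_cases hx : x = n
          · subst hx
            rw [count_eq_zero_of_not_mem (by simp), count_eq_zero_of_not_mem (by simp)]
          · rw [count_filter (by simpa using hx), count_filter (by simpa using hx)]
            exact h.count x
        · have e1 := hasInv_filter_append (t := t) hB hw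
            (fun x hx => (hS'' x).1 ((ht x).1 hx)) (fun x hx y hy hxy hinv => ht' x
              ((hS'' x).2 ⟨hx, hinv⟩) y ((hS'' y).2 ⟨hy, hinv.mono hxy.le le_rfl⟩)) hij
          have e2 := hasInv_filter_append (t := t) hB hw'
            (fun x hx => (hS' x).1 ((ht x).1 hx)) (fun x hx y hy hxy hinv => ht' x
              ((hS' x).2 ⟨hx, hinv⟩) y ((hS' y).2 ⟨hy, hinv.mono hxy.le le_rfl⟩)) hij
          rw [e1, e2]
          have key : ∀ x y, x < y → (HasInv w x y ↔ HasInv w' x y) := h.inv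
          constructor <;> rintro ⟨x, hx, y, hy, hxy, h1, h2, h3⟩
          · exact ⟨x, hx, y, hy, hxy, h1, h2, (key x y hxy).1 h3⟩
          · exact ⟨x, hx, y, hy, hxy, h1, h2, (key x y hxy).2 h3⟩
    have hcount : f n ^ w.count n = f n ^ w'.count n :=
      H.pow_eq_pow (count_pos_iff.2 hn) (count_pos_iff.2 hn') (h.count n)
    rcases S.eq_empty_or_nonempty with hSe | hSne
    · have htn : t = [] := eq_nil_iff_forall_not_mem.2 fun x => by simp [ht, hSe]
      rw [htn, append_nil, append_nil] at hU
      rw [prod_eq_of_no_inv hn (fun x hx hxn hinv => ?_) (hle hw),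
        prod_eq_of_no_inv hn' (fun x hx hxn hinv => ?_) (hle hw'), hU, hcount]
      · exact absurd ((hS' x).2 ⟨hmemB hw' x hx hxn, hinv⟩) (by simp [hSe])
      · exact absurd ((hS'' x).2 ⟨hmemB hw x hx hxn, hinv⟩) (by simp [hSe])
    · have hi := S.min'_mem hSne
      set i := S.min' hSne
      obtain ⟨hiB, hiw⟩ := (hS'' i).1 hi
      have hiw' := ((hS' i).1 hi).2
      have hLS : ∀ x ∈ L, x ∈ S := by simp [hL]
      rw [H.prod_eq_of_min_inv (L := L) hn (hB i hiB) hiw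
          (fun x hx hxn hinv => S.min'_le x ((hS'' x).2 ⟨hmemB hw x hx hxn, hinv⟩)) (hle hw),
        H.prod_eq_of_min_inv (L := L) hn' (hB i hiB) hiw'
          (fun x hx hxn hinv => S.min'_le x ((hS' x).2 ⟨hmemB hw' x hx hxn, hinv⟩)) (hle hw'),
        ← htdef, hU, hcount]
      · intro x hx
        have hx := hLS x hx
        have hxB := ((hS' x).1 hx).1
        exact ⟨(hw' x).2 (Finset.mem_insert_of_mem hxB), S.min'_le x hx, hB x hxB⟩
      · intro x hx
        have hx := hLS x hx
        have hxB := ((hS' x).1 hx).1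
        exact ⟨(hw x).2 (Finset.mem_insert_of_mem hxB), S.min'_le x hx, hB x hxB⟩

end IsChineseFamily

/-- Monotone functions on `{0, …, n - 1}` lying weakly below the identity, extended by zero. -/
def SubdiagonalSet (n : ℕ) : Set (ℕ → ℕ) :=
  {h | (∀ i j, i ≤ j → j < n → h i ≤ h j) ∧ (∀ j, h j ≤ j) ∧ ∀ j, n ≤ j → h j = 0}

/-- Gluing two subdiagonal functions, so that `m` becomes the last fixed point. -/
def subdiagonalGlue (n m : ℕ) (f g : ℕ → ℕ) (j : ℕ) : ℕ :=
  if j < m then f j else if j = m then m else if j ≤ n then m + g (j - m - 1) else 0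

theorem subdiagonalGlue_mem {n m : ℕ} (hm : m ≤ n) {f g : ℕ → ℕ} (hf : f ∈ SubdiagonalSet m)
    (hg : g ∈ SubdiagonalSet (n - m)) : subdiagonalGlue n m f g ∈ SubdiagonalSet (n + 1) := by
  obtain ⟨f1, f2, f3⟩ := hf
  obtain ⟨g1, g2, g3⟩ := hg
  refine ⟨fun i j hij hj => ?_, fun j => ?_, fun j hj => ?_⟩
  · have a := f2 i
    have b := f1 i j hij
    have c := g1 (i - m - 1) (j - m - 1) (by omega)
    unfold subdiagonalGlue
    split_ifs <;> omega
  · have a := f2 j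
    have b := g2 (j - m - 1)
    unfold subdiagonalGlue
    split_ifs <;> omega
  · unfold subdiagonalGlue
    split_ifs <;> omega

theorem subdiagonalGlue_lt {n m : ℕ} {f g : ℕ → ℕ} (hg : g ∈ SubdiagonalSet (n - m)) {j : ℕ}
    (hj : m < j) : subdiagonalGlue n m f g j < j := by
  have := hg.2.1 (j - m - 1)
  unfold subdiagonalGlue
  split_ifs <;> omega

theorem subdiagonalGlue_self (n m : ℕ) (f g : ℕ → ℕ) : subdiagonalGlue n m f g m = m := by
  simp [subdiagonalGlue]

theorem exists_subdiagonalGlue {n : ℕ} {h : ℕ → ℕ} (hh : h ∈ SubdiagonalSet (n + 1)) :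
    ∃ m ≤ n, ∃ f ∈ SubdiagonalSet m, ∃ g ∈ SubdiagonalSet (n - m), subdiagonalGlue n m f g = h := by
  obtain ⟨h1, h2, h3⟩ := hh
  set m := Nat.findGreatest (fun j => h j = j) n with hm
  have hmn : m ≤ n := Nat.findGreatest_le n
  have hfix : h m = m := Nat.findGreatest_spec (P := fun j => h j = j) (Nat.zero_le n)
    (Nat.le_zero.1 (h2 0))
  have hlt : ∀ j, m < j → j ≤ n → h j < j := fun j hj hjn =>
    lt_of_le_of_ne (h2 j) (Nat.findGreatest_is_greatest (P := fun j => h j = j) hj hjn)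
  refine ⟨m, hmn, fun j => if j < m then h j else 0, ⟨?_, ?_, ?_⟩,
    fun j => if j < n - m then h (j + m + 1) - m else 0, ⟨?_, ?_, ?_⟩, ?_⟩
  · intro i j hij hj
    have := h1 i j hij (by omega)
    dsimp only; split_ifs <;> omega
  · intro j
    have := h2 j
    dsimp only; split_ifs <;> omega
  · intro j hj
    dsimp only; split_ifs <;> omega
  · intro i j hij hj
    have := h1 (i + m + 1) (j + m + 1) (by omega) (by omega)
    dsimp only; split_ifs <;> omega
  · intro j
    have := hlt (j + m + 1)
    dsimp only; split_ifs <;> omega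
  · intro j hj
    dsimp only; split_ifs <;> omega
  · funext j
    have a := h3 j
    unfold subdiagonalGlue
    by_cases c1 : j < m
    · simp [c1]
    by_cases c2 : j = m
    · simp [c2, hfix]
    by_cases c3 : j ≤ n
    · have := h1 m j (by omega) (by omega)
      have e : j - m - 1 + m + 1 = j := by omega
      simp only [c1, c2, c3, if_false, if_true, e]
      split_ifs <;> omega
    · simp only [c1, c2, c3, if_false]
      omega

theorem subdiagonalGlue_inj {n m m' : ℕ} {f g f' g' : ℕ → ℕ} (hm : m ≤ n) (hm' : m' ≤ n)
    (hf : f ∈ SubdiagonalSet m) (hg : g ∈ SubdiagonalSet (n - m)) (hf' : f' ∈ SubdiagonalSet m')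
    (hg' : g' ∈ SubdiagonalSet (n - m'))
    (h : subdiagonalGlue n m f g = subdiagonalGlue n m' f' g') : m = m' ∧ f = f' ∧ g = g' := by
  obtain rfl : m = m' := by
    rcases lt_trichotomy m m' with hlt | rfl | hlt
    · have := subdiagonalGlue_lt (f := f) hg hlt
      rw [h, subdiagonalGlue_self] at this
      omega
    · rfl
    · have := subdiagonalGlue_lt (f := f') hg' hlt
      rw [← h, subdiagonalGlue_self] at this
      omega
  refine ⟨rfl, funext fun j => ?_, funext fun j => ?_⟩
  · rcases lt_or_ge j m with hj | hj
    · simpa [subdiagonalGlue, hj] using congrFun h j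
    · rw [hf.2.2 j hj, hf'.2.2 j hj]
  · rcases lt_or_ge j (n - m) with hj | hj
    · have := congrFun h (j + m + 1)
      have e : j + m + 1 - m - 1 = j := by omega
      simp only [subdiagonalGlue, e, show ¬ j + m + 1 < m by omega,
        show ¬ j + m + 1 = m by omega, show j + m + 1 ≤ n by omega, if_true, if_false] at this
      omega
    · rw [hg.2.2 j hj, hg'.2.2 j hj]

/-- The first-return decomposition of subdiagonal functions. -/
noncomputable def subdiagonalEquiv (n : ℕ) :
    (Σ m : Fin (n + 1), SubdiagonalSet m × SubdiagonalSet (n - m)) ≃ SubdiagonalSet (n + 1) :=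
  Equiv.ofBijective
    (fun x => ⟨subdiagonalGlue n x.1 x.2.1 x.2.2,
      subdiagonalGlue_mem (Nat.le_of_lt_succ x.1.2) x.2.1.2 x.2.2.2⟩) <| by
    constructor
    · rintro ⟨⟨m, hm⟩, ⟨f, hf⟩, ⟨g, hg⟩⟩ ⟨⟨m', hm'⟩, ⟨f', hf'⟩, ⟨g', hg'⟩⟩ h
      obtain ⟨rfl, rfl, rfl⟩ := subdiagonalGlue_inj (Nat.le_of_lt_succ hm)
        (Nat.le_of_lt_succ hm') hf hg hf' hg' (Subtype.ext_iff.1 h)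
      rfl
    · rintro ⟨h, hh⟩
      obtain ⟨m, hm, f, hf, g, hg, rfl⟩ := exists_subdiagonalGlue hh
      exact ⟨⟨⟨m, Nat.lt_succ_of_le hm⟩, ⟨f, hf⟩, ⟨g, hg⟩⟩, rfl⟩

theorem card_subdiagonalSet (n : ℕ) :
    Finite (SubdiagonalSet n) ∧ Nat.card (SubdiagonalSet n) = catalan n := by
  induction n using Nat.strong_induction_on with
  | _ n ih =>
    rcases n with - | n
    · have h0 : SubdiagonalSet 0 = {fun _ => 0} := by
        ext h
        constructor
        · exact fun hh => funext fun j => hh.2.2 j (Nat.zero_le j)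
        · rintro rfl
          simp [SubdiagonalSet]
      rw [h0]
      exact ⟨inferInstance, by simp⟩
    · have hfin : ∀ m : Fin (n + 1), Finite (SubdiagonalSet m × SubdiagonalSet (n - m)) := by
        intro m
        have := (ih m m.2).1
        have := (ih (n - m) (by omega)).1
        infer_instance
      refine ⟨Finite.of_equiv _ (subdiagonalEquiv n), ?_⟩
      rw [← Nat.card_congr (subdiagonalEquiv n), Nat.card_sigma, catalan_succ]
      refine Finset.sum_congr rfl fun m _ => ?_
      rw [Nat.card_prod, (ih m m.2).2, (ih (n - m) (by omega)).2]

/-- Monotone self-maps of a linear order lying weakly below the identity. -/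
abbrev Regressive (B : Type*) [LinearOrder B] : Type _ :=
  {h : B → B // Monotone h ∧ ∀ x, h x ≤ x}

/-- Order isomorphic linear orders have the same regressive maps. -/
def regressiveCongr {B C : Type*} [LinearOrder B] [LinearOrder C] (e : B ≃o C) :
    Regressive B ≃ Regressive C where
  toFun h := ⟨fun x => e (h.1 (e.symm x)), fun x y hxy => e.monotone (h.2.1 (e.symm.monotone hxy)),
    fun x => by simpa using e.monotone (h.2.2 (e.symm x))⟩
  invFun h := ⟨fun x => e.symm (h.1 (e x)), fun x y hxy => e.symm.monotone (h.2.1 (e.monotone hxy)),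
    fun x => by simpa using e.symm.monotone (h.2.2 (e x))⟩
  left_inv h := by ext; simp
  right_inv h := by ext; simp

/-- Regressive maps on `Fin n` as functions on `ℕ`. -/
def regressiveFinEquiv (n : ℕ) : Regressive (Fin n) ≃ SubdiagonalSet n where
  toFun h := ⟨fun j => if hj : j < n then h.1 ⟨j, hj⟩ else 0, by
    refine ⟨fun i j hij hj => ?_, fun j => ?_, fun j hj => ?_⟩
    · dsimp only
      rw [dif_pos (hij.trans_lt hj), dif_pos hj]
      exact h.2.1 (by simpa using hij)
    · dsimp only
      split_ifs with hj
      · exact h.2.2 ⟨j, hj⟩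
      · exact Nat.zero_le _
    · dsimp only
      rw [dif_neg hj.not_gt]⟩
  invFun h := ⟨fun j => ⟨h.1 j, (h.2.2.1 j).trans_lt j.2⟩,
    fun i j hij => h.2.1 i j hij j.2, fun j => h.2.2.1 j⟩
  left_inv h := by ext j; simp
  right_inv h := by
    ext j
    by_cases hj : j < n
    · simp [hj]
    · simp [hj, h.2.2.2 j (not_lt.1 hj)]

theorem card_regressive (B : Type*) [LinearOrder B] [Fintype B] :
    Nat.card (Regressive B) = catalan (Fintype.card B) := by
  rw [Nat.card_congr (regressiveCongr (Fintype.orderIsoFinOfCardEq B rfl).symm),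
    Nat.card_congr (regressiveFinEquiv _), (card_subdiagonalSet _).2]

/-- The part of the canonical word indexed by `b`. -/
def canonicalRow {A : Type*} [LinearOrder A] (k : A → ℕ) {B : Finset A} (h : B → B)
    (c : (b : B) → ZMod (k b)) (b : B) : List A :=
  List.replicate (k b) (b : A) ++
    (List.replicate (k (h b)) (h b : A) ++ List.replicate (c b).val (b : A))

/-- The canonical word with support `B`, inversions given by `h` and letter counts given by `c`. -/
def canonicalWord {A : Type*} [LinearOrder A] (k : A → ℕ) {B : Finset A} (h : B → B)
    (c : (b : B) → ZMod (k b)) : List A :=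
  ((Finset.univ : Finset B).sort (· ≤ ·)).flatMap (canonicalRow k h c)

section CanonicalWord

variable {A : Type*} [LinearOrder A] {k : A → ℕ} {B : Finset A}

theorem mem_canonicalWord (hk : ∀ a, 1 ≤ k a) (h : B → B) (c : (b : B) → ZMod (k b)) (x : A) :
    x ∈ canonicalWord k h c ↔ x ∈ B := by
  simp only [canonicalWord, canonicalRow, List.mem_flatMap, List.mem_append, List.mem_replicate]
  constructor
  · rintro ⟨b, -, ⟨-, rfl⟩ | ⟨-, rfl⟩ | ⟨-, rfl⟩⟩
    exacts [b.2, (h b).2, b.2]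
  · intro hx
    have := hk x
    exact ⟨⟨x, hx⟩, by simp, Or.inl ⟨by simp; omega, rfl⟩⟩

theorem count_canonicalWord (hk : ∀ a, 1 ≤ k a) (h : B → B) (c : (b : B) → ZMod (k b)) (x : B) :
    (((canonicalWord k h c).count (x : A) : ℕ) : ZMod (k x)) = c x := by
  have : NeZero (k x) := ⟨by have := hk x; omega⟩
  have hrow : ∀ b : B, (((canonicalRow k h c b).count (x : A) : ℕ) : ZMod (k x)) =
      if b = x then c x else 0 := by
    intro b
    simp only [canonicalRow, List.count_append, List.count_replicate, beq_iff_eq, Nat.cast_add,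
      Nat.cast_ite, Nat.cast_zero]
    have e1 : (if (b : A) = x then ((k b : ℕ) : ZMod (k x)) else 0) = 0 := by
      split_ifs with hb
      · rw [hb, ZMod.natCast_self]
      · rfl
    have e2 : (if (h b : A) = x then ((k (h b) : ℕ) : ZMod (k x)) else 0) = 0 := by
      split_ifs with hb
      · rw [hb, ZMod.natCast_self]
      · rfl
    rw [e1, e2, zero_add, zero_add]
    by_cases hb : b = x
    · subst hb; simp
    · rw [if_neg hb, if_neg (fun e => hb (Subtype.ext e))]
  rw [canonicalWord, List.count_flatMap, ((Finset.sort_perm_toList _ _).map _).sum_eq,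
    Finset.sum_map_toList, Nat.cast_sum]
  simp [hrow]

theorem hasInv_canonicalWord (hk : ∀ a, 1 ≤ k a) (h : Regressive B) (c : (b : B) → ZMod (k b))
    {i j : A} :
    HasInv (canonicalWord k h.1 c) i j ↔ ∃ y : B, j ≤ y ∧ (h.1 y : A) ≤ i := by
  have hrow : ∀ b : B, ∀ x ∈ canonicalRow k h.1 c b, (h.1 b : A) ≤ x ∧ x ≤ b := by
    intro b x hx
    have hb : (h.1 b : A) ≤ b := h.2.2 b
    simp only [canonicalRow, List.mem_append, List.mem_replicate] at hx
    rcases hx with ⟨-, rfl⟩ | ⟨-, rfl⟩ | ⟨-, rfl⟩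
    exacts [⟨hb, le_rfl⟩, ⟨le_rfl, hb⟩, ⟨hb, le_rfl⟩]
  have key : ∀ l : List B, l.Pairwise (· ≤ ·) → (HasInv (l.flatMap (canonicalRow k h.1 c)) i j ↔
      ∃ y ∈ l, j ≤ y ∧ (h.1 y : A) ≤ i) := by
    intro l hl
    induction l with
    | nil => simp [HasInv]
    | cons b l ih =>
      obtain ⟨hb, hl⟩ := List.pairwise_cons.1 hl
      rw [List.flatMap_cons, hasInv_append, ih hl]
      constructor
      · rintro (⟨p, q, hs, hp, hq⟩ | ⟨y, hy, h1, h2⟩ | ⟨⟨p, hp, hjp⟩, ⟨q, hq, hqi⟩⟩)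
        · have hs := hs.subset
          exact ⟨b, by simp, hp.trans (hrow b p (hs (by simp))).2,
            (hrow b q (hs (by simp))).1.trans hq⟩
        · exact ⟨y, by simp [hy], h1, h2⟩
        · obtain ⟨b', hb', hq⟩ := List.mem_flatMap.1 hq
          have hle : (h.1 b : A) ≤ h.1 b' := h.2.1 (hb b' hb')
          exact ⟨b, by simp, hjp.trans (hrow b p hp).2, (hle.trans (hrow b' q hq).1).trans hqi⟩
      · rintro ⟨y, hy, h1, h2⟩
        rcases List.mem_cons.1 hy with rfl | hy
        · left
          have e1 := hk y
          have e2 := hk (h.1 y)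
          refine hasInv_append.2 (Or.inr (Or.inr ⟨⟨y, ?_, h1⟩, ⟨h.1 y, ?_, h2⟩⟩))
          · rw [List.mem_replicate]; exact ⟨by omega, rfl⟩
          · rw [List.mem_append, List.mem_replicate]; exact Or.inl ⟨by omega, rfl⟩
        · exact Or.inr (Or.inl ⟨y, hy, h1, h2⟩)
  rw [canonicalWord, key _ (Finset.pairwise_sort _ _)]
  simp

/-- The inversions of a word with support `B` are described by a regressive map. -/
theorem exists_regressive (w : List A) (hw : ∀ x, x ∈ w ↔ x ∈ B) :
    ∃ h : Regressive B, ∀ i j, i < j → (HasInv w i j ↔ ∃ y : B, j ≤ y ∧ (h.1 y : A) ≤ i) := by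
  classical
  let S : B → Finset B := fun y =>
    Finset.univ.filter fun x => x ≤ y ∧ (x = y ∨ HasInv w (x : A) (y : A))
  have hS : ∀ y : B, (S y).Nonempty := fun y => ⟨y, by simp [S]⟩
  have hmem : ∀ y : B, (S y).min' (hS y) ≤ y ∧
      ((S y).min' (hS y) = y ∨ HasInv w ((S y).min' (hS y) : A) (y : A)) := fun y => by
    simpa [S] using (S y).min'_mem (hS y)
  have hmin : ∀ y x : B, x ≤ y → (x = y ∨ HasInv w (x : A) (y : A)) → (S y).min' (hS y) ≤ x :=
    fun y x h1 h2 => (S y).min'_le x (by simpa [S] using ⟨h1, h2⟩)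
  refine ⟨⟨fun y => (S y).min' (hS y), fun y y' hyy => ?_, fun y => (hmem y).1⟩,
    fun i j hij => ⟨?_, ?_⟩⟩
  · dsimp only
    obtain ⟨h1, h2⟩ := hmem y'
    rcases le_or_gt y ((S y').min' (hS y')) with hle | hlt
    · exact (hmem y).1.trans hle
    · refine hmin y _ hlt.le (Or.inr ?_)
      rcases h2 with h2 | h2
      · exact absurd (h2 ▸ hlt) hyy.not_gt
      · exact h2.mono le_rfl hyy
  · rintro ⟨p, q, hs, hp, hq⟩
    have hqp : q < p := hq.trans_lt (hij.trans_le hp)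
    have hpB := (hw p).1 (hs.subset (by simp))
    have hqB := (hw q).1 (hs.subset (by simp))
    have := hmin ⟨p, hpB⟩ ⟨q, hqB⟩ hqp.le (Or.inr ⟨p, q, hs, le_rfl, le_rfl⟩)
    exact ⟨⟨p, hpB⟩, hp, le_trans this hq⟩
  · rintro ⟨y, hjy, hyi⟩
    rcases (hmem y).2 with h2 | h2
    · exact absurd (hjy.trans (h2 ▸ hyi)) hij.not_ge
    · exact h2.mono hyi hjy

theorem regressive_ext {h h' : Regressive B}
    (H : ∀ i j : A, i < j → ((∃ y : B, j ≤ y ∧ (h.1 y : A) ≤ i) ↔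
      ∃ y : B, j ≤ y ∧ (h'.1 y : A) ≤ i)) : h = h' := by
  have key : ∀ {h h' : Regressive B}, (∀ i j : A, i < j → (∃ y : B, j ≤ y ∧ (h.1 y : A) ≤ i) →
      ∃ y : B, j ≤ y ∧ (h'.1 y : A) ≤ i) → ∀ y, h'.1 y ≤ h.1 y := by
    intro h h' H y
    rcases (h.2.2 y).eq_or_lt with e | hlt
    · rw [e]; exact h'.2.2 y
    · obtain ⟨y', h1, h2⟩ := H (h.1 y) y hlt ⟨y, le_rfl, le_rfl⟩
      exact (h'.2.1 (show y ≤ y' from h1)).trans h2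
  exact Subtype.ext (funext fun y => le_antisymm (key (fun i j hij => (H i j hij).2) y)
    (key (fun i j hij => (H i j hij).1) y))

end CanonicalWord

/-- Words with the same invariants form a congruence. -/
def sameInvCon {A : Type*} [LinearOrder A] (k : A → ℕ) : Con (FreeMonoid A) where
  r U V := SameInv k U.toList V.toList
  iseqv :=
    { refl := fun _ => ⟨fun _ => Iff.rfl, fun _ => rfl, fun _ _ _ => Iff.rfl⟩
      symm := fun h => ⟨fun x => (h.mem x).symm, fun x => (h.count x).symm,
        fun i j hij => (h.inv i j hij).symm⟩
      trans := fun h h' => ⟨fun x => (h.mem x).trans (h'.mem x),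
        fun x => (h.count x).trans (h'.count x),
        fun i j hij => (h.inv i j hij).trans (h'.inv i j hij)⟩ }
  mul' h h' := by
    refine ⟨fun x => ?_, fun x => ?_, fun i j hij => ?_⟩
    · simp [FreeMonoid.toList_mul, h.mem x, h'.mem x]
    · simpa [FreeMonoid.toList_mul] using (h.count x).add (h'.count x)
    · rw [FreeMonoid.toList_mul, FreeMonoid.toList_mul, hasInv_append, hasInv_append,
        h.inv i j hij, h'.inv i j hij]
      simp only [h.mem, h'.mem]

theorem hasInv_nil {A : Type*} [LinearOrder A] (i j : A) : ¬ HasInv [] i j := by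
  rintro ⟨p, q, h, -⟩
  simp at h

theorem hasInv_cons {A : Type*} [LinearOrder A] {a : A} {l : List A} {i j : A} :
    HasInv (a :: l) i j ↔ HasInv l i j ∨ (j ≤ a ∧ ∃ q ∈ l, q ≤ i) := by
  have : ¬ HasInv [a] i j := by
    rintro ⟨p, q, h, -⟩
    simpa using h.length_le
  simpa [this] using hasInv_append (l := [a]) (l' := l) (i := i) (j := j)

theorem hasInv_replicate {A : Type*} [LinearOrder A] {a i j : A} (hij : i < j) (m : ℕ) :
    ¬ HasInv (List.replicate m a) i j := by
  rintro ⟨p, q, h, hp, hq⟩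
  have h1 := List.eq_of_mem_replicate (h.subset (show p ∈ [p, q] by simp))
  have h2 := List.eq_of_mem_replicate (h.subset (show q ∈ [p, q] by simp))
  subst h1 h2
  exact absurd (hp.trans hq) hij.not_ge

theorem chineseCon_le_sameInvCon {A : Type*} [LinearOrder A] (σ : A → ℕ) (hσ : ∀ a, 2 ≤ σ a) :
    chineseCon σ ≤ sameInvCon fun a => σ a - 1 := by
  have e : ∀ a b c : A, FreeMonoid.toList (FreeMonoid.of a * FreeMonoid.of b * FreeMonoid.of c) =
    [a, b, c] := fun _ _ _ => rfl
  refine Con.conGen_le.2 ?_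
  rintro U V (⟨a, b, c, hab, hbc, rfl, rfl⟩ | ⟨a, b, c, hab, hbc, rfl, rfl⟩ |
    ⟨a, b, hab, rfl, rfl⟩ | ⟨a, b, hab, rfl, rfl⟩ | ⟨a, rfl, rfl⟩)
  iterate 4
    · change SameInv _ _ _
      rw [e, e]
      refine ⟨fun x => by simp; tauto, fun x => ?_, fun i j hij => ?_⟩
      · simp only [List.count_cons, List.count_nil]; congr 1; omega
      · simp only [hasInv_cons, hasInv_nil, List.mem_cons, List.not_mem_nil]; grind
  · have ha := hσ a
    change SameInv _ _ _
    have e1 : FreeMonoid.toList (FreeMonoid.of a ^ σ a) = List.replicate (σ a) a := by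
      induction σ a with
      | zero => rfl
      | succ n ih => rw [pow_succ', FreeMonoid.toList_mul, ih]; rfl
    have e2 : FreeMonoid.toList (FreeMonoid.of a) = List.replicate 1 a := rfl
    rw [e1, e2]
    refine ⟨fun x => by simp; omega, fun x => ?_, fun i j hij => ?_⟩
    · simp only [List.count_replicate]
      split_ifs with h
      · obtain rfl : a = x := by simpa using h
        obtain ⟨m, hm⟩ := Nat.exists_eq_add_of_le' ha
        rw [hm, show m + 2 = m + 2 - 1 + 1 by omega]
        simp [Nat.ModEq]
      · rfl
    · simp only [hasInv_replicate hij]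

theorem isChineseFamily_of {A : Type*} [LinearOrder A] (σ : A → ℕ) (hσ : ∀ a, 2 ≤ σ a) :
    IsChineseFamily (fun a => σ a - 1)
      (fun a => ((FreeMonoid.of a : FreeMonoid A) : (chineseCon σ).Quotient)) := by
  have rel : ∀ {U V : FreeMonoid A}, chineseRel σ U V →
      (U : (chineseCon σ).Quotient) = (V : (chineseCon σ).Quotient) :=
    fun h => (Con.eq _).2 (ConGen.Rel.of _ _ h)
  refine ⟨fun a => by have := hσ a; omega, fun a => ?_, fun a b c hab hbc => ?_,
    fun a b c hab hbc => ?_⟩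
  · have ha := hσ a
    rw [show σ a - 1 + 1 = σ a by omega]
    exact rel (by unfold chineseRel; exact Or.inr (Or.inr (Or.inr (Or.inr ⟨a, rfl, rfl⟩))))
  · rcases hab.eq_or_lt with rfl | hab
    · rfl
    rcases hbc.eq_or_lt with rfl | hbc
    · exact rel (Or.inr (Or.inr (Or.inr (Or.inl ⟨a, b, hab, rfl, rfl⟩))))
    · exact rel (Or.inl ⟨a, b, c, hab, hbc, rfl, rfl⟩)
  · rcases hab.eq_or_lt with rfl | hab
    · rcases hbc.eq_or_lt with rfl | hbc
      · rfl
      · exact (rel (Or.inr (Or.inr (Or.inl ⟨a, c, hbc, rfl, rfl⟩)))).symm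
    rcases hbc.eq_or_lt with rfl | hbc
    · exact (rel (Or.inr (Or.inr (Or.inr (Or.inl ⟨a, b, hab, rfl, rfl⟩))))).symm
    · exact rel (Or.inr (Or.inl ⟨a, b, c, hab, hbc, rfl, rfl⟩))

theorem chineseCon_iff_sameInv {A : Type*} [LinearOrder A] (σ : A → ℕ) (hσ : ∀ a, 2 ≤ σ a)
    (U V : FreeMonoid A) :
    chineseCon σ U V ↔ SameInv (fun a => σ a - 1) U.toList V.toList := by
  refine ⟨fun h => chineseCon_le_sameInvCon σ hσ h, fun h => (Con.eq _).1 ?_⟩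
  have key : ∀ W : FreeMonoid A, (W : (chineseCon σ).Quotient) =
      (W.toList.map fun a => ((FreeMonoid.of a : FreeMonoid A) : (chineseCon σ).Quotient)).prod := by
    intro W
    induction W using FreeMonoid.inductionOn' with
    | one => rfl
    | of_mul a W ih => rw [Con.coe_mul, ih]; rfl
  rw [key, key]
  exact (isChineseFamily_of σ hσ).prod_eq_of_sameInv U.toList.toFinset _ _ (by simp) h

/-- The σ-Chinese monoid is parametrised by supports, regressive maps and letter counts. -/
noncomputable def chineseEquiv {A : Type*} [LinearOrder A] (σ : A → ℕ) (hσ : ∀ a, 2 ≤ σ a) :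
    (Σ B : Finset A, Regressive B × ((b : B) → ZMod (σ b - 1))) ≃ (chineseCon σ).Quotient :=
  Equiv.ofBijective
    (fun x => (FreeMonoid.ofList (canonicalWord (fun a => σ a - 1) x.2.1.1 x.2.2) :)) <| by
    have hk : ∀ a, 1 ≤ (fun a => σ a - 1) a := fun a => by have := hσ a; dsimp only; omega
    constructor
    · rintro ⟨B, h, c⟩ ⟨B', h', c'⟩ e
      have e := (chineseCon_iff_sameInv σ hσ _ _).1 ((Con.eq _).1 e)
      simp only [FreeMonoid.toList_ofList] at e
      obtain rfl : B = B' := by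
        ext x
        rw [← mem_canonicalWord hk h.1 c, ← mem_canonicalWord hk h'.1 c', e.mem]
      obtain rfl : h = h' := regressive_ext fun i j hij => by
        rw [← hasInv_canonicalWord hk h c, ← hasInv_canonicalWord hk h' c', e.inv i j hij]
      obtain rfl : c = c' := funext fun x => by
        have := (ZMod.natCast_eq_natCast_iff _ _ _).2 (e.count x)
        rwa [count_canonicalWord hk h.1 c, count_canonicalWord hk h.1 c'] at this
      rfl
    · intro q
      induction q using Con.induction_on with
      | _ W =>
        obtain ⟨h, hh⟩ := exists_regressive (B := W.toList.toFinset) W.toList (by simp)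
        refine ⟨⟨W.toList.toFinset, h, fun b => (W.toList.count (b : A) : ℕ)⟩,
          (Con.eq _).2 ((chineseCon_iff_sameInv σ hσ _ _).2 ⟨fun x => ?_, fun x => ?_,
            fun i j hij => ?_⟩)⟩
        · rw [FreeMonoid.toList_ofList, mem_canonicalWord hk, List.mem_toFinset]
        · rw [FreeMonoid.toList_ofList]
          by_cases hx : x ∈ W.toList
          · exact (ZMod.natCast_eq_natCast_iff _ _ _).1
              (count_canonicalWord hk h.1 _ ⟨x, List.mem_toFinset.2 hx⟩)
          · rw [List.count_eq_zero_of_not_mem hx, List.count_eq_zero_of_not_mem]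
            rwa [mem_canonicalWord hk, List.mem_toFinset]
        · rw [FreeMonoid.toList_ofList, hasInv_canonicalWord hk _ _, hh i j hij]

/-- The σ-Chinese monoid `Ch(A, σ)` is finite, of cardinality
`Σ_{B ⊆ A} Catalan(|B|) · Π_{b ∈ B} (σ(b) - 1)`. -/
theorem card_chinese {A : Type*} [LinearOrder A] [Fintype A]
    (σ : A → ℕ) (hσ : ∀ a : A, 2 ≤ σ a) :
    Finite (chineseCon σ).Quotient ∧
      Nat.card (chineseCon σ).Quotient =
        ∑ B : Finset A, catalan B.card * ∏ b ∈ B, (σ b - 1) := by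
  have : ∀ a, NeZero (σ a - 1) := fun a => ⟨by have := hσ a; omega⟩
  refine ⟨Finite.of_equiv _ (chineseEquiv σ hσ), ?_⟩
  rw [← Nat.card_congr (chineseEquiv σ hσ), Nat.card_sigma]
  refine Finset.sum_congr rfl fun B _ => ?_
  rw [Nat.card_prod, card_regressive, Fintype.card_coe, Nat.card_pi,
    ← Finset.prod_coe_sort B fun b => σ b - 1]
  simp only [Nat.card_zmod]
end

section
/- Let A be a finite totally ordered alphabet with |A| = n. Then the stylic monoid Plax(A,2) is finite and its cardinality is |Plax(A,2)| = Σ_{k=0}^{n} binomial(n,k) · Bell(k), the binomial transform of the Bell numbers. -/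
/-- The defining relations of the stylic monoid `Plax(A, 2)`: the Knuth relations
together with `a² = a` for every letter `a`. -/
def stylicRel {A : Type*} [LinearOrder A] (U V : FreeMonoid A) : Prop :=
  (∃ a b c : A, a ≤ b ∧ b < c ∧
    U = FreeMonoid.of a * FreeMonoid.of c * FreeMonoid.of b ∧
    V = FreeMonoid.of c * FreeMonoid.of a * FreeMonoid.of b) ∨
  (∃ a b c : A, a < b ∧ b ≤ c ∧
    U = FreeMonoid.of b * FreeMonoid.of a * FreeMonoid.of c ∧
    V = FreeMonoid.of b * FreeMonoid.of c * FreeMonoid.of a) ∨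
  (∃ a : A, U = FreeMonoid.of a * FreeMonoid.of a ∧ V = FreeMonoid.of a)

/-- The congruence on the free monoid defining the stylic monoid `Plax(A, 2)`. -/
def stylicCon (A : Type*) [LinearOrder A] : Con (FreeMonoid A) :=
  conGen stylicRel

/-- The `k`-th Bell number: the number of equivalence relations on a `k`-element set. -/
noncomputable def bellNumber (k : ℕ) : ℕ :=
  Nat.card {r : Fin k → Fin k → Prop // Equivalence r}

namespace Stylic

variable {A : Type*} [LinearOrder A]

/-! ### Words in the stylic monoid -/

/-- The image of a word in the stylic monoid. -/
def eval (l : List A) : (stylicCon A).Quotient :=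
  (stylicCon A).mk' (FreeMonoid.ofList l)

@[simp] lemma eval_append (l l' : List A) : eval (l ++ l') = eval l * eval l' := by
  simp [eval, FreeMonoid.ofList_append]

lemma eval_cons (a : A) (l : List A) : eval (a :: l) = eval [a] * eval l :=
  eval_append [a] l

lemma eval_surjective : Function.Surjective (eval : List A → (stylicCon A).Quotient) :=
  Con.mk'_surjective.comp FreeMonoid.ofList.surjective

lemma eval_eq_of_rel {l l' : List A}
    (h : stylicRel (FreeMonoid.ofList l) (FreeMonoid.ofList l')) : eval l = eval l' :=
  (Con.eq _).2 (ConGen.Rel.of _ _ h)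

lemma eval_knuth_left {a b c : A} (hab : a ≤ b) (hbc : b < c) :
    eval [a, c, b] = eval [c, a, b] :=
  eval_eq_of_rel (Or.inl ⟨a, b, c, hab, hbc, rfl, rfl⟩)

lemma eval_knuth_right {a b c : A} (hab : a < b) (hbc : b ≤ c) :
    eval [b, a, c] = eval [b, c, a] :=
  eval_eq_of_rel (Or.inr (Or.inl ⟨a, b, c, hab, hbc, rfl, rfl⟩))

lemma eval_idem (a : A) : eval [a, a] = eval [a] :=
  eval_eq_of_rel (Or.inr (Or.inr ⟨a, rfl, rfl⟩))

/-- A letter moves to the left through a sorted sequence of larger letters,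
up to the leftmost of them. -/
lemma eval_cons_append_singleton {x : A} (v : List A) (y : A) (hxy : x < y)
    (hv : (y :: v).Pairwise (· < ·)) : eval (y :: (v ++ [x])) = eval (y :: x :: v) := by
  induction v generalizing y with
  | nil => rfl
  | cons z v ih =>
    have hyz : y < z := (List.pairwise_cons.1 hv).1 z (by simp)
    calc eval (y :: (z :: v ++ [x])) = eval [y] * eval (z :: (v ++ [x])) := eval_cons _ _
      _ = eval [y] * eval (z :: x :: v) := by rw [ih z (hxy.trans hyz) hv.of_cons]
      _ = eval [y, z, x] * eval v := by rw [← eval_append, ← eval_append]; rfl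
      _ = eval [y, x, z] * eval v := by rw [eval_knuth_right hxy hyz.le]
      _ = eval (y :: x :: z :: v) := by rw [← eval_append]; rfl

/-- A letter moves to the left through a sorted sequence of smaller letters, as long as one of
these remains on its right. -/
lemma eval_append_pair {x y : A} (hxy : x < y) (u : List A)
    (hu : (u ++ [x]).Pairwise (· ≤ ·)) : eval (u ++ [y, x]) = eval (y :: (u ++ [x])) := by
  induction u with
  | nil => rfl
  | cons a u ih =>
    rw [List.cons_append] at hu ⊢
    obtain ⟨ha, hu⟩ := List.pairwise_cons.1 hu
    obtain ⟨b, t, hb⟩ : ∃ b t, u ++ [x] = b :: t := List.exists_cons_of_ne_nil (by simp)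
    have hbx : b ≤ x := by
      have hx : x ∈ b :: t := hb ▸ (by simp)
      rw [hb] at hu
      rcases List.mem_cons.1 hx with rfl | hx
      · exact le_rfl
      · exact (List.pairwise_cons.1 hu).1 x hx
    have hab : a ≤ b := ha b (by simp [hb])
    calc eval (a :: (u ++ [y, x])) = eval [a] * eval (u ++ [y, x]) := eval_cons _ _
      _ = eval [a] * eval (y :: b :: t) := by rw [ih hu, hb]
      _ = eval [a, y, b] * eval t := by rw [← eval_append, ← eval_append]; rfl
      _ = eval [y, a, b] * eval t := by rw [eval_knuth_left hab (hbx.trans_lt hxy)]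
      _ = eval (y :: a :: (u ++ [x])) := by rw [← eval_append, hb]; rfl

/-- Absorption of a copy of `y` on the right of a smaller letter. -/
lemma eval_pair_absorb {x y : A} (hxy : x < y) : eval [y, x, y] = eval [y, x] := by
  rw [eval_knuth_right hxy le_rfl]
  rw [eval_cons y [y, x], eval_cons y [x], ← mul_assoc, ← eval_append]
  exact congrArg (· * eval [x]) (eval_idem y)

/-! ### Insertion of a letter into a row -/

lemma sort_union_of_lt {S T : Finset A} (h : ∀ a ∈ S, ∀ b ∈ T, a < b) :
    (S ∪ T).sort (· ≤ ·) = S.sort (· ≤ ·) ++ T.sort (· ≤ ·) := by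
  have hl : (S.sort (· ≤ ·) ++ T.sort (· ≤ ·)).Pairwise (· < ·) := by
    refine List.pairwise_append.2 ⟨S.sortedLT_sort.pairwise, T.sortedLT_sort.pairwise, ?_⟩
    simpa using h
  have := (List.toFinset_sort (· ≤ ·) (hl.imp ne_of_lt)).2 (hl.imp le_of_lt)
  rwa [List.toFinset_append, Finset.sort_toFinset, Finset.sort_toFinset] at this

/-- The increasing word whose letters are the elements of a finite set. -/
def row (S : Finset A) : (stylicCon A).Quotient := eval (S.sort (· ≤ ·))

lemma row_insert_of_forall_le {S : Finset A} {x : A} (h : ∀ a ∈ S, a ≤ x) :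
    row S * eval [x] = row (insert x S) := by
  have key : ∀ T : Finset A, (∀ a ∈ T, a < x) → row (insert x T) = row T * eval [x] := by
    intro T hT
    rw [row, Finset.insert_eq, Finset.union_comm, sort_union_of_lt (by simpa using hT)]
    simp [row]
  by_cases hx : x ∈ S
  · have hS : ∀ a ∈ S.erase x, a < x := fun a ha =>
      lt_of_le_of_ne (h a (Finset.mem_of_mem_erase ha)) (Finset.ne_of_mem_erase ha)
    rw [Finset.insert_eq_of_mem hx, ← Finset.insert_erase hx, key _ hS, mul_assoc,
      ← eval_append]
    simp only [List.cons_append, List.nil_append, eval_idem]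
  · exact (key S fun a ha => lt_of_le_of_ne (h a ha) (ne_of_mem_of_not_mem ha hx)).symm

lemma row_insert_bump {S : Finset A} {x y : A} (hxy : x < y) (hy : y ∈ S)
    (hmin : ∀ a ∈ S, x < a → y ≤ a) : row S * eval [x] = eval [y] * row (insert x S) := by
  set U := S.filter (· ≤ x) with hU
  set V := S.filter (y < ·) with hV
  have hS : S = U ∪ ({y} ∪ V) := by
    ext a
    simp only [hU, hV, Finset.mem_union, Finset.mem_filter, Finset.mem_singleton]
    constructor
    · intro ha
      rcases le_or_gt a x with h | h
      · exact Or.inl ⟨ha, h⟩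
      · exact Or.inr ((hmin a ha h).eq_or_lt.imp Eq.symm fun h => ⟨ha, h⟩)
    · rintro (h | rfl | h)
      exacts [h.1, hy, h.1]
  have hyV : ∀ a ∈ ({y} : Finset A), ∀ b ∈ V, a < b := by simp +contextual [hV]
  have hrow : ∀ T : Finset A, (∀ a ∈ T, a ≤ x) →
      row (T ∪ ({y} ∪ V)) = row T * (eval [y] * row V) := by
    intro T hT
    rw [row, sort_union_of_lt, sort_union_of_lt hyV]
    · simp [row, eval_cons y (V.sort _)]
    · intro a ha b hb
      refine (hT a ha).trans_lt ?_
      rcases Finset.mem_union.1 hb with hb | hb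
      · rwa [Finset.mem_singleton.1 hb]
      · exact hxy.trans (Finset.mem_filter.1 hb).2
  have hUx : ∀ a ∈ U, a ≤ x := fun a ha => (Finset.mem_filter.1 ha).2
  have h1 : eval [y] * row V * eval [x] = eval [y] * eval [x] * row V := by
    have := eval_cons_append_singleton (V.sort (· ≤ ·)) y hxy
      (List.pairwise_cons.2 ⟨fun b hb => hyV y (by simp) b ((Finset.mem_sort _).1 hb),
        V.sortedLT_sort.pairwise⟩)
    rw [eval_cons, eval_cons y (x :: _), eval_cons x, eval_append] at this
    rw [row, mul_assoc, this, mul_assoc]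
  have h2 : row U * (eval [y] * eval [x]) = eval [y] * (row U * eval [x]) := by
    have := eval_append_pair hxy (U.sort (· ≤ ·)) (by
      refine List.pairwise_append.2 ⟨(U.sortedLT_sort.pairwise).imp le_of_lt, by simp, ?_⟩
      simpa using hUx)
    rw [eval_cons, eval_append, eval_append, eval_cons y [x]] at this
    exact this
  have h3 : eval [y] * eval [x] * eval [y] = eval [y] * eval [x] := by
    simpa [eval_cons y [x, y], eval_cons x [y], eval_cons y [x], mul_assoc]
      using eval_pair_absorb hxy
  calc row S * eval [x] = row U * (eval [y] * row V * eval [x]) := by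
        rw [hS, hrow U hUx]; simp only [mul_assoc]
    _ = row U * (eval [y] * eval [x]) * row V := by rw [h1]; simp only [mul_assoc]
    _ = row U * (eval [y] * eval [x] * eval [y]) * row V := by rw [h3]
    _ = row U * (eval [y] * eval [x]) * eval [y] * row V := by simp only [mul_assoc]
    _ = eval [y] * (row U * eval [x] * (eval [y] * row V)) := by
      rw [h2]; simp only [mul_assoc]
    _ = eval [y] * row (insert x S) := by
      rw [row_insert_of_forall_le hUx, ← hrow _ (by simpa using hUx), Finset.insert_union, ← hS]

/-! ### Decreasing subwords -/

/-- Every strictly decreasing subword of `w` can be replaced by a strictly decreasing subword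
of `w'`, of the same length and in the convex hull of its letters. -/
def DecreasingDominated (w w' : List A) : Prop :=
  ∀ s : List A, s.Sublist w → s.Pairwise (· > ·) →
    ∃ s' : List A, s'.Sublist w' ∧ s'.Pairwise (· > ·) ∧ s'.length = s.length ∧
      ∀ x ∈ s', (∃ y ∈ s, y ≤ x) ∧ ∃ z ∈ s, x ≤ z

lemma DecreasingDominated.refl (w : List A) : DecreasingDominated w w :=
  fun s hs hd => ⟨s, hs, hd, rfl, fun x hx => ⟨⟨x, hx, le_rfl⟩, x, hx, le_rfl⟩⟩

lemma DecreasingDominated.trans {u v w : List A} (huv : DecreasingDominated u v)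
    (hvw : DecreasingDominated v w) : DecreasingDominated u w := by
  intro s hs hd
  obtain ⟨s', hs', hd', hl', hc'⟩ := huv s hs hd
  obtain ⟨t, ht, hdt, hlt, hct⟩ := hvw s' hs' hd'
  refine ⟨t, ht, hdt, hlt.trans hl', fun x hx => ?_⟩
  obtain ⟨⟨y, hy, hyx⟩, z, hz, hxz⟩ := hct x hx
  obtain ⟨y', hy', hyy⟩ := (hc' y hy).1
  obtain ⟨z', hz', hzz⟩ := (hc' z hz).2
  exact ⟨⟨y', hy', hyy.trans hyx⟩, z', hz', hxz.trans hzz⟩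

lemma DecreasingDominated.append {u u' v v' : List A} (hu : DecreasingDominated u u')
    (hv : DecreasingDominated v v') : DecreasingDominated (u ++ v) (u' ++ v') := by
  intro s hs hd
  obtain ⟨s₁, s₂, rfl, hs₁, hs₂⟩ := List.sublist_append_iff.1 hs
  obtain ⟨hd₁, hd₂, hd⟩ := List.pairwise_append.1 hd
  obtain ⟨t₁, ht₁, he₁, hl₁, hc₁⟩ := hu s₁ hs₁ hd₁
  obtain ⟨t₂, ht₂, he₂, hl₂, hc₂⟩ := hv s₂ hs₂ hd₂
  refine ⟨t₁ ++ t₂, ht₁.append ht₂, List.pairwise_append.2 ⟨he₁, he₂, fun a ha b hb => ?_⟩,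
    by simp [hl₁, hl₂], fun x hx => ?_⟩
  · obtain ⟨y, hy, hya⟩ := (hc₁ a ha).1
    obtain ⟨z, hz, hbz⟩ := (hc₂ b hb).2
    exact hbz.trans_lt ((hd y hy z hz).trans_le hya)
  · rcases List.mem_append.1 hx with hx | hx
    · obtain ⟨⟨y, hy, hyx⟩, z, hz, hxz⟩ := hc₁ x hx
      exact ⟨⟨y, by simp [hy], hyx⟩, z, by simp [hz], hxz⟩
    · obtain ⟨⟨y, hy, hyx⟩, z, hz, hxz⟩ := hc₂ x hx
      exact ⟨⟨y, by simp [hy], hyx⟩, z, by simp [hz], hxz⟩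

variable (A) in
/-- The congruence of words dominating each other. -/
def decreasingCon : Con (FreeMonoid A) where
  r u v := DecreasingDominated u.toList v.toList ∧ DecreasingDominated v.toList u.toList
  iseqv := ⟨fun _ => ⟨.refl _, .refl _⟩, fun h => h.symm,
    fun h h' => ⟨h.1.trans h'.1, h'.2.trans h.2⟩⟩
  mul' hu hv := ⟨hu.1.append hv.1, hu.2.append hv.2⟩

/-- To check domination, one may discard the subwords which occur in both words. -/
lemma dominated_of_forall {w w' : List A}
    (H : ∀ s : List A, s.Sublist w → s.Pairwise (· > ·) → s.Sublist w' ∨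
      ∃ s' : List A, s'.Sublist w' ∧ s'.Pairwise (· > ·) ∧ s'.length = s.length ∧
      ∀ x ∈ s', (∃ y ∈ s, y ≤ x) ∧ ∃ z ∈ s, x ≤ z) : DecreasingDominated w w' := by
  intro s hs hd
  rcases H s hs hd with h | h
  · exact DecreasingDominated.refl w' s h hd
  · exact h

lemma decreasingCon_of_stylicRel {u v : FreeMonoid A} (h : stylicRel u v) :
    decreasingCon A u v := by
  have pair : ∀ {x y : A} {s : List A}, s.Sublist [x, y] ↔
      s = [] ∨ s = [x] ∨ s = [y] ∨ s = [x, y] := by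
    intro x y s
    rw [← List.mem_sublists]
    simp [List.sublists]
  have triple : ∀ {x y z : A} {s : List A}, s.Sublist [x, y, z] ↔
      s = [] ∨ s = [x] ∨ s = [y] ∨ s = [z] ∨ s = [x, y] ∨ s = [x, z] ∨ s = [y, z] ∨
        s = [x, y, z] := by
    intro x y z s
    rw [← List.mem_sublists]
    simp [List.sublists]
    tauto
  rcases h with ⟨a, b, c, hab, hbc, rfl, rfl⟩ | ⟨a, b, c, hab, hbc, rfl, rfl⟩ | ⟨a, rfl, rfl⟩
  · change DecreasingDominated [a, c, b] [c, a, b] ∧ DecreasingDominated [c, a, b] [a, c, b]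
    constructor <;> apply dominated_of_forall <;> intro s hs hd
    · left
      rcases triple.1 hs with rfl | rfl | rfl | rfl | rfl | rfl | rfl | rfl <;>
        first | (refine triple.2 ?_; simp; done) | (simp at hd; grind)
    · by_cases e : s = [c, a]
      · subst e
        exact Or.inr ⟨[c, b], by simp, by simpa, rfl, by simp [hab, hbc.le]⟩
      · left
        rcases triple.1 hs with rfl | rfl | rfl | rfl | rfl | rfl | rfl | rfl <;>
          first | (refine triple.2 ?_; simp; done) | (simp at hd; grind)
  · change DecreasingDominated [b, a, c] [b, c, a] ∧ DecreasingDominated [b, c, a] [b, a, c]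
    constructor <;> apply dominated_of_forall <;> intro s hs hd
    · left
      rcases triple.1 hs with rfl | rfl | rfl | rfl | rfl | rfl | rfl | rfl <;>
        first | (refine triple.2 ?_; simp; done) | (simp at hd; grind)
    · by_cases e : s = [c, a]
      · subst e
        exact Or.inr ⟨[b, a], by simp, by simpa, rfl, by simp [hab.le, hbc]⟩
      · left
        rcases triple.1 hs with rfl | rfl | rfl | rfl | rfl | rfl | rfl | rfl <;>
          first | (refine triple.2 ?_; simp; done) | (simp at hd; grind)
  · change DecreasingDominated [a, a] [a] ∧ DecreasingDominated [a] [a, a]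
    constructor <;> apply dominated_of_forall <;> intro s hs hd <;> left
    · rcases pair.1 hs with rfl | rfl | rfl | rfl <;> simp at hd ⊢
    · exact hs.trans (by simp)

lemma dominated_of_eval_eq {w w' : List A} (h : eval w = eval w') : DecreasingDominated w w' :=
  by
  have hle : stylicCon A ≤ decreasingCon A :=
    Con.conGen_le.2 fun _ _ => decreasingCon_of_stylicRel
  exact (hle ((Con.eq _).1 h)).1

/-! ### Restricted growth functions and their words -/

/-- A function has restricted growth if each of its values `p + 2` is preceded by the value
`p + 1`. -/
def RestrictedGrowth (h : A → ℕ) : Prop :=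
  ∀ a p, h a = p + 2 → ∃ b < a, h b = p + 1

lemma RestrictedGrowth.exists_lt {h : A → ℕ} (hh : RestrictedGrowth h) {p : ℕ} (a : A)
    (hp : p + 1 < h a) : ∃ b < a, h b = p + 1 := by
  obtain ⟨k, hk⟩ := Nat.exists_eq_add_of_lt hp
  induction k generalizing a with
  | zero => exact hh a p (by omega)
  | succ k ih =>
    obtain ⟨b, hba, hb⟩ := hh a (p + k + 1) (by omega)
    obtain ⟨c, hcb, hc⟩ := ih b (by omega) (by omega)
    exact ⟨c, hcb.trans hba, hc⟩

/-- Raising a value to `p + 1` preserves restricted growth when `p` is reached before. -/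
lemma RestrictedGrowth.update {h : A → ℕ} (hh : RestrictedGrowth h) {p : ℕ} {x : A}
    (hx : h x = p) (hp : p = 0 ∨ ∃ z < x, p ≤ h z) :
    RestrictedGrowth (Function.update h x (p + 1)) := by
  have hp' : p = 0 ∨ ∃ z < x, h z = p := by
    obtain _ | p := p
    · exact Or.inl rfl
    · obtain h0 | ⟨z, hz, hpz⟩ := hp
      · exact Or.inl h0
      · rcases hpz.eq_or_lt with e | hlt
        · exact Or.inr ⟨z, hz, e.symm⟩
        · obtain ⟨b, hb, e⟩ := hh.exists_lt z hlt
          exact Or.inr ⟨b, hb.trans hz, e⟩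
  intro a q ha
  rcases eq_or_ne a x with rfl | hax
  · rw [Function.update_self] at ha
    obtain rfl | ⟨z, hz, e⟩ := hp'
    · omega
    · exact ⟨z, hz, by rw [Function.update_of_ne hz.ne]; omega⟩
  · rw [Function.update_of_ne hax] at ha
    obtain ⟨b, hb, e⟩ := hh a q ha
    rcases eq_or_ne b x with rfl | hbx
    · obtain rfl | ⟨z, hz, e'⟩ := hp'
      · omega
      · exact ⟨z, hz.trans hb, by rw [Function.update_of_ne hz.ne]; omega⟩
    · exact ⟨b, hb, by rwa [Function.update_of_ne hbx]⟩

/-- A list is a row chain for `h` above `p` if its letters, read from the end, can be picked in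
the successive rows `p, p + 1, …` of `h`. -/
def RowChain {α : Type*} (h : α → ℕ) : ℕ → List α → Prop
  | _, [] => True
  | p, a :: t => p + t.length < h a ∧ RowChain h p t

lemma rowChain_append_singleton {α : Type*} {h : α → ℕ} {p : ℕ} {t : List α} {z : α} :
    RowChain h p (t ++ [z]) ↔ RowChain h (p + 1) t ∧ p < h z := by
  induction t with
  | nil => simp [RowChain]
  | cons a t ih =>
    simp only [List.cons_append, RowChain, ih, List.length_append, List.length_singleton]
    rw [and_assoc]
    exact and_congr_left fun _ => by omega

lemma RowChain.mono {α : Type*} {h : α → ℕ} {p p' : ℕ} (hp : p ≤ p') {s : List α}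
    (hs : RowChain h p' s) : RowChain h p s := by
  induction s with
  | nil => trivial
  | cons a t ih => exact ⟨(Nat.add_le_add_right hp _).trans_lt hs.1, ih hs.2⟩

lemma RestrictedGrowth.exists_rowChain {h : A → ℕ} (hh : RestrictedGrowth h) (m : ℕ) (a : A)
    (ha : h a = m + 1) : ∃ t : List A, (a :: t).Pairwise (· > ·) ∧ RowChain h 0 (a :: t) ∧
      t.length = m := by
  induction m generalizing a with
  | zero => exact ⟨[], by simp, by simp [RowChain, ha], rfl⟩
  | succ m ih =>
    obtain ⟨b, hba, hb⟩ := hh a m ha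
    obtain ⟨t, hd, hc, hl⟩ := ih b hb
    refine ⟨b :: t, List.pairwise_cons.2 ⟨fun c hct => ?_, hd⟩, ⟨by simp [hl, ha], hc⟩,
      by simp [hl]⟩
    rcases List.mem_cons.1 hct with rfl | hct
    · exact hba
    · exact ((List.pairwise_cons.1 hd).1 c hct).trans hba

variable [Fintype A]

/-- The word made of the `q` rows `{a | i < h a}` for `p ≤ i < p + q`, from the shortest to the
longest. -/
def word (h : A → ℕ) : ℕ → ℕ → List A
  | _, 0 => []
  | p, q + 1 => word h (p + 1) q ++ (Finset.univ.filter (p < h ·)).sort (· ≤ ·)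

lemma word_congr {h h' : A → ℕ} (p q : ℕ) (H : ∀ a i, p ≤ i → (i < h a ↔ i < h' a)) :
    word h p q = word h' p q := by
  induction q generalizing p with
  | zero => rfl
  | succ q ih =>
    rw [word, word, ih (p + 1) fun a i hi => H a i (by omega)]
    simp only [H _ p le_rfl]

lemma eval_word_succ (h : A → ℕ) (p q : ℕ) :
    eval (word h p (q + 1)) = eval (word h (p + 1) q) * row (Finset.univ.filter (p < h ·)) :=
  eval_append _ _

/-- Multiplying the upper rows of a restricted growth function by a letter amounts to raising
some of its values. -/
lemma exists_eval_word_mul (q p : ℕ) (h : A → ℕ) (x : A) (hh : RestrictedGrowth h)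
    (hx : p ≤ h x) (hp : p = 0 ∨ ∃ z < x, p ≤ h z)
    (hq : (Finset.univ.filter (x ≤ ·)).card ≤ q) :
    ∃ h' : A → ℕ, RestrictedGrowth h' ∧ h ≤ h' ∧ (∀ a, h' a ≠ h a → p ≤ h a) ∧
      eval (word h p q) * eval [x] = eval (word h' p q) := by
  induction q generalizing p h x with
  | zero =>
    have : x ∈ Finset.univ.filter (x ≤ ·) := by simp
    simp [Finset.card_eq_zero.1 (Nat.le_zero.1 hq)] at this
  | succ q ih =>
    -- the function whose row of index `p` is obtained by adding `x`
    obtain ⟨g, hg, hhg, hgne, hgp, hgrow⟩ : ∃ g : A → ℕ, RestrictedGrowth g ∧ h ≤ g ∧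
        (∀ a, g a ≠ h a → p ≤ h a) ∧ (∀ a i, p + 1 ≤ i → (i < h a ↔ i < g a)) ∧
        Finset.univ.filter (p < g ·) = insert x (Finset.univ.filter (p < h ·)) := by
      rcases hx.eq_or_lt with hx | hx
      · have hlt : ∀ a i, i < Function.update h x (p + 1) a ↔
            i < h a ∨ a = x ∧ i = p := by
          intro a i
          rcases eq_or_ne a x with rfl | hax
          · rw [Function.update_self]; simp only [true_and]; omega
          · simp [hax]
        refine ⟨Function.update h x (p + 1), hh.update hx.symm hp, fun a => ?_, fun a ha => ?_,
          fun a i hi => ?_, ?_⟩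
        · exact le_of_forall_lt fun i hi => (hlt a i).2 (Or.inl hi)
        · rcases eq_or_ne a x with rfl | hax
          · exact hx.le
          · simp [hax] at ha
        · simp [hlt, show i ≠ p by omega]
        · ext a
          simp only [Finset.mem_filter, Finset.mem_univ, true_and, hlt, Finset.mem_insert]
          tauto
      · refine ⟨h, hh, le_rfl, by simp, by simp, (Finset.insert_eq_of_mem ?_).symm⟩
        simpa using hx
    have hgw : word h (p + 1) q = word g (p + 1) q := word_congr _ _ hgp
    by_cases hy : ∃ y, x < y ∧ p < h y
    · obtain ⟨y, ⟨hxy, hhy⟩, hmin⟩ :=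
        WellFounded.has_min (wellFounded_lt (α := A)) {y | x < y ∧ p < h y} hy
      have hgx : p < g x := by
        have : x ∈ Finset.univ.filter (p < g ·) := by simp [hgrow]
        simpa using this
      obtain ⟨h', hh', hgh', hne, he⟩ := ih (p + 1) g y hg (hhy.trans_le (hhg y))
        (Or.inr ⟨x, hxy, hgx⟩) (by
          refine Nat.le_of_lt_succ (lt_of_lt_of_le (Finset.card_lt_card ?_) hq)
          refine Finset.ssubset_iff_of_subset ?_ |>.2 ⟨x, by simp, by simpa using hxy⟩
          intro a ha
          simp only [Finset.mem_filter, Finset.mem_univ, true_and] at ha ⊢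
          exact hxy.le.trans ha)
      have hrow' : Finset.univ.filter (p < g ·) = Finset.univ.filter (p < h' ·) := by
        ext a
        simp only [Finset.mem_filter, Finset.mem_univ, true_and]
        have h1 := hne a
        have h2 := hgh' a
        simp only at h2
        omega
      refine ⟨h', hh', hhg.trans hgh', fun a ha => ?_, ?_⟩
      · have h1 := hne a
        have h2 := hgne a
        omega
      · rw [eval_word_succ, eval_word_succ, mul_assoc,
          row_insert_bump hxy (by simpa using hhy), ← hgrow, ← mul_assoc, hgw, he, hrow']
        intro a ha hxa
        exact not_lt.1 (hmin a ⟨hxa, by simpa using ha⟩)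
    · refine ⟨g, hg, hhg, hgne, ?_⟩
      rw [eval_word_succ, eval_word_succ, mul_assoc, row_insert_of_forall_le, ← hgrow, hgw]
      intro a ha
      by_contra! hlt
      exact hy ⟨a, hlt, by simpa using ha⟩

/-- Every element of the stylic monoid is the class of the word of a restricted growth
function. -/
lemma exists_eval_word (m : (stylicCon A).Quotient) :
    ∃ h : A → ℕ, RestrictedGrowth h ∧ eval (word h 0 (Fintype.card A)) = m := by
  obtain ⟨l, rfl⟩ := eval_surjective m
  induction l using List.reverseRecOn with
  | nil =>
    refine ⟨fun _ => 0, fun a p ha => by simp at ha, congrArg eval ?_⟩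
    have key : ∀ q p, word (fun _ : A => 0) p q = [] := by
      intro q
      induction q with
      | zero => exact fun _ => rfl
      | succ q ih => intro p; simp [word, ih]
    exact key _ _
  | append_singleton l x ih =>
    obtain ⟨h, hh, e⟩ := ih
    obtain ⟨h', hh', -, -, he⟩ := exists_eval_word_mul (Fintype.card A) 0 h x hh
      (Nat.zero_le _) (Or.inl rfl) (Finset.card_le_univ _)
    exact ⟨h', hh', by rw [eval_append, ← e, he]⟩

/-! ### Decreasing subwords of normal forms -/

lemma RowChain.of_sublist_word {h : A → ℕ} {q p : ℕ} {s : List A}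
    (hs : s.Sublist (word h p q)) (hd : s.Pairwise (· > ·)) : RowChain h p s := by
  induction q generalizing p s with
  | zero => rw [List.sublist_nil.1 hs]; trivial
  | succ q ih =>
    obtain ⟨s₁, s₂, rfl, hs₁, hs₂⟩ := List.sublist_append_iff.1 hs
    obtain ⟨hd₁, hd₂, -⟩ := List.pairwise_append.1 hd
    have h₁ := ih hs₁ hd₁
    have hp := (Finset.sortedLT_sort _).pairwise.sublist hs₂
    match s₂, hs₂, hp, hd₂ with
    | [], _, _, _ =>
      rw [List.append_nil]
      exact h₁.mono (Nat.le_succ p)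
    | [z], hz, _, _ =>
      rw [rowChain_append_singleton]
      exact ⟨h₁, by simpa using hz⟩
    | x :: y :: _, _, hp, hd₂ =>
      exact absurd ((List.pairwise_cons.1 hp).1 y (by simp))
        ((List.pairwise_cons.1 hd₂).1 y (by simp)).not_gt

lemma RowChain.sublist_word {h : A → ℕ} {q p : ℕ} {s : List A} (hs : RowChain h p s)
    (hq : s.length ≤ q) : s.Sublist (word h p q) := by
  induction q generalizing p s with
  | zero => rw [List.eq_nil_of_length_eq_zero (Nat.le_zero.1 hq)]; exact List.nil_sublist _
  | succ q ih =>
    rcases List.eq_nil_or_concat s with rfl | ⟨t, z, rfl⟩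
    · exact List.nil_sublist _
    · rw [List.concat_eq_append] at *
      rw [rowChain_append_singleton] at hs
      refine (ih hs.1 (by simpa using hq)).append ?_
      simpa using hs.2

/-- The word of a restricted growth function determines its values. -/
lemma RestrictedGrowth.le_of_eval_word_eq {h h' : A → ℕ} (hh : RestrictedGrowth h)
    (e : eval (word h 0 (Fintype.card A)) = eval (word h' 0 (Fintype.card A))) : h ≤ h' := by
  have transfer : ∀ {g g' : A → ℕ},
      eval (word g 0 (Fintype.card A)) = eval (word g' 0 (Fintype.card A)) →
      ∀ s : List A, s.Pairwise (· > ·) → RowChain g 0 s →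
      ∃ s' : List A, s'.Pairwise (· > ·) ∧ RowChain g' 0 s' ∧ s'.length = s.length ∧
        ∀ x ∈ s', (∃ y ∈ s, y ≤ x) ∧ ∃ z ∈ s, x ≤ z := by
    intro g g' hg s hd hc
    obtain ⟨s', h1, h2, h3, h4⟩ := dominated_of_eval_eq hg s
      (hc.sublist_word (List.Nodup.length_le_card (hd.imp ne_of_gt))) hd
    exact ⟨s', h2, .of_sublist_word h1 h2, h3, h4⟩
  intro a
  obtain h0 | ⟨m, hm⟩ : h a = 0 ∨ ∃ m, h a = m + 1 := by cases h a <;> simp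
  · simp [h0]
  -- among the decreasing row chains of length `h a` with letters in `[i, a]`, take `i` maximal
  obtain ⟨i, ⟨s, hd, hc, hl, his, hsa⟩, hmax⟩ :=
    (Set.toFinite {i | ∃ s : List A, s.Pairwise (· > ·) ∧ RowChain h 0 s ∧ s.length = h a ∧
      (∀ x ∈ s, i ≤ x) ∧ ∀ x ∈ s, x ≤ a}).exists_maximal (by
      obtain ⟨t, hd, hc, hl⟩ := hh.exists_rowChain m a hm
      obtain ⟨i, -, hi⟩ := Finset.exists_min_image Finset.univ (id : A → A) ⟨a, by simp⟩
      refine ⟨i, a :: t, hd, hc, by simp [hl, hm], fun x _ => hi x (by simp), fun x hx => ?_⟩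
      rcases List.mem_cons.1 hx with rfl | hx
      · exact le_rfl
      · exact ((List.pairwise_cons.1 hd).1 x hx).le)
  obtain ⟨s', hd', hc', hl', hs'⟩ := transfer e s hd hc
  obtain ⟨b, t', rfl⟩ : ∃ b t', s' = b :: t' :=
    List.exists_cons_of_length_eq_add_one (hl'.trans (hl.trans hm))
  have hba : b ≤ a := by
    obtain ⟨z, hz, hbz⟩ := (hs' b (by simp)).2
    exact hbz.trans (hsa z hz)
  rcases hba.eq_or_lt with rfl | hba
  · have hb : 0 + t'.length < h' b := hc'.1
    simp only [List.length_cons] at hl'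
    change h b ≤ h' b
    omega
  -- otherwise there is such a chain in `[i, a)`; exchanging its last letter for `a` gives a
  -- contradiction
  exfalso
  obtain ⟨s'', hd'', hc'', hl'', hs''⟩ := transfer e.symm _ hd' hc'
  have hi : ∀ x ∈ s'', i ≤ x := by
    intro x hx
    obtain ⟨y, hy, hyx⟩ := (hs'' x hx).1
    obtain ⟨w, hw, hwy⟩ := (hs' y hy).1
    exact (his w hw).trans (hwy.trans hyx)
  have ha : ∀ x ∈ s'', x < a := by
    intro x hx
    obtain ⟨y, hy, hxy⟩ := (hs'' x hx).2
    refine (hxy.trans ?_).trans_lt hba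
    rcases List.mem_cons.1 hy with rfl | hy
    · exact le_rfl
    · exact ((List.pairwise_cons.1 hd').1 y hy).le
  obtain rfl | ⟨t, z, rfl⟩ := List.eq_nil_or_concat s''
  · simp only [List.length_nil, List.length_cons] at hl''
    omega
  rw [List.concat_eq_append] at *
  obtain ⟨hdt, -, htz⟩ := List.pairwise_append.1 hd''
  have hzt : ∀ x ∈ a :: t, z < x := by
    intro x hx
    rcases List.mem_cons.1 hx with rfl | hx
    · exact ha z (by simp)
    · exact htz x hx z (by simp)
  obtain ⟨j, hj, hjmin⟩ := Finset.exists_min_image (a :: t).toFinset id ⟨a, by simp⟩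
  have hij : i < j := (hi z (by simp)).trans_lt (hzt j (by simpa using hj))
  refine (hmax ⟨a :: t, List.pairwise_cons.2 ⟨fun x hx => ha x (by simp [hx]), hdt⟩,
    ⟨?_, (rowChain_append_singleton.1 hc'').1.mono (Nat.le_succ 0)⟩, ?_,
    fun x hx => hjmin x (by simpa using hx), fun x hx => ?_⟩ hij.le).not_gt hij
  · simp only [List.length_append, List.length_cons, List.length_nil] at hl'' hl'
    omega
  · simp only [List.length_append, List.length_cons, List.length_nil] at *
    omega
  · rcases List.mem_cons.1 hx with rfl | hx
    · exact le_rfl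
    · exact (ha x (by simp [hx])).le

lemma card_quotient_eq_card_restrictedGrowth [Finite {h : A → ℕ // RestrictedGrowth h}] :
    Finite (stylicCon A).Quotient ∧
      Nat.card (stylicCon A).Quotient = Nat.card {h : A → ℕ // RestrictedGrowth h} := by
  let f : {h : A → ℕ // RestrictedGrowth h} → (stylicCon A).Quotient :=
    fun h => eval (word h.1 0 (Fintype.card A))
  have hf : Function.Bijective f :=
    ⟨fun h h' e => Subtype.ext (le_antisymm (h.2.le_of_eval_word_eq e)
      (h'.2.le_of_eval_word_eq e.symm)), fun m =>
      let ⟨h, hh, e⟩ := exists_eval_word m; ⟨⟨h, hh⟩, e⟩⟩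
  exact ⟨Finite.of_surjective f hf.2, (Nat.card_congr (Equiv.ofBijective f hf)).symm⟩

/-! ### Counting restricted growth functions -/

/-- A partial equivalence relation: a symmetric and transitive one. -/
def PartialEquivalence {α : Type*} (r : α → α → Prop) : Prop :=
  (∀ a b, r a b → r b a) ∧ ∀ a b c, r a b → r b c → r a c

/-- The partial equivalence relation whose classes are the nonempty fibres of `h` over positive
integers. -/
def fibreRel {α : Type*} (h : α → ℕ) (a b : α) : Prop := h a = h b ∧ h a ≠ 0

lemma partialEquivalence_fibreRel {α : Type*} (h : α → ℕ) : PartialEquivalence (fibreRel h) :=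
  ⟨fun _ _ e => ⟨e.1.symm, e.1 ▸ e.2⟩, fun _ _ _ e e' => ⟨e.1.trans e'.1, e.2⟩⟩

lemma RestrictedGrowth.eq_of_fibreRel_eq {h h' : A → ℕ} (hh : RestrictedGrowth h)
    (hh' : RestrictedGrowth h') (e : fibreRel h = fibreRel h') : h = h' := by
  have key : ∀ {g g' : A → ℕ}, RestrictedGrowth g' → fibreRel g = fibreRel g' →
      ∀ a, (∀ b < a, g b = g' b) → g' a ≤ g a := by
    intro g g' hg' e a ih
    by_contra! hlt
    have e' : ∀ a b, fibreRel g a b ↔ fibreRel g' a b := fun a b => by rw [e]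
    obtain ⟨p, hp⟩ : ∃ p, g a = p + 1 := by
      refine Nat.exists_eq_succ_of_ne_zero ?_
      exact ((e' a a).2 ⟨rfl, by omega⟩).2
    obtain ⟨b, hb, hbp⟩ := hg'.exists_lt a (hp ▸ hlt)
    have h1 := ih b hb
    have h2 := ((e' a b).1 ⟨by omega, by omega⟩).1
    omega
  funext a
  induction a using WellFoundedLT.induction with
  | ind a ih =>
    exact le_antisymm (key hh e.symm a fun b hb => (ih b hb).symm) (key hh' e a ih)

lemma exists_restrictedGrowth {r : A → A → Prop} (hr : PartialEquivalence r) :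
    ∃ h : A → ℕ, RestrictedGrowth h ∧ fibreRel h = r := by
  classical
  obtain ⟨hsymm, htrans⟩ := hr
  -- the minimal elements of the classes, and those below the class of `a`
  let M : A → Prop := fun b => r b b ∧ ∀ c, r b c → b ≤ c
  let F : A → Finset A := fun a => Finset.univ.filter fun b => M b ∧ ∀ c, r a c → b ≤ c
  have hM : ∀ a, r a a → ∃ m, M m ∧ r a m := by
    intro a ha
    obtain ⟨m, hm, hmin⟩ := WellFounded.has_min (wellFounded_lt (α := A)) {c | r a c} ⟨a, ha⟩
    exact ⟨m, ⟨htrans m a m (hsymm _ _ hm) hm, fun c hc => not_lt.1 (hmin c (htrans _ _ _ hm hc))⟩,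
      hm⟩
  have hF : ∀ a m, M m → r a m → F a = Finset.univ.filter fun b => M b ∧ b ≤ m := by
    intro a m hm ham
    ext b
    simp only [F, Finset.mem_filter, Finset.mem_univ, true_and]
    refine and_congr_right fun _ => ⟨fun h => h m ham, fun h c hc => h.trans ?_⟩
    exact hm.2 c (htrans _ _ _ (hsymm _ _ ham) hc)
  let h : A → ℕ := fun a => if r a a then (F a).card else 0
  have hrefl : ∀ {a b}, r a b → r a a := fun h => htrans _ _ _ h (hsymm _ _ h)
  have hpos : ∀ a, h a ≠ 0 ↔ r a a := by
    intro a
    by_cases ha : r a a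
    · obtain ⟨m, hm, ham⟩ := hM a ha
      simp only [h, ha, if_true, iff_true, hF a m hm ham]
      exact (Finset.card_pos.2 ⟨m, by simp [hm]⟩).ne'
    · simp [h, ha]
  refine ⟨h, fun a p hap => ?_, ?_⟩
  · have ha : r a a := (hpos a).1 (by omega)
    obtain ⟨m, hm, ham⟩ := hM a ha
    simp only [h, ha, if_true, hF a m hm ham] at hap
    have hsplit : (Finset.univ.filter fun b => M b ∧ b ≤ m) =
        insert m (Finset.univ.filter fun b => M b ∧ b < m) := by
      ext b
      simp only [Finset.mem_filter, Finset.mem_univ, true_and, Finset.mem_insert, le_iff_eq_or_lt]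
      constructor
      · tauto
      · rintro (rfl | h)
        exacts [⟨hm, Or.inl rfl⟩, ⟨h.1, Or.inr h.2⟩]
    rw [hsplit, Finset.card_insert_of_notMem (by simp)] at hap
    obtain ⟨b, hb, hmax⟩ := Finset.exists_max_image (Finset.univ.filter fun b => M b ∧ b < m) id
      (Finset.card_pos.1 (by omega))
    simp only [Finset.mem_filter, Finset.mem_univ, true_and, id] at hb hmax
    refine ⟨b, hb.2.trans_le (hm.2 a (hsymm _ _ ham)), ?_⟩
    simp only [h, hb.1.1, if_true, hF b b hb.1 hb.1.1]
    rw [← Nat.add_right_cancel hap]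
    congr 1
    ext c
    simp only [Finset.mem_filter, Finset.mem_univ, true_and]
    exact and_congr_right fun hc => ⟨fun h => h.trans_lt hb.2, fun h => hmax c ⟨hc, h⟩⟩
  · funext a b
    refine propext ⟨fun ⟨e, h0⟩ => ?_, fun hab => ?_⟩
    · have ha : r a a := (hpos a).1 h0
      have hb : r b b := (hpos b).1 (e ▸ h0)
      obtain ⟨m, hm, ham⟩ := hM a ha
      obtain ⟨n, hn, hbn⟩ := hM b hb
      simp only [h, ha, hb, if_true, hF a m hm ham, hF b n hn hbn] at e
      have le : ∀ {m n : A}, M n → m ≤ n → (Finset.univ.filter fun b => M b ∧ b ≤ m).card =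
          (Finset.univ.filter fun b => M b ∧ b ≤ n).card → m = n := by
        intro m n hn hmn e
        have : n ∈ Finset.univ.filter fun b => M b ∧ b ≤ m := by
          rw [Finset.eq_of_subset_of_card_le (Finset.monotone_filter_right _
            fun c _ hc => ⟨hc.1, hc.2.trans hmn⟩) e.ge]
          simp [hn]
        simp only [Finset.mem_filter] at this
        exact hmn.antisymm this.2.2
      have hmn : m = n := (le_total m n).elim (fun hl => le hn hl e)
        fun hl => (le hm hl e.symm).symm
      exact htrans _ _ _ ham (hmn ▸ hsymm _ _ hbn)
    · have ha := hrefl hab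
      have hb := hrefl (hsymm _ _ hab)
      refine ⟨?_, (hpos a).2 ha⟩
      obtain ⟨m, hm, ham⟩ := hM a ha
      simp only [h, ha, hb, if_true, hF a m hm ham, hF b m hm (htrans _ _ _ (hsymm _ _ hab) ham)]

variable (A) in
lemma card_restrictedGrowth : Finite {h : A → ℕ // RestrictedGrowth h} ∧
    Nat.card {h : A → ℕ // RestrictedGrowth h} =
      Nat.card {r : A → A → Prop // PartialEquivalence r} := by
  let f : {h : A → ℕ // RestrictedGrowth h} → {r : A → A → Prop // PartialEquivalence r} :=
    fun h => ⟨fibreRel h.1, partialEquivalence_fibreRel h.1⟩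
  have hf : Function.Bijective f :=
    ⟨fun h h' e => Subtype.ext (h.2.eq_of_fibreRel_eq h'.2 (congrArg Subtype.val e)), fun r =>
      let ⟨h, hh, e⟩ := exists_restrictedGrowth r.2; ⟨⟨h, hh⟩, Subtype.ext e⟩⟩
  exact ⟨Finite.of_injective f hf.1, Nat.card_congr (Equiv.ofBijective f hf)⟩

/-! ### Counting partial equivalence relations -/

lemma card_equivalence (α : Type*) [Fintype α] :
    Nat.card {r : α → α → Prop // Equivalence r} = bellNumber (Fintype.card α) := by
  let e := Fintype.equivFin α
  refine Nat.card_congr ((e.arrowCongr (e.arrowCongr (Equiv.refl Prop))).subtypeEquiv fun r => ?_)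
  constructor
  · exact fun h => h.comap e.symm
  · intro h
    convert h.comap e using 1
    funext a b
    simp [Function.onFun]

/-- The partial equivalence relations with a given domain are the equivalence relations on that
domain. -/
def partialEquivalenceEquiv {α : Type*} (S : Set α) :
    {r : {r : α → α → Prop // PartialEquivalence r} // {a | r.1 a a} = S} ≃
      {r : S → S → Prop // Equivalence r} where
  toFun r := ⟨fun a b => r.1.1 a b,
    ⟨fun a => (Set.ext_iff.1 r.2 a).2 a.2, fun h => r.1.2.1 _ _ h, fun h h' => r.1.2.2 _ _ _ h h'⟩⟩
  invFun r := ⟨⟨fun a b => ∃ (ha : a ∈ S) (hb : b ∈ S), r.1 ⟨a, ha⟩ ⟨b, hb⟩,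
    fun _ _ ⟨ha, hb, h⟩ => ⟨hb, ha, r.2.symm h⟩,
    fun _ _ _ ⟨ha, _, h⟩ ⟨_, hc, h'⟩ => ⟨ha, hc, r.2.trans h h'⟩⟩,
    Set.ext fun a => ⟨fun h => h.1, fun h => ⟨h, h, r.2.refl _⟩⟩⟩
  left_inv r := by
    ext a b
    refine ⟨fun ⟨_, _, h⟩ => h, fun h => ⟨?_, ?_, h⟩⟩
    · exact (Set.ext_iff.1 r.2 a).1 (r.1.2.2 _ _ _ h (r.1.2.1 _ _ h))
    · exact (Set.ext_iff.1 r.2 b).1 (r.1.2.2 _ _ _ (r.1.2.1 _ _ h) h)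
  right_inv r := by
    ext a b
    exact ⟨fun ⟨_, _, h⟩ => h, fun h => ⟨a.2, b.2, h⟩⟩

lemma card_partialEquivalence (α : Type*) [Fintype α] :
    Nat.card {r : α → α → Prop // PartialEquivalence r} =
      ∑ k ∈ Finset.range (Fintype.card α + 1), Nat.choose (Fintype.card α) k * bellNumber k := by
  classical
  have key : ∀ S : Finset α, Nat.card {r : {r : α → α → Prop // PartialEquivalence r} //
      {a | r.1 a a} = (S : Set α)} = bellNumber S.card := by
    intro S
    rw [Nat.card_congr (partialEquivalenceEquiv (S : Set α)), card_equivalence]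
    simp
  rw [← Nat.card_congr (Equiv.sigmaFiberEquiv fun r : {r : α → α → Prop // PartialEquivalence r} =>
    Finset.univ.filter fun a => r.1 a a), Nat.card_sigma]
  calc _ = ∑ S : Finset α, bellNumber S.card := Finset.sum_congr rfl fun S _ => by
        rw [← key S]
        refine Nat.card_congr (Equiv.subtypeEquivRight fun r => ?_)
        rw [← Finset.coe_inj]
        simp
    _ = _ := by
      rw [← Finset.powerset_univ, Finset.sum_powerset_apply_card]
      simp

end Stylic

/-- The stylic monoid `Plax(A, 2)` is finite, of cardinality
`Σ_{k=0}^{n} binomial(n,k) · Bell(k)` where `n = |A|`: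
the binomial transform of the Bell numbers. -/
theorem card_stylic {A : Type*} [LinearOrder A] [Fintype A] :
    Finite (stylicCon A).Quotient ∧
      Nat.card (stylicCon A).Quotient =
        ∑ k ∈ Finset.range (Fintype.card A + 1),
          Nat.choose (Fintype.card A) k * bellNumber k := by
  have h := Stylic.card_restrictedGrowth A
  have := h.1
  rw [← Stylic.card_partialEquivalence A, ← h.2]
  exact Stylic.card_quotient_eq_card_restrictedGrowth
end

section
/- Let A be a finite totally ordered alphabet with |A| = n. Then the 2-Chinese monoid Ch(A,2) is finite and its cardinality is |Ch(A,2)| = Σ_{k=0}^{n} binomial(n,k) · Catalan(k), the binomial transform of the Catalan numbers. -/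
/-- The defining relations of the 2-Chinese monoid `Ch(A, 2)`: the Chinese relations
`cba = cab = bca` (for `a < b < c`), `aba = baa`, `bba = bab` (for `a < b`),
together with `a² = a` for every letter `a`. -/
def chinese2Rel {A : Type*} [LinearOrder A] (U V : FreeMonoid A) : Prop :=
  (∃ a b c : A, a < b ∧ b < c ∧
    U = FreeMonoid.of c * FreeMonoid.of b * FreeMonoid.of a ∧
    V = FreeMonoid.of c * FreeMonoid.of a * FreeMonoid.of b) ∨
  (∃ a b c : A, a < b ∧ b < c ∧
    U = FreeMonoid.of c * FreeMonoid.of a * FreeMonoid.of b ∧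
    V = FreeMonoid.of b * FreeMonoid.of c * FreeMonoid.of a) ∨
  (∃ a b : A, a < b ∧
    U = FreeMonoid.of a * FreeMonoid.of b * FreeMonoid.of a ∧
    V = FreeMonoid.of b * FreeMonoid.of a * FreeMonoid.of a) ∨
  (∃ a b : A, a < b ∧
    U = FreeMonoid.of b * FreeMonoid.of b * FreeMonoid.of a ∧
    V = FreeMonoid.of b * FreeMonoid.of a * FreeMonoid.of b) ∨
  (∃ a : A, U = FreeMonoid.of a * FreeMonoid.of a ∧ V = FreeMonoid.of a)

/-- The congruence on the free monoid defining the 2-Chinese monoid `Ch(A, 2)`. -/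
def chinese2Con (A : Type*) [LinearOrder A] : Con (FreeMonoid A) :=
  conGen chinese2Rel

namespace Chinese2

section Catalan

/-- Monotone regressive functions on `ℕ` that fix every `i ≥ n`. -/
def Regressive (n : ℕ) : Type :=
  {g : ℕ → ℕ // Monotone g ∧ (∀ i, g i ≤ i) ∧ ∀ i, n ≤ i → g i = i}

/-- Glue two regressive functions into one whose last fixed point up to `n` is `i`. -/
def glue (n i : ℕ) (g h : ℕ → ℕ) (j : ℕ) : ℕ :=
  if j ≤ i then g j else if j ≤ n then h (j - i - 1) + i else j

lemma glue_mem {n i : ℕ} (hi : i ≤ n) (g : Regressive i) (h : Regressive (n - i)) :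
    Monotone (glue n i g.1 h.1) ∧ (∀ j, glue n i g.1 h.1 j ≤ j) ∧
      ∀ j, n + 1 ≤ j → glue n i g.1 h.1 j = j := by
  obtain ⟨g, gm, gr, gf⟩ := g
  obtain ⟨h, hm, hr, hf⟩ := h
  refine ⟨?_, ?_, ?_⟩
  · intro j k hjk
    have := gm hjk
    have := hm (show j - i - 1 ≤ k - i - 1 by omega)
    have := gr j
    have := hr (j - i - 1)
    simp only [glue]
    split_ifs <;> omega
  · intro j
    have := gr j
    have := hr (j - i - 1)
    simp only [glue]
    split_ifs <;> omega
  · intro j hj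
    simp only [glue]
    split_ifs <;> omega

/-- The decomposition of a regressive function at its last fixed point up to `n`. -/
def glueMap (n : ℕ) (p : Σ i : Fin (n + 1), Regressive i × Regressive (n - i)) :
    Regressive (n + 1) :=
  ⟨glue n p.1 p.2.1.1 p.2.2.1, glue_mem (Nat.lt_succ_iff.1 p.1.2) p.2.1 p.2.2⟩

lemma glueMap_injective (n : ℕ) : Function.Injective (glueMap n) := by
  rintro ⟨⟨i, hi⟩, ⟨g, gm, gr, gf⟩, ⟨h, hm, hr, hf⟩⟩
    ⟨⟨i', hi'⟩, ⟨g', gm', gr', gf'⟩, ⟨h', hm', hr', hf'⟩⟩ e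
  have e' : ∀ j, glue n i g h j = glue n i' g' h' j := fun j => congrFun (congrArg Subtype.val e) j
  dsimp only at gf gf' hf hf'
  have hii : i = i' := by
    have e1 := e' i
    have e2 := e' i'
    have := gf i le_rfl
    have := gf' i' le_rfl
    have := hr (i' - i - 1)
    have := hr' (i - i' - 1)
    simp only [glue] at e1 e2
    split_ifs at e1 e2 <;> omega
  subst hii
  have hg : g = g' := by
    funext j
    by_cases hj : j ≤ i
    · have := e' j
      simpa only [glue, if_pos hj] using this
    · rw [gf j (by omega), gf' j (by omega)]
  have hh : h = h' := by
    funext t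
    by_cases ht : n - i ≤ t
    · rw [hf t ht, hf' t ht]
    · have := e' (i + 1 + t)
      simp only [glue] at this
      rw [if_neg (by omega), if_pos (by omega), if_neg (by omega), if_pos (by omega),
        show i + 1 + t - i - 1 = t by omega] at this
      omega
  subst hg hh
  rfl

lemma glueMap_surjective (n : ℕ) : Function.Surjective (glueMap n) := by
  rintro ⟨f, fm, fr, ff⟩
  set i := Nat.findGreatest (fun j => f j = j) n with hi
  have hin : i ≤ n := Nat.findGreatest_le n
  have hfi : f i = i :=
    Nat.findGreatest_spec (P := fun j => f j = j) (Nat.zero_le n) (Nat.le_zero.1 (fr 0))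
  have hlt : ∀ j, i < j → j ≤ n → f j < j := fun j h1 h2 =>
    lt_of_le_of_ne (fr j) (Nat.findGreatest_is_greatest (P := fun j => f j = j) h1 h2)
  refine ⟨⟨⟨i, by omega⟩, ⟨fun j => if j ≤ i then f j else j, ?_, ?_, ?_⟩,
    ⟨fun t => if t < n - i then f (i + 1 + t) - i else t, ?_, ?_, ?_⟩⟩, ?_⟩
  · intro j k hjk
    have := fm hjk
    have := fr j
    dsimp only
    split_ifs <;> omega
  · intro j
    have := fr j
    dsimp only
    split_ifs <;> omega
  · intro j hj
    dsimp only at hj ⊢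
    split_ifs with h
    · rw [show j = i by omega, hfi]
    · rfl
  · intro j k hjk
    have := fm (show i + 1 + j ≤ i + 1 + k by omega)
    have := fr (i + 1 + j)
    dsimp only
    split_ifs with h1
    · omega
    · have := hlt (i + 1 + j) (by omega) (by omega)
      omega
    · omega
    · omega
  · intro t
    dsimp only
    split_ifs with h1
    · have := hlt (i + 1 + t) (by omega) (by omega)
      omega
    · exact le_rfl
  · intro t ht
    dsimp only at ht ⊢
    rw [if_neg (by omega)]
  · apply Subtype.ext
    funext j
    simp only [glueMap, glue]
    split_ifs with h1 h2 h3
    · rfl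
    · have := fm (show i ≤ j by omega)
      rw [show i + 1 + (j - i - 1) = j by omega]
      omega
    · omega
    · exact (ff j (by omega)).symm

lemma card_regressive (n : ℕ) : Finite (Regressive n) ∧ Nat.card (Regressive n) = catalan n := by
  induction n using Nat.strong_induction_on with
  | _ n ih =>
    cases n with
    | zero =>
      have : Unique (Regressive 0) :=
        { default := ⟨id, monotone_id, fun _ => le_rfl, fun _ _ => rfl⟩
          uniq := fun g => Subtype.ext (funext fun i => g.2.2.2 i (Nat.zero_le i)) }
      exact ⟨inferInstance, by simp⟩
    | succ n =>
      have e := Equiv.ofBijective _ ⟨glueMap_injective n, glueMap_surjective n⟩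
      have f1 : ∀ i : Fin (n + 1), Finite (Regressive i) := fun i => (ih i (by omega)).1
      have f2 : ∀ i : Fin (n + 1), Finite (Regressive (n - i)) := fun i => (ih _ (by omega)).1
      refine ⟨Finite.of_equiv _ e, ?_⟩
      rw [← Nat.card_congr e, Nat.card_sigma, catalan_succ]
      refine Finset.sum_congr rfl fun i _ => ?_
      rw [Nat.card_prod, (ih i (by omega)).2, (ih (n - i) (by omega)).2]

/-- Monotone regressive self-maps of a linear order. -/
abbrev RegressiveMap (α : Type*) [LinearOrder α] : Type _ :=
  {g : α → α // Monotone g ∧ ∀ i, g i ≤ i}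

lemma card_regressiveMap (α : Type*) [LinearOrder α] [Fintype α] :
    Nat.card (RegressiveMap α) = catalan (Fintype.card α) := by
  set n := Fintype.card α with hn
  have e : α ≃o Fin n := (Fintype.orderIsoFinOfCardEq α hn.symm).symm
  rw [← (card_regressive n).2]
  refine (Nat.card_congr (Equiv.ofBijective
    (fun g : Regressive n => (⟨fun a => e.symm ⟨g.1 (e a), (g.2.2.1 _).trans_lt (e a).2⟩,
      fun a b hab => e.symm.monotone (g.2.1 (e.monotone hab)),
      fun a => by
        rw [e.symm_apply_le]
        exact g.2.2.1 _⟩ : RegressiveMap α)) ⟨?_, ?_⟩)).symm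
  · intro g h hgh
    apply Subtype.ext
    funext i
    by_cases hi : i < n
    · have := congrFun (congrArg Subtype.val hgh) (e.symm ⟨i, hi⟩)
      simpa using this
    · rw [g.2.2.2 i (by omega), h.2.2.2 i (by omega)]
  · intro f
    refine ⟨⟨fun i => if hi : i < n then e (f.1 (e.symm ⟨i, hi⟩)) else i, ?_, ?_, ?_⟩, ?_⟩
    · intro i j hij
      dsimp only
      split_ifs with h1 h2
      · exact e.monotone (f.2.1 (e.symm.monotone hij))
      · have := (e (f.1 (e.symm ⟨i, h1⟩))).2
        omega
      · omega
      · exact hij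
    · intro i
      dsimp only
      split_ifs with h1
      · have := e.monotone (f.2.2 (e.symm ⟨i, h1⟩))
        rwa [e.apply_symm_apply] at this
      · exact le_rfl
    · intro i hi
      exact dif_neg hi.not_gt
    · apply Subtype.ext
      funext a
      simp

end Catalan

section Relations

variable {A : Type*} [LinearOrder A]

/-- The class of a letter in the 2-Chinese monoid. -/
def letter (a : A) : (chinese2Con A).Quotient := ((FreeMonoid.of a : FreeMonoid A) : _)

lemma coe_eq_of_rel {U V : FreeMonoid A} (h : chinese2Rel U V) :
    (U : (chinese2Con A).Quotient) = V :=
  (Con.eq _).2 (ConGen.Rel.of _ _ h)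

lemma letter_cba {a b c : A} (hab : a < b) (hbc : b < c) :
    letter c * letter b * letter a = letter c * letter a * letter b :=
  coe_eq_of_rel (Or.inl ⟨a, b, c, hab, hbc, rfl, rfl⟩)

lemma letter_cab {a b c : A} (hab : a < b) (hbc : b < c) :
    letter c * letter a * letter b = letter b * letter c * letter a :=
  coe_eq_of_rel (Or.inr (Or.inl ⟨a, b, c, hab, hbc, rfl, rfl⟩))

lemma letter_self (a : A) : letter a * letter a = letter a :=
  coe_eq_of_rel (Or.inr (Or.inr (Or.inr (Or.inr ⟨a, rfl, rfl⟩))))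

lemma letter_aba {a b : A} (hab : a ≤ b) :
    letter a * letter b * letter a = letter b * letter a := by
  rcases hab.eq_or_lt with rfl | hab
  · simp only [letter_self]
  · have : letter a * letter b * letter a = letter b * letter a * letter a :=
      coe_eq_of_rel (Or.inr (Or.inr (Or.inl ⟨a, b, hab, rfl, rfl⟩)))
    rw [this, mul_assoc, letter_self]

lemma letter_bab {a b : A} (hab : a ≤ b) :
    letter b * letter a * letter b = letter b * letter a := by
  rcases hab.eq_or_lt with rfl | hab
  · simp only [letter_self]
  · have : letter b * letter b * letter a = letter b * letter a * letter b :=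
      coe_eq_of_rel (Or.inr (Or.inr (Or.inr (Or.inl ⟨a, b, hab, rfl, rfl⟩))))
    rw [← this, letter_self]

/-- The normal form: the product of the blocks `i * m i` for `i ∈ S` in increasing order. -/
def normalForm (S : Finset A) (m : A → A) : (chinese2Con A).Quotient :=
  (S.sort (· ≥ ·)).foldr (fun i w => w * (letter i * letter (m i))) 1

@[simp] lemma normalForm_empty (m : A → A) : normalForm ∅ m = 1 := by
  simp [normalForm]

lemma normalForm_insert {S : Finset A} {b : A} (hb : ∀ s ∈ S, s < b) (m : A → A) :
    normalForm (insert b S) m = normalForm S m * (letter b * letter (m b)) := by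
  rw [normalForm, Finset.sort_insert (· ≥ ·) (fun s hs => (hb s hs).le)
    (fun h => lt_irrefl _ (hb b h))]
  rfl

lemma normalForm_congr {S : Finset A} {m m' : A → A} (h : ∀ s ∈ S, m s = m' s) :
    normalForm S m = normalForm S m' := by
  induction S using Finset.induction_on_max with
  | empty => simp
  | insert b S hb ih =>
    rw [normalForm_insert hb, normalForm_insert hb, h b (Finset.mem_insert_self b S),
      ih fun s hs => h s (Finset.mem_insert_of_mem hs)]

lemma normalForm_mul_absorb {S : Finset A} {m : A → A} (hm : ∀ s, m s ≤ s) {x : A} (hx : x ∈ S)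
    (h : ∀ s ∈ S, x < s → m s ≤ x) : normalForm S m * letter x = normalForm S m := by
  induction S using Finset.induction_on_max with
  | empty => simp at hx
  | insert b S hb ih =>
    rw [normalForm_insert hb]
    rcases Finset.mem_insert.1 hx with rfl | hxS
    · rw [mul_assoc, letter_bab (hm x)]
    · rcases (h b (Finset.mem_insert_self b S) (hb x hxS)).eq_or_lt with he | hlt
      · rw [he, mul_assoc, mul_assoc, letter_self]
      · rw [mul_assoc, letter_cab hlt (hb x hxS), mul_assoc (letter x), ← mul_assoc,
          ih hxS fun s hs => h s (Finset.mem_insert_of_mem hs)]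

lemma block_mul {P : (chinese2Con A).Quotient} {x b μ : A} (hxb : x < b) (hμ : μ ≤ b)
    (hP : x < μ → μ < b → P * letter μ = P) :
    P * (letter b * letter μ) * letter x = P * letter x * (letter b * letter (min μ x)) := by
  have key : letter b * letter x = letter x * (letter b * letter x) := by
    rw [← mul_assoc, letter_aba hxb.le]
  rcases lt_trichotomy μ x with h | rfl | h
  · rw [min_eq_left h.le, mul_assoc, letter_cab h hxb, mul_assoc, mul_assoc]
  · rw [min_self, mul_assoc, mul_assoc, letter_self, mul_assoc, ← key]
  · rw [min_eq_right h.le, mul_assoc P (letter x), ← key]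
    rcases hμ.eq_or_lt with rfl | hlt
    · rw [letter_self, mul_assoc]
    · rw [mul_assoc, letter_cba h hlt, letter_cab h hlt, mul_assoc (letter μ), ← mul_assoc,
        hP h hlt]

lemma mul_block {x b μ : A} (hxb : x < b) (hμ : μ ≤ x) :
    letter x * (letter b * letter μ) = letter x * letter μ * (letter b * letter μ) := by
  have : letter b * letter μ = letter μ * letter b * letter μ :=
    (letter_aba (hμ.trans hxb.le)).symm
  conv_lhs => rw [this]
  simp only [mul_assoc]

lemma normalForm_mul_letter {S : Finset A} {m : A → A} (hm : ∀ s, m s ≤ s) (hmono : Monotone m)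
    (hS : ∀ s ∈ S, m s ∈ S) {x : A} (h1 : (∀ s ∈ S, s < x) → m x = x)
    (h2 : x ∉ S → ∀ b ∈ S, x < b → (∀ s ∈ S, s < x ∨ b ≤ s) → m x = min (m b) x) :
    normalForm S m * letter x = normalForm (insert x S) (fun y => min (m y) x) := by
  have top : ∀ T : Finset A, (∀ s ∈ T, s < x) →
      normalForm T m = normalForm T (fun y => min (m y) x) := fun T hT =>
    normalForm_congr fun s hs => (min_eq_left ((hm s).trans (hT s hs).le)).symm
  induction S using Finset.induction_on_max with
  | empty =>
    rw [normalForm_insert (by simp), h1 (by simp), min_self, letter_self]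
    simp
  | insert b S hb ih =>
    have hbS : b ∉ S := fun h => lt_irrefl _ (hb b h)
    rcases lt_trichotomy x b with hxb | rfl | hbx
    · have hS' : ∀ s ∈ S, m s ∈ S := fun s hs =>
        (Finset.mem_insert.1 (hS s (Finset.mem_insert_of_mem hs))).resolve_left
          ((hm s).trans_lt (hb s hs)).ne
      have hb' : ∀ s ∈ insert x S, s < b := by
        intro s hs
        rcases Finset.mem_insert.1 hs with rfl | hs
        exacts [hxb, hb s hs]
      rw [Finset.insert_comm, normalForm_insert hb', normalForm_insert hb,
        block_mul hxb (hm b) fun _ hlt => normalForm_mul_absorb hm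
          ((Finset.mem_insert.1 (hS b (Finset.mem_insert_self b S))).resolve_left hlt.ne)
          fun s hs _ => hmono (hb s hs).le]
      by_cases hall : ∀ s ∈ S, s < x
      · have hx : m x = min (m b) x := by
          refine h2 ?_ b (Finset.mem_insert_self b S) hxb ?_
          · intro h
            rcases Finset.mem_insert.1 h with rfl | h
            exacts [lt_irrefl _ hxb, lt_irrefl _ (hall x h)]
          · intro s hs
            rcases Finset.mem_insert.1 hs with rfl | hs
            exacts [Or.inr le_rfl, Or.inl (hall s hs)]
        rw [normalForm_insert hall, mul_assoc, mul_block hxb (min_le_right _ _), top S hall,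
          min_eq_left (hm x), hx, mul_assoc, mul_assoc, mul_assoc]
      · rw [ih hS' (fun h => absurd h hall)]
        intro hx c hc hxc hs
        refine h2 (fun h => ?_) c (Finset.mem_insert_of_mem hc) hxc fun s hs' => ?_
        · rcases Finset.mem_insert.1 h with rfl | h
          exacts [lt_irrefl _ hxb, hx h]
        · rcases Finset.mem_insert.1 hs' with rfl | hs'
          exacts [Or.inr (hb c hc).le, hs s hs']
    · rw [normalForm_mul_absorb hm (Finset.mem_insert_self x S), Finset.insert_idem]
      · refine normalForm_congr fun s hs => (min_eq_left ((hm s).trans ?_)).symm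
        rcases Finset.mem_insert.1 hs with rfl | hs
        exacts [le_rfl, (hb s hs).le]
      · intro s hs hxs
        rcases Finset.mem_insert.1 hs with rfl | hs
        exacts [absurd hxs (lt_irrefl _), absurd hxs (hb s hs).not_gt]
    · have hall : ∀ s ∈ insert b S, s < x := by
        intro s hs
        rcases Finset.mem_insert.1 hs with rfl | hs
        exacts [hbx, (hb s hs).trans hbx]
      rw [normalForm_insert hall, h1 hall, min_self, letter_self, top _ hall]

end Relations

section Invariant

variable {A : Type*} [LinearOrder A]

/-- Pairs of a content `S` and a function `m` on letters, as produced by words: `m y` is the least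
letter `a ≤ y` that equals `y` or occurs after some letter `b ≥ y`. -/
structure IsState (S : Finset A) (m : A → A) : Prop where
  le : ∀ y, m y ≤ y
  mono : Monotone m
  mem : ∀ y, m y = y ∨ m y ∈ S
  eq_of_lt : ∀ y, (∀ s ∈ S, s < y) → m y = y
  next : ∀ y, m y = y ∨ ∃ s ∈ S, y ≤ s ∧ m s ≤ m y

/-- The effect on `m` of appending the letter `x` to a word with content `S`. -/
def stepFun (S : Finset A) (m : A → A) (x y : A) : A :=
  if ∃ b ∈ S, y ≤ b then min (m y) x else m y

lemma IsState.step {S : Finset A} {m : A → A} (h : IsState S m) (x : A) :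
    IsState (insert x S) (stepFun S m x) := by
  have hout : ∀ {y}, (¬ ∃ b ∈ S, y ≤ b) → m y = y := fun {y} hy =>
    h.eq_of_lt y fun s hs => lt_of_not_ge fun hle => hy ⟨s, hs, hle⟩
  refine ⟨fun y => ?_, fun y z hyz => ?_, fun y => ?_, fun y hy => ?_, fun y => ?_⟩
  · unfold stepFun
    split_ifs
    exacts [(min_le_left _ _).trans (h.le y), h.le y]
  · unfold stepFun
    split_ifs with h1 h2 h2
    · exact min_le_min_right _ (h.mono hyz)
    · exact (min_le_left _ _).trans (h.mono hyz)
    · obtain ⟨b, hb, hzb⟩ := h2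
      exact absurd ⟨b, hb, hyz.trans hzb⟩ h1
    · exact h.mono hyz
  · unfold stepFun
    split_ifs with h1
    · rcases min_choice (m y) x with e | e <;> rw [e]
      · exact (h.mem y).imp_right Finset.mem_insert_of_mem
      · exact Or.inr (Finset.mem_insert_self x S)
    · exact Or.inl (hout h1)
  · have h1 : ¬ ∃ b ∈ S, y ≤ b := fun ⟨b, hb, hyb⟩ =>
      (hy b (Finset.mem_insert_of_mem hb)).not_ge hyb
    rw [stepFun, if_neg h1, hout h1]
  · by_cases h1 : ∃ b ∈ S, y ≤ b
    · rcases h.next y with e | ⟨s, hs, hys, hms⟩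
      · rcases le_or_gt y x with hyx | hxy
        · left
          rw [stepFun, if_pos h1, e, min_eq_left hyx]
        · right
          obtain ⟨b, hb, hyb⟩ := h1
          refine ⟨b, Finset.mem_insert_of_mem hb, hyb, ?_⟩
          rw [stepFun, if_pos ⟨b, hb, le_rfl⟩, stepFun, if_pos ⟨b, hb, hyb⟩, e,
            min_eq_right hxy.le]
          exact min_le_right _ _
      · right
        refine ⟨s, Finset.mem_insert_of_mem hs, hys, ?_⟩
        rw [stepFun, if_pos ⟨s, hs, le_rfl⟩, stepFun, if_pos h1]
        exact min_le_min_right _ hms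
    · left
      rw [stepFun, if_neg h1, hout h1]

variable (A) in
/-- The states on which words act from the right. -/
abbrev State : Type _ := {p : Finset A × (A → A) // IsState p.1 p.2}

/-- Appending a letter to a state. -/
def step (x : A) : Function.End (State A) := fun p =>
  ⟨(insert x p.1.1, stepFun p.1.1 p.1.2 x), p.2.step x⟩

variable (A) in
/-- The state of the empty word. -/
def initial : State A :=
  ⟨(∅, id), fun _ => le_rfl, monotone_id, fun _ => Or.inl rfl, fun _ _ => rfl, fun _ => Or.inl rfl⟩

variable (A) in
/-- The right action of words on states. -/
def act : FreeMonoid A →* (Function.End (State A))ᵐᵒᵖ :=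
  FreeMonoid.lift fun x => MulOpposite.op (step x)

lemma act_rel {U V : FreeMonoid A} (h : chinese2Rel U V) : act A U = act A V := by
  have hmul : ∀ (f g : (Function.End (State A))ᵐᵒᵖ) (p : State A),
      (f * g).unop p = g.unop (f.unop p) := fun _ _ _ => rfl
  rcases h with ⟨a, b, c, hab, hbc, rfl, rfl⟩ | ⟨a, b, c, hab, hbc, rfl, rfl⟩ |
    ⟨a, b, hab, rfl, rfl⟩ | ⟨a, b, hab, rfl, rfl⟩ | ⟨a, rfl, rfl⟩ <;>
  simp only [act, map_mul, FreeMonoid.lift_eval_of] <;>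
  apply MulOpposite.unop_injective <;>
  funext p <;>
  obtain ⟨⟨S, m⟩, hp⟩ := p <;>
  apply Subtype.ext <;>
  refine Prod.ext ?_ (funext fun y => ?_)
  all_goals simp only [hmul, MulOpposite.unop_op, step]
  · ext z; simp; tauto
  · have : m y ≤ y := hp.le y
    clear hmul hp
    simp only [stepFun, Finset.exists_mem_insert]
    generalize m y = k at *
    by_cases hE : ∃ s ∈ S, y ≤ s <;>
    simp only [hE, or_true, or_false, if_true, if_false] <;>
    grind
  · ext z; simp; tauto
  · have : m y ≤ y := hp.le y
    clear hmul hp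
    simp only [stepFun, Finset.exists_mem_insert]
    generalize m y = k at *
    by_cases hE : ∃ s ∈ S, y ≤ s <;>
    simp only [hE, or_true, or_false, if_true, if_false] <;>
    grind
  · ext z; simp; tauto
  · have : m y ≤ y := hp.le y
    clear hmul hp
    simp only [stepFun, Finset.exists_mem_insert]
    generalize m y = k at *
    by_cases hE : ∃ s ∈ S, y ≤ s <;>
    simp only [hE, or_true, or_false, if_true, if_false] <;>
    grind
  · ext z; simp
  · have : m y ≤ y := hp.le y
    clear hmul hp
    simp only [stepFun, Finset.exists_mem_insert]
    generalize m y = k at *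
    by_cases hE : ∃ s ∈ S, y ≤ s <;>
    simp only [hE, or_true, or_false, if_true, if_false] <;>
    grind
  · simp
  · have : m y ≤ y := hp.le y
    clear hmul hp
    simp only [stepFun, Finset.exists_mem_insert]
    generalize m y = k at *
    by_cases hE : ∃ s ∈ S, y ≤ s <;>
    simp only [hE, or_true, or_false, if_true, if_false] <;>
    grind

variable (A) in
/-- The right action of the 2-Chinese monoid on states. -/
def actQuotient : (chinese2Con A).Quotient →* (Function.End (State A))ᵐᵒᵖ :=
  (chinese2Con A).lift (act A) (Con.conGen_le.2 fun _ _ h => act_rel h)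

/-- The state of an element of the 2-Chinese monoid. -/
def state (q : (chinese2Con A).Quotient) : State A := (actQuotient A q).unop (initial A)

lemma state_one : state (1 : (chinese2Con A).Quotient) = initial A := by
  rw [state, map_one]
  rfl

lemma state_mul_letter (q : (chinese2Con A).Quotient) (x : A) :
    state (q * letter x) = step x (state q) := by
  have : actQuotient A (letter x) = MulOpposite.op (step x) := by
    exact FreeMonoid.lift_eval_of (fun x : A => MulOpposite.op (step x)) x
  rw [state, map_mul, this]
  rfl

lemma eq_normalForm (q : (chinese2Con A).Quotient) :
    q = normalForm (state q).1.1 (state q).1.2 := by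
  induction q using Con.induction_on with
  | H w =>
    suffices ∀ l : List A, ∀ q : (chinese2Con A).Quotient,
        q = (FreeMonoid.ofList l : FreeMonoid A) →
        q = normalForm (state q).1.1 (state q).1.2 from this w.toList _ rfl
    intro l
    induction l using List.reverseRecOn with
    | nil =>
      rintro _ rfl
      change (1 : (chinese2Con A).Quotient) = normalForm (state 1).1.1 (state 1).1.2
      rw [state_one]
      simp [initial]
    | append_singleton l x ih =>
      rintro _ rfl
      specialize ih _ rfl
      generalize hq : ((FreeMonoid.ofList l : FreeMonoid A) : (chinese2Con A).Quotient) = q at ih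
      have hqx : ((FreeMonoid.ofList (l ++ [x]) : FreeMonoid A) : (chinese2Con A).Quotient) =
          q * letter x := hq ▸ rfl
      rw [hqx]
      clear hq hqx
      rw [state_mul_letter]
      generalize state q = p at ih ⊢
      obtain ⟨⟨S, m⟩, h⟩ := p
      subst ih
      change normalForm S m * letter x = normalForm (insert x S) (stepFun S m x)
      dsimp only at h
      rw [normalForm_mul_letter h.le h.mono _ (h.eq_of_lt x)]
      · refine normalForm_congr fun s hs => ?_
        rcases Finset.mem_insert.1 hs with rfl | hs
        · simp [stepFun, h.le s]
        · exact (if_pos ⟨s, hs, le_rfl⟩).symm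
      · intro _ b hb hxb hs
        rcases h.next x with e | ⟨s, hsS, hxs, hms⟩
        · rw [e, min_eq_right]
          exact e.symm.le.trans (h.mono hxb.le)
        · have hbs : b ≤ s := (hs s hsS).resolve_left hxs.not_gt
          have : m x = m b := le_antisymm (h.mono hxb.le) ((h.mono hbs).trans hms)
          rw [← this, min_eq_left (h.le x)]
      · intro s hs
        rcases h.mem s with e | e
        exacts [e.symm ▸ hs, e]

lemma state_normalForm {S : Finset A} {m : A → A} (hm : ∀ s ∈ S, m s ≤ s)
    (hmono : ∀ s ∈ S, ∀ t ∈ S, s ≤ t → m s ≤ m t) (hS : ∀ s ∈ S, m s ∈ S) :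
    (state (normalForm S m)).1.1 = S ∧ ∀ s ∈ S, (state (normalForm S m)).1.2 s = m s := by
  induction S using Finset.induction_on_max with
  | empty => simp [state_one, initial]
  | insert b S hb ih =>
    have hbm := Finset.mem_insert_self b S
    have hi : ∀ {s}, s ∈ S → s ∈ insert b S := fun h => Finset.mem_insert_of_mem h
    obtain ⟨h1, h2⟩ := ih (fun s hs => hm s (hi hs))
      (fun s hs t ht => hmono s (hi hs) t (hi ht))
      (fun s hs => (Finset.mem_insert.1 (hS s (hi hs))).resolve_left
        ((hm s (hi hs)).trans_lt (hb s hs)).ne)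
    rw [normalForm_insert hb, ← mul_assoc, state_mul_letter, state_mul_letter]
    generalize state (normalForm S m) = p at h1 h2
    obtain ⟨⟨T, g⟩, hp⟩ := p
    dsimp only at h1 h2 hp
    subst h1
    refine ⟨?_, fun s hs => ?_⟩
    · exact Finset.insert_eq_of_mem (hS b hbm)
    · change stepFun (insert b T) (stepFun T g b) (m b) s = m s
      rw [stepFun, if_pos ⟨s, hs, le_rfl⟩]
      rcases Finset.mem_insert.1 hs with rfl | hs'
      · rw [stepFun, if_neg fun ⟨c, hc, hsc⟩ => (hb c hc).not_ge hsc, hp.eq_of_lt s hb,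
          min_eq_right (hm s hs)]
      · rw [stepFun, if_pos ⟨s, hs', le_rfl⟩, h2 s hs',
          min_eq_left ((hm s hs).trans (hb s hs').le), min_eq_left (hmono s hs b hbm (hb s hs').le)]

/-- The content of an element together with its function restricted to the content. -/
def toRegressive (q : (chinese2Con A).Quotient) : Σ S : Finset A, RegressiveMap S :=
  ⟨(state q).1.1, fun s => ⟨(state q).1.2 s, by
      rcases (state q).2.mem s with e | e
      exacts [e.symm ▸ s.2, e]⟩,
    fun _ _ h => (state q).2.mono h, fun s => (state q).2.le s⟩

lemma toRegressive_bijective : Function.Bijective (toRegressive (A := A)) := by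
  constructor
  · intro q r h
    have hfst : (state q).1.1 = (state r).1.1 := congrArg Sigma.fst h
    have key : ∀ p p' : Σ S : Finset A, RegressiveMap S, p = p' → ∀ s (hs : s ∈ p.1)
        (hs' : s ∈ p'.1), (p.2.1 ⟨s, hs⟩ : A) = p'.2.1 ⟨s, hs'⟩ := by
      rintro p _ rfl s hs hs'
      rfl
    rw [eq_normalForm q, eq_normalForm r, ← hfst]
    exact normalForm_congr fun s hs => key _ _ h s hs (show s ∈ (state r).1.1 from hfst ▸ hs)
  · rintro ⟨S, g, gm, gr⟩
    let m : A → A := fun a => if h : a ∈ S then g ⟨a, h⟩ else a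
    have hmg : ∀ s (hs : s ∈ S), m s = g ⟨s, hs⟩ := fun s hs => dif_pos hs
    obtain ⟨h1, h2⟩ := state_normalForm (S := S) (m := m)
      (fun s hs => by rw [hmg s hs]; exact gr ⟨s, hs⟩)
      (fun s hs t ht hst => by rw [hmg s hs, hmg t ht]; exact gm hst)
      (fun s hs => by rw [hmg s hs]; exact (g ⟨s, hs⟩).2)
    refine ⟨normalForm S m, ?_⟩
    have key : ∀ p : Σ S : Finset A, RegressiveMap S, ∀ h : p.1 = S,
        (∀ s (hs : s ∈ p.1), (p.2.1 ⟨s, hs⟩ : A) = g ⟨s, h ▸ hs⟩) → p = ⟨S, g, gm, gr⟩ := by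
      rintro ⟨T, f, fm, fr⟩ rfl hf
      have : f = g := funext fun s => Subtype.ext (hf s.1 s.2)
      subst this
      rfl
    refine key _ h1 fun s hs => ?_
    have hs' : s ∈ S := h1 ▸ hs
    exact (h2 s hs').trans (hmg s hs')

end Invariant

end Chinese2

/-- The 2-Chinese monoid `Ch(A, 2)` is finite, of cardinality
`Σ_{k=0}^{n} binomial(n,k) · Catalan(k)` where `n = |A|`:
the binomial transform of the Catalan numbers. -/
theorem card_chinese2 {A : Type*} [LinearOrder A] [Fintype A] :
    Finite (chinese2Con A).Quotient ∧
      Nat.card (chinese2Con A).Quotient =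
        ∑ k ∈ Finset.range (Fintype.card A + 1),
          Nat.choose (Fintype.card A) k * catalan k := by
  have e := Equiv.ofBijective _ (Chinese2.toRegressive_bijective (A := A))
  refine ⟨Finite.of_equiv _ e.symm, ?_⟩
  rw [Nat.card_congr e, Nat.card_sigma]
  simp only [Chinese2.card_regressiveMap, Fintype.card_coe]
  rw [← Finset.powerset_univ, Finset.sum_powerset_apply_card]
  simp
end

section
/- Let A be a finite totally ordered alphabet with |A| = n and σ : A → ℕ with σ(a) ≥ 2 for every a ∈ A. Then the σ-plactic monoid Plax(A,σ) contains exactly 2^n idempotent elements; more precisely, for every subset B ⊆ A there is exactly one idempotent element of Plax(A,σ) that is the image of a word whose content is B, and every idempotent of Plax(A,σ) arises in this way. -/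
/-- The defining relations of the σ-plactic monoid: the Knuth relations together with
`a^(σ a) = a` for every letter `a`. -/
def plaxRel {A : Type*} [LinearOrder A] (σ : A → ℕ) (U V : FreeMonoid A) : Prop :=
  (∃ a b c : A, a ≤ b ∧ b < c ∧
    U = FreeMonoid.of a * FreeMonoid.of c * FreeMonoid.of b ∧
    V = FreeMonoid.of c * FreeMonoid.of a * FreeMonoid.of b) ∨
  (∃ a b c : A, a < b ∧ b ≤ c ∧
    U = FreeMonoid.of b * FreeMonoid.of a * FreeMonoid.of c ∧
    V = FreeMonoid.of b * FreeMonoid.of c * FreeMonoid.of a) ∨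
  (∃ a : A, U = FreeMonoid.of a ^ σ a ∧ V = FreeMonoid.of a)

/-- The congruence on the free monoid defining the σ-plactic monoid `Plax(A, σ)`. -/
def plaxCon {A : Type*} [LinearOrder A] (σ : A → ℕ) : Con (FreeMonoid A) :=
  conGen (plaxRel σ)

/-- A family `p` of elements of a monoid satisfies the Knuth relations. -/
structure SatisfiesKnuth {A M : Type*} [LinearOrder A] [Monoid M] (p : A → M) : Prop where
  left : ∀ a b c : A, a ≤ b → b < c → p a * p c * p b = p c * p a * p b
  right : ∀ a b c : A, a < b → b ≤ c → p b * p a * p c = p b * p c * p a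

namespace SatisfiesKnuth

variable {A M : Type*} [LinearOrder A] [Monoid M] {p : A → M}

/-- A letter slides left through a column whose entries it bounds, up to the top entry. -/
theorem column_mul (hp : SatisfiesKnuth p) (x : A) (l : List A) :
    ∀ h, (h :: l).Pairwise (· > ·) → h ≤ x →
      p h * (l.map p).prod * p x = p h * p x * (l.map p).prod := by
  induction l with
  | nil => intro h _ _; simp
  | cons k t ih =>
    intro h hl hx
    have hk : k < h := by simp at hl; exact hl.1.1
    have ih' := ih k hl.of_cons (hk.le.trans hx)
    have hr := hp.right k h x hk hx
    simp only [List.map_cons, List.prod_cons]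
    calc p h * (p k * (t.map p).prod) * p x = p h * (p k * (t.map p).prod * p x) := by
          simp only [mul_assoc]
      _ = p h * p k * p x * (t.map p).prod := by rw [ih']; simp only [mul_assoc]
      _ = _ := by rw [hr]; simp only [mul_assoc]

/-- A letter slides right through a column ending with that letter. -/
theorem mul_column (hp : SatisfiesKnuth p) (x : A) (l : List A) :
    (l ++ [x]).Pairwise (· > ·) →
      p x * ((l.map p).prod * p x) = (l.map p).prod * p x * p x := by
  induction l with
  | nil => intro _; simp
  | cons c t ih =>
    intro hl
    have ih' := ih hl.of_cons
    have hc : ∀ y ∈ t ++ [x], y < c := (List.pairwise_cons.1 hl).1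
    have key : p x * p c * ((t.map p).prod * p x) = p c * p x * ((t.map p).prod * p x) := by
      cases t with
      | nil => simpa using hp.left x x c le_rfl (hc x (by simp))
      | cons d s =>
        have hxd : x ≤ d := le_of_lt ((List.pairwise_append.1 hl.of_cons).2.2 d (by simp) x (by simp))
        have hr := hp.left x d c hxd (hc d (by simp))
        simp only [List.map_cons, List.prod_cons]
        rw [mul_assoc (p d), ← mul_assoc (p x * p c), hr, mul_assoc (p c * p x)]
    simp only [List.map_cons, List.prod_cons]
    calc p x * (p c * (t.map p).prod * p x) = p x * p c * ((t.map p).prod * p x) := by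
          simp only [mul_assoc]
      _ = p c * (p x * ((t.map p).prod * p x)) := by rw [key]; simp only [mul_assoc]
      _ = _ := by rw [ih']; simp only [mul_assoc]

/-- A column commutes with each of its entries. -/
theorem commute_column (hp : SatisfiesKnuth p) {l : List A} (hl : l.Pairwise (· > ·))
    {x : A} (hx : x ∈ l) : Commute ((l.map p).prod) (p x) := by
  obtain ⟨s, t, rfl⟩ := List.append_of_mem hx
  have h1 := hp.column_mul x t x (List.pairwise_append.1 hl).2.1 le_rfl
  have h2 := hp.mul_column x s (by
    have : (s ++ x :: t) = (s ++ [x]) ++ t := by simp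
    rw [this] at hl
    exact (List.pairwise_append.1 hl).1)
  simp only [Commute, SemiconjBy, List.map_append, List.map_cons, List.prod_append,
    List.prod_cons]
  calc (s.map p).prod * (p x * (t.map p).prod) * p x
      = (s.map p).prod * (p x * (t.map p).prod * p x) := by simp only [mul_assoc]
    _ = (s.map p).prod * p x * p x * (t.map p).prod := by rw [h1]; simp only [mul_assoc]
    _ = p x * ((s.map p).prod * (p x * (t.map p).prod)) := by rw [← h2]; simp only [mul_assoc]

theorem commute_column_prod (hp : SatisfiesKnuth p) {l : List A} (hl : l.Pairwise (· > ·))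
    {v : List A} (hv : ∀ x ∈ v, x ∈ l) : Commute ((l.map p).prod) ((v.map p).prod) := by
  induction v with
  | nil => simp
  | cons x t ih =>
    simp only [List.map_cons, List.prod_cons]
    exact (hp.commute_column hl (hv x (by simp))).mul_right
      (ih fun y hy => hv y (List.mem_cons_of_mem _ hy))

/-- Column insertion of a letter that may evict an entry. -/
theorem exists_insert (hp : SatisfiesKnuth p) (x : A) (l : List A) :
    l.Pairwise (· > ·) → ∃ l' v : List A, l'.Pairwise (· > ·) ∧
      p x * (l.map p).prod = (l'.map p).prod * (v.map p).prod ∧ x ∈ l' ∧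
      (∀ b ∈ l, b < x → b ∈ l') ∧ (∀ b ∈ l', b = x ∨ b ∈ l) ∧ ∀ b ∈ v, b ∈ l := by
  induction l with
  | nil => intro _; exact ⟨[x], [], by simp⟩
  | cons h t ih =>
    intro hl
    have hh : ∀ y ∈ t, y < h := (List.pairwise_cons.1 hl).1
    rcases lt_or_ge h x with hx | hx
    · refine ⟨x :: h :: t, [], ?_, by simp, by simp, by simp +contextual, by simp, by simp⟩
      refine List.pairwise_cons.2 ⟨?_, hl⟩
      intro y hy
      rcases List.mem_cons.1 hy with rfl | hy
      · exact hx
      · exact (hh y hy).trans hx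
    · cases t with
      | nil =>
        refine ⟨[x], [h], by simp, by simp, by simp, ?_, by simp, by simp⟩
        intro b hb hbx
        simp at hb
        exact absurd (hb ▸ hbx) hx.not_gt
      | cons k s =>
        rcases le_or_gt x k with hxk | hkx
        · obtain ⟨l', v, h1, h2, h3, h4, h5, h6⟩ := ih hl.of_cons
          refine ⟨h :: l', v, ?_, ?_, by simp [h3], ?_, ?_, ?_⟩
          · refine List.pairwise_cons.2 ⟨?_, h1⟩
            intro y hy
            rcases h5 y hy with rfl | hy
            · exact hxk.trans_lt (hh k (by simp))
            · exact hh y hy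
          · have hr := hp.left x k h hxk (hh k (by simp))
            simp only [List.map_cons, List.prod_cons] at h2 ⊢
            rw [mul_assoc (p h), ← h2]
            simp only [← mul_assoc]
            rw [hr]
          · intro b hb hbx
            rcases List.mem_cons.1 hb with rfl | hb
            · simp
            · exact List.mem_cons_of_mem _ (h4 b hb hbx)
          · intro b hb
            rcases List.mem_cons.1 hb with rfl | hb
            · simp
            · exact (h5 b hb).imp id (List.mem_cons_of_mem _)
          · exact fun b hb => List.mem_cons_of_mem _ (h6 b hb)
        · have hd : (x :: k :: s).Pairwise (· > ·) := by
            refine List.pairwise_cons.2 ⟨?_, hl.of_cons⟩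
            intro y hy
            rcases List.mem_cons.1 hy with rfl | hy
            · exact hkx
            · exact ((List.pairwise_cons.1 hl.of_cons).1 y hy).trans hkx
          refine ⟨x :: k :: s, [h], hd, ?_, by simp, ?_, ?_, by simp⟩
          · have := hp.column_mul h (k :: s) x hd hx
            simp only [List.map_cons, List.prod_cons, List.map_nil, List.prod_nil, mul_one] at this ⊢
            rw [this]; simp only [mul_assoc]
          · intro b hb hbx
            rcases List.mem_cons.1 hb with rfl | hb
            · exact absurd hbx hx.not_gt
            · exact List.mem_cons_of_mem _ hb
          · intro b hb
            rcases List.mem_cons.1 hb with rfl | hb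
            · simp
            · exact Or.inr (List.mem_cons_of_mem _ hb)

/-- Column insertion, leaving the column unchanged if it already contains the letter. -/
theorem exists_insert' (hp : SatisfiesKnuth p) (x : A) {l : List A} (hl : l.Pairwise (· > ·)) :
    ∃ l' v : List A, l'.Pairwise (· > ·) ∧
      p x * (l.map p).prod = (l'.map p).prod * (v.map p).prod ∧ x ∈ l' ∧
      (∀ b ∈ l, (b < x ∨ x ∈ l) → b ∈ l') ∧ (∀ b ∈ l', b = x ∨ b ∈ l) ∧
      ∀ b ∈ v, b = x ∨ b ∈ l := by
  by_cases hx : x ∈ l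
  · refine ⟨l, [x], hl, ?_, hx, fun b hb _ => hb, fun b hb => Or.inr hb, by simp⟩
    simpa using (hp.commute_column hl hx).eq.symm
  · obtain ⟨l', v, h1, h2, h3, h4, h5, h6⟩ := hp.exists_insert x l hl
    exact ⟨l', v, h1, h2, h3, fun b hb h => h4 b hb (h.resolve_right hx), h5,
      fun b hb => Or.inr (h6 b hb)⟩

/-- Inserting a word over `B` into a column containing a lower subset `S` of `B` keeps `S`,
and adds the letter following `S` if it occurs in the word. -/
theorem exists_insert_word (hp : SatisfiesKnuth p) {B S : Finset A} {m : A}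
    (hS : ∀ b ∈ B, ∀ s ∈ S, b ≤ s → b ∈ S) (hm : ∀ b ∈ B, b < m → b ∈ S)
    {l : List A} (hl : l.Pairwise (· > ·)) (hlB : ∀ b ∈ l, b ∈ B) (hSl : ∀ b ∈ S, b ∈ l)
    {w : List A} (hw : ∀ b ∈ w, b ∈ B) :
    ∃ l' v : List A, l'.Pairwise (· > ·) ∧
      (w.map p).prod * (l.map p).prod = (l'.map p).prod * (v.map p).prod ∧
      (∀ b ∈ S, b ∈ l') ∧ (m ∈ w → m ∈ l') ∧ (∀ b ∈ l', b ∈ B) ∧ ∀ b ∈ v, b ∈ B := by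
  induction w with
  | nil => exact ⟨l, [], hl, by simp, hSl, by simp, hlB, by simp⟩
  | cons x t ih =>
    obtain ⟨c, v, h1, h2, h3, h4, h5, h6⟩ := ih fun b hb => hw b (List.mem_cons_of_mem _ hb)
    obtain ⟨c', v', k1, k2, k3, k4, k5, k6⟩ := hp.exists_insert' x h1
    have hx : x ∈ B := hw x (by simp)
    refine ⟨c', v' ++ v, k1, ?_, ?_, ?_, ?_, ?_⟩
    · simp only [List.map_cons, List.prod_cons, List.map_append, List.prod_append]
      rw [mul_assoc, h2, ← mul_assoc, k2, mul_assoc]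
    · intro b hb
      refine k4 b (h3 b hb) ?_
      rcases lt_or_ge b x with h | h
      · exact Or.inl h
      · exact Or.inr (h3 x (hS x hx b hb h))
    · intro hmx
      rcases lt_trichotomy m x with h | h | h
      · exact k4 m (h4 ((List.mem_cons.1 hmx).resolve_left h.ne)) (Or.inl h)
      · exact h ▸ k3
      · exact k4 m (h4 ((List.mem_cons.1 hmx).resolve_left h.ne')) (Or.inr (h3 x (hm x hx h)))
    · intro b hb
      rcases k5 b hb with rfl | hb
      · exact hx
      · exact h5 b hb
    · intro b hb
      rcases List.mem_append.1 hb with hb | hb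
      · rcases k6 b hb with rfl | hb
        · exact hx
        · exact h5 b hb
      · exact h6 b hb

/-- An idempotent word factors through a column containing any lower subset of its content. -/
theorem exists_column_of_idempotent (hp : SatisfiesKnuth p) {w : List A}
    (he : (w.map p).prod * (w.map p).prod = (w.map p).prod) (S : Finset A) :
    S ⊆ w.toFinset → (∀ b ∈ w.toFinset, ∀ s ∈ S, b ≤ s → b ∈ S) →
    ∃ l v : List A, l.Pairwise (· > ·) ∧ (w.map p).prod = (l.map p).prod * (v.map p).prod ∧
      (∀ b ∈ S, b ∈ l) ∧ (∀ b ∈ l, b ∈ w.toFinset) ∧ ∀ b ∈ v, b ∈ w.toFinset := by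
  induction S using Finset.induction_on_max with
  | empty => intro _ _; exact ⟨[], w, by simp⟩
  | insert m S hm ih =>
    intro hsub hlow
    have hlow' : ∀ b ∈ w.toFinset, ∀ s ∈ S, b ≤ s → b ∈ S := by
      intro b hb s hs hbs
      exact (Finset.mem_insert.1 (hlow b hb s (Finset.mem_insert_of_mem hs) hbs)).resolve_left
        (hbs.trans_lt (hm s hs)).ne
    obtain ⟨l, v, h1, h2, h3, h4, h5⟩ := ih ((Finset.subset_insert _ _).trans hsub) hlow'
    obtain ⟨l', v', k1, k2, k3, k4, k5, k6⟩ := hp.exists_insert_word (m := m) hlow'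
      (fun b hb hbm => (Finset.mem_insert.1
        (hlow b hb m (Finset.mem_insert_self _ _) hbm.le)).resolve_left hbm.ne)
      h1 h4 h3 (w := w) (by simp)
    refine ⟨l', v' ++ v, k1, ?_, ?_, k5, ?_⟩
    · rw [List.map_append, List.prod_append, ← mul_assoc, ← k2, mul_assoc, ← h2, he]
    · intro b hb
      rcases Finset.mem_insert.1 hb with rfl | hb
      · exact k4 (List.mem_toFinset.1 (hsub (Finset.mem_insert_self _ _)))
      · exact k3 b hb
    · intro b hb
      rcases List.mem_append.1 hb with hb | hb
      · exact k6 b hb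
      · exact h5 b hb

theorem column_pow (hp : SatisfiesKnuth p) {a : A} {l : List A}
    (hl : (a :: l).Pairwise (· > ·)) (k : ℕ) :
    (((a :: l).map p).prod) ^ k = p a ^ k * ((l.map p).prod) ^ k := by
  induction k with
  | zero => simp
  | succ k ih =>
    have hc : Commute (((a :: l).map p).prod ^ k) ((l.map p).prod) :=
      (hp.commute_column_prod hl fun x hx => List.mem_cons_of_mem _ hx).pow_left k
    calc (((a :: l).map p).prod) ^ (k + 1)
        = p a * ((l.map p).prod * (((a :: l).map p).prod) ^ k) := by
          rw [pow_succ', List.map_cons, List.prod_cons, mul_assoc]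
      _ = _ := by
          rw [← hc.eq, ih, pow_succ' (p a), pow_succ ((l.map p).prod)]
          simp only [mul_assoc]

variable {N : ℕ}

/-- The `N`-th power of a column absorbs the `N`-th powers of its entries. -/
theorem column_pow_mul_pow (hp : SatisfiesKnuth p)
    (hidem : ∀ a, p a ^ N * p a ^ N = p a ^ N) {l : List A} (hl : l.Pairwise (· > ·))
    {b : A} (hb : b ∈ l) : (l.map p).prod ^ N * p b ^ N = (l.map p).prod ^ N := by
  induction l with
  | nil => simp at hb
  | cons a t ih =>
    rcases List.mem_cons.1 hb with rfl | hbt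
    · rw [((hp.commute_column hl hb).pow_pow N N).eq, hp.column_pow hl, ← mul_assoc, hidem]
    · rw [hp.column_pow hl, mul_assoc, ih hl.of_cons hbt]

theorem column_pow_idempotent (hp : SatisfiesKnuth p)
    (hidem : ∀ a, p a ^ N * p a ^ N = p a ^ N) {l : List A} (hl : l.Pairwise (· > ·)) :
    (l.map p).prod ^ N * (l.map p).prod ^ N = (l.map p).prod ^ N := by
  have key : ∀ t : List A, t.Pairwise (· > ·) → (∀ b ∈ t, b ∈ l) →
      (l.map p).prod ^ N * (t.map p).prod ^ N = (l.map p).prod ^ N := by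
    intro t
    induction t with
    | nil => intro _ _; simp
    | cons a t ih =>
      intro ht hsub
      rw [hp.column_pow ht, ← mul_assoc, hp.column_pow_mul_pow hidem hl (hsub a (by simp)),
        ih ht.of_cons fun b hb => hsub b (List.mem_cons_of_mem _ hb)]
  exact key l hl fun _ h => h

/-- Words over a column become right invertible after multiplication by its `N`-th power. -/
theorem exists_column_pow_mul_eq (hp : SatisfiesKnuth p) (hN : N ≠ 0)
    (hidem : ∀ a, p a ^ N * p a ^ N = p a ^ N) {l : List A} (hl : l.Pairwise (· > ·))
    {v : List A} (hv : ∀ x ∈ v, x ∈ l) :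
    ∃ y, (l.map p).prod ^ N * (v.map p).prod * y = (l.map p).prod ^ N := by
  induction v with
  | nil => exact ⟨1, by simp⟩
  | cons x t ih =>
    obtain ⟨y, hy⟩ := ih fun b hb => hv b (List.mem_cons_of_mem _ hb)
    have hx : x ∈ l := hv x (by simp)
    have hc := (hp.commute_column hl hx).pow_left N
    refine ⟨y * p x ^ (N - 1), ?_⟩
    calc (l.map p).prod ^ N * ((x :: t).map p).prod * (y * p x ^ (N - 1))
        = (l.map p).prod ^ N * p x * (t.map p).prod * y * p x ^ (N - 1) := by
          simp only [List.map_cons, List.prod_cons, mul_assoc]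
      _ = p x * ((l.map p).prod ^ N * (t.map p).prod * y) * p x ^ (N - 1) := by
          rw [hc.eq]; simp only [mul_assoc]
      _ = (l.map p).prod ^ N * (p x * p x ^ (N - 1)) := by
          rw [hy, ← hc.eq, mul_assoc]
      _ = _ := by rw [mul_pow_sub_one hN, hp.column_pow_mul_pow hidem hl hx]

/-- An idempotent word equals the `N`-th power of the full column on its content. -/
theorem eq_column_pow_of_idempotent (hp : SatisfiesKnuth p) (hN : N ≠ 0)
    (hidem : ∀ a, p a ^ N * p a ^ N = p a ^ N) {l : List A} (hl : l.Pairwise (· > ·))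
    {w : List A} (hw : w.toFinset = l.toFinset)
    (he : (w.map p).prod * (w.map p).prod = (w.map p).prod) :
    (w.map p).prod = (l.map p).prod ^ N := by
  have hwl : ∀ x, x ∈ w ↔ x ∈ l := fun x => by
    rw [← List.mem_toFinset, hw, List.mem_toFinset]
  obtain ⟨c, v, h1, h2, h3, h4, h5⟩ := hp.exists_column_of_idempotent he w.toFinset
    subset_rfl (fun b hb _ _ _ => hb)
  simp only [List.mem_toFinset, hwl] at h3 h4 h5
  have hcl : c = l := by
    refine List.Perm.eq_of_pairwise (le := (· > ·)) ?_ h1 hl ?_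
    · intro a b _ _ hab hba
      exact absurd hab hba.asymm
    · exact (List.perm_ext_iff_of_nodup (h1.imp fun h => h.ne') (hl.imp fun h => h.ne')).2
        fun a => ⟨h4 a, h3 a⟩
  subst hcl
  set f := (c.map p).prod ^ N with hf
  set e := (w.map p).prod with hee
  have hff : f * f = f := hp.column_pow_idempotent hidem hl
  have hpow : e ^ N = e := IsIdempotentElem.pow_eq he hN
  have hfe : f * e = e := by
    rw [← hpow, h2, (hp.commute_column_prod hl h5).mul_pow, ← mul_assoc, hff]
  have hcomm : Commute f e := (hp.commute_column_prod hl fun x hx => (hwl x).1 hx).pow_left N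
  obtain ⟨y, hy⟩ := hp.exists_column_pow_mul_eq hN hidem hl (fun x hx => (hwl x).1 hx)
  change f * e * y = f at hy
  rw [hfe] at hy
  calc e = e * f := by rw [← hcomm.eq, hfe]
    _ = e * y := by rw [← hy, ← mul_assoc, he]
    _ = f := hy

end SatisfiesKnuth

/-- The congruence on words of having the same content. -/
def contentCon (A : Type*) [DecidableEq A] : Con (FreeMonoid A) where
  r U V := U.toList.toFinset = V.toList.toFinset
  iseqv := ⟨fun _ => rfl, fun h => h.symm, fun h h' => h.trans h'⟩
  mul' h h' := by
    simp only [FreeMonoid.toList_mul, List.toFinset_append] at *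
    rw [h, h']

section Plax

variable {A : Type*} [LinearOrder A] {σ : A → ℕ}

theorem toFinset_toList_of_pow (a : A) {k : ℕ} (hk : k ≠ 0) :
    (FreeMonoid.of a ^ k).toList.toFinset = {a} := by
  induction k with
  | zero => exact absurd rfl hk
  | succ k ih =>
    rcases eq_or_ne k 0 with rfl | h
    · simp
    · rw [pow_succ, FreeMonoid.toList_mul, List.toFinset_append, ih h]
      simp

theorem plaxCon_le_contentCon (hσ : ∀ a, 2 ≤ σ a) : plaxCon σ ≤ contentCon A := by
  refine Con.conGen_le.2 ?_
  rintro U V (⟨a, b, c, -, -, rfl, rfl⟩ | ⟨a, b, c, -, -, rfl, rfl⟩ | ⟨a, rfl, rfl⟩)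
  · change List.toFinset _ = List.toFinset _
    ext x
    simp
    tauto
  · change List.toFinset _ = List.toFinset _
    ext x
    simp
    tauto
  · change List.toFinset _ = List.toFinset _
    rw [toFinset_toList_of_pow a (by have := hσ a; omega)]
    simp

theorem toFinset_eq_of_mk'_eq (hσ : ∀ a, 2 ≤ σ a) {U V : FreeMonoid A}
    (h : (plaxCon σ).mk' U = (plaxCon σ).mk' V) : U.toList.toFinset = V.toList.toFinset :=
  plaxCon_le_contentCon hσ ((Con.eq _).1 h)

theorem satisfiesKnuth_plax (σ : A → ℕ) :
    SatisfiesKnuth fun a => (plaxCon σ).mk' (FreeMonoid.of a) where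
  left a b c hab hbc := by
    simp only [← map_mul]
    exact (Con.eq _).2 (ConGen.Rel.of _ _ (Or.inl ⟨a, b, c, hab, hbc, rfl, rfl⟩))
  right a b c hab hbc := by
    simp only [← map_mul]
    exact (Con.eq _).2 (ConGen.Rel.of _ _ (Or.inr (Or.inl ⟨a, b, c, hab, hbc, rfl, rfl⟩)))

theorem mk'_of_pow (σ : A → ℕ) (a : A) :
    (plaxCon σ).mk' (FreeMonoid.of a) ^ σ a = (plaxCon σ).mk' (FreeMonoid.of a) := by
  rw [← map_pow]
  exact (Con.eq _).2 (ConGen.Rel.of _ _ (Or.inr (Or.inr ⟨a, rfl, rfl⟩)))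

theorem mk'_eq_prod (σ : A → ℕ) (W : FreeMonoid A) :
    (plaxCon σ).mk' W = (W.toList.map fun a => (plaxCon σ).mk' (FreeMonoid.of a)).prod := by
  rw [← FreeMonoid.lift_apply]
  exact DFunLike.congr_fun (FreeMonoid.hom_eq fun a => by simp) W

theorem exists_pow_mk'_of_idempotent [Fintype A] (hσ : ∀ a, 2 ≤ σ a) :
    ∃ N : ℕ, N ≠ 0 ∧ ∀ a, (plaxCon σ).mk' (FreeMonoid.of a) ^ N *
      (plaxCon σ).mk' (FreeMonoid.of a) ^ N = (plaxCon σ).mk' (FreeMonoid.of a) ^ N := by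
  refine ⟨∏ a, (σ a - 1), Finset.prod_ne_zero_iff.2 fun a _ => by have := hσ a; omega,
    fun a => ?_⟩
  obtain ⟨k, hk⟩ := Finset.dvd_prod_of_mem (fun a => σ a - 1) (Finset.mem_univ a)
  rw [hk, pow_mul]
  refine IsIdempotentElem.pow k ?_
  have h2 := hσ a
  change _ ^ (σ a - 1) * _ ^ (σ a - 1) = _ ^ (σ a - 1)
  rw [← pow_add, show σ a - 1 + (σ a - 1) = σ a + (σ a - 2) by omega, pow_add, mk'_of_pow,
    ← pow_succ', show σ a - 2 + 1 = σ a - 1 by omega]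

theorem existsUnique_idempotent_of_content [Fintype A] (hσ : ∀ a, 2 ≤ σ a) (B : Finset A) :
    ∃! x : (plaxCon σ).Quotient,
      x * x = x ∧ ∃ W : FreeMonoid A, W.toList.toFinset = B ∧ (plaxCon σ).mk' W = x := by
  obtain ⟨N, hN, hidem⟩ := exists_pow_mk'_of_idempotent hσ
  have hp := satisfiesKnuth_plax σ
  have hl : (B.sort (· ≥ ·)).Pairwise (· > ·) := (B.sortedGT_sort).pairwise
  refine ⟨_, ⟨hp.column_pow_idempotent hidem hl, FreeMonoid.ofList (B.sort (· ≥ ·)) ^ N, ?_, ?_⟩,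
    ?_⟩
  · have key : ∀ k ≠ 0, (FreeMonoid.ofList (B.sort (· ≥ ·)) ^ k).toList.toFinset = B := by
      intro k hk
      induction k with
      | zero => exact absurd rfl hk
      | succ k ih =>
        rcases eq_or_ne k 0 with rfl | h
        · simp
        · rw [pow_succ, FreeMonoid.toList_mul, List.toFinset_append, ih h]
          simp
    exact key N hN
  · rw [map_pow, mk'_eq_prod]
    rfl
  · rintro x ⟨hx, W, hW, rfl⟩
    rw [mk'_eq_prod] at hx ⊢
    exact hp.eq_column_pow_of_idempotent hN hidem hl (by rw [hW, Finset.sort_toFinset]) hx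

end Plax

/-- The σ-plactic monoid `Plax(A, σ)` has exactly `2^|A|` idempotents: for every
subset `B ⊆ A` there is exactly one idempotent which is the image of a word with
content `B`, and (since every element is the image of a word, and all words
representing a given element have the same content) every idempotent arises this
way; moreover the number of idempotents is `2^|A|`. -/
theorem idempotents_plax {A : Type*} [LinearOrder A] [Fintype A]
    (σ : A → ℕ) (hσ : ∀ a : A, 2 ≤ σ a) :
    (∀ B : Finset A, ∃! x : (plaxCon σ).Quotient,
      x * x = x ∧ ∃ W : FreeMonoid A, W.toList.toFinset = B ∧ (plaxCon σ).mk' W = x) ∧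
    Nat.card {x : (plaxCon σ).Quotient // x * x = x} = 2 ^ Fintype.card A := by
  have hB := existsUnique_idempotent_of_content hσ
  refine ⟨hB, ?_⟩
  choose g hg huniq using hB
  rw [← Fintype.card_finset, ← Nat.card_eq_fintype_card]
  refine (Nat.card_congr (Equiv.ofBijective
    (fun B => (⟨g B, (hg B).1⟩ : {x : (plaxCon σ).Quotient // x * x = x})) ⟨?_, ?_⟩)).symm
  · intro B C h
    obtain ⟨-, U, rfl, hU⟩ := hg B
    obtain ⟨-, V, rfl, hV⟩ := hg C
    exact toFinset_eq_of_mk'_eq hσ (hU.trans ((congrArg Subtype.val h).trans hV.symm))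
  · rintro ⟨x, hx⟩
    obtain ⟨W, rfl⟩ := Con.mk'_surjective x
    exact ⟨W.toList.toFinset, Subtype.ext (huniq _ _ ⟨hx, W, rfl, rfl⟩).symm⟩
end

section
/- Let A be a finite totally ordered alphabet. The 2-Chinese monoid Ch(A,2) is 𝒥-trivial: for all x, y ∈ Ch(A,2), if there exist p, q, r, s ∈ Ch(A,2) such that p·x·q = y and r·y·s = x, then x = y. -/
/-- A map from an ordered alphabet to a monoid satisfying the relations of the 2-Chinese monoid,
stated uniformly for weak inequalities. -/
structure IsChinese2Map {A Q : Type*} [LinearOrder A] [Monoid Q] (f : A → Q) : Prop where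
  swap : ∀ {a b c : A}, a ≤ b → b ≤ c → f c * f b * f a = f c * f a * f b
  comm : ∀ {a b c : A}, a ≤ b → b ≤ c → f c * f a * f b = f b * (f c * f a)
  idem : ∀ a : A, f a * f a = f a

theorem isChinese2Map_of (A : Type*) [LinearOrder A] :
    IsChinese2Map fun a : A => ((FreeMonoid.of a : FreeMonoid A) : (chinese2Con A).Quotient) := by
  have key : ∀ {U V : FreeMonoid A}, chinese2Rel U V →
      (U : (chinese2Con A).Quotient) = (V : (chinese2Con A).Quotient) := fun h =>
    (Con.eq _).2 (ConGen.Rel.of _ _ h)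
  have idem : ∀ a : A, ((FreeMonoid.of a : FreeMonoid A) : (chinese2Con A).Quotient) *
      ((FreeMonoid.of a : FreeMonoid A) : (chinese2Con A).Quotient) =
      ((FreeMonoid.of a : FreeMonoid A) : (chinese2Con A).Quotient) := fun a =>
    key (.inr (.inr (.inr (.inr ⟨a, rfl, rfl⟩))))
  refine ⟨fun {a b c} hab hbc => ?_, fun {a b c} hab hbc => ?_, idem⟩
  · rcases hab.eq_or_lt with rfl | hab
    · rfl
    rcases hbc.eq_or_lt with rfl | hbc
    · exact key (.inr (.inr (.inr (.inl ⟨a, b, hab, rfl, rfl⟩))))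
    · exact key (.inl ⟨a, b, c, hab, hbc, rfl, rfl⟩)
  · rw [← mul_assoc]
    rcases hab.eq_or_lt with rfl | hab
    · rcases hbc.eq_or_lt with rfl | hbc
      · rfl
      · exact (key (.inr (.inr (.inl ⟨a, c, hbc, rfl, rfl⟩)))).symm
    rcases hbc.eq_or_lt with rfl | hbc
    · exact (key (.inr (.inr (.inr (.inl ⟨a, b, hab, rfl, rfl⟩))))).symm
    · exact key (.inr (.inl ⟨a, b, c, hab, hbc, rfl, rfl⟩))

theorem List.mul_prod_map_eq_mul_prod_map_filter {A Q : Type*} [Monoid Q] {f : A → Q}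
    {e : Q} (S : A → Prop) [DecidablePred S] {u : List A}
    (hcomm : ∀ c ∈ u, Commute e (f c)) (habs : ∀ c, ¬ S c → e * f c = e) :
    e * (u.map f).prod = e * ((u.filter S).map f).prod := by
  induction u with
  | nil => rfl
  | cons c u ih =>
    have ih := ih fun d hd => hcomm d (by simp [hd])
    by_cases hc : S c
    · have h := (hcomm c (by simp)).eq
      simp only [hc, decide_true, List.filter_cons_of_pos, List.map_cons, List.prod_cons]
      rw [← mul_assoc, h, mul_assoc, ih, ← mul_assoc, ← h, mul_assoc]
    · simp only [hc, decide_false, Bool.false_eq_true, not_false_eq_true,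
        List.filter_cons_of_neg, List.map_cons, List.prod_cons]
      rw [← mul_assoc, habs c hc, ih]

namespace IsChinese2Map

variable {A Q : Type*} [LinearOrder A] [Monoid Q] {f : A → Q}

theorem commute_prod (hf : IsChinese2Map f) {m M : A} {w : List A}
    (hw : ∀ b ∈ w, m ≤ b ∧ b ≤ M) : Commute (f M * f m) (w.map f).prod := by
  refine Commute.list_prod_right _ _ fun q hq => ?_
  obtain ⟨b, hb, rfl⟩ := List.mem_map.1 hq
  exact hf.comm (hw b hb).1 (hw b hb).2

/-- In a word with letters in `[m, M]` that starts with `M` and ends with `m`, the last letter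
can be moved to the second position. -/
theorem exists_mul_prod_mul_eq (hf : IsChinese2Map f) {m M : A} (w : List A)
    (hw : ∀ b ∈ w, m ≤ b ∧ b ≤ M) :
    ∃ y, f M * (w.map f).prod * f m = f M * f m * y := by
  rcases w.eq_nil_or_concat with rfl | ⟨l, a, hl⟩
  · exact ⟨1, by simp⟩
  obtain ⟨b, hb, hmax⟩ := w.toFinset.exists_max_image id ⟨a, by simp [hl]⟩
  simp only [List.mem_toFinset, id] at hb hmax
  obtain ⟨w₁, w₂, hw₁₂⟩ := List.append_of_mem hb
  have hlt : w₂.length < w.length := by rw [hw₁₂]; simp; omega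
  obtain ⟨y, hy⟩ := exists_mul_prod_mul_eq hf (m := m) (M := b) w₂
    fun c hc => ⟨(hw c (by simp [hw₁₂, hc])).1, hmax c (by simp [hw₁₂, hc])⟩
  have hcomm : Commute (f b * f m) (w₁.map f).prod :=
    hf.commute_prod fun c hc =>
      ⟨(hw c (by simp [hw₁₂, hc])).1, hmax c (by simp [hw₁₂, hc])⟩
  refine ⟨f b * (w₁.map f).prod * y, ?_⟩
  calc f M * (w.map f).prod * f m
      = f M * (w₁.map f).prod * (f b * (w₂.map f).prod * f m) := by simp [hw₁₂, mul_assoc]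
    _ = f M * ((w₁.map f).prod * (f b * f m)) * y := by rw [hy]; simp only [mul_assoc]
    _ = f M * f b * f m * ((w₁.map f).prod * y) := by rw [← hcomm.eq]; simp only [mul_assoc]
    _ = f M * f m * (f b * (w₁.map f).prod * y) := by
      rw [hf.swap (hw b hb).1 (hw b hb).2]; simp only [mul_assoc]
termination_by w.length

/-- Some power of a word absorbs, on both sides, every letter of that word. -/
theorem exists_pow_absorbs (hf : IsChinese2Map f) (u : List A) :
    ∃ N : ℕ, ∀ c ∈ u, f c * (u.map f).prod ^ N = (u.map f).prod ^ N ∧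
      (u.map f).prod ^ N * f c = (u.map f).prod ^ N := by
  rcases u.eq_nil_or_concat with rfl | ⟨l, a, hl⟩
  · exact ⟨0, by simp⟩
  obtain ⟨M, hM, hmax⟩ := u.toFinset.exists_max_image id ⟨a, by simp [hl]⟩
  obtain ⟨m, hm, hmin⟩ := u.toFinset.exists_min_image id ⟨a, by simp [hl]⟩
  simp only [List.mem_toFinset, id] at hM hmax hm hmin
  have hu : ∀ b ∈ u, m ≤ b ∧ b ≤ M := fun b hb => ⟨hmin b hb, hmax b hb⟩
  have hmM : m ≤ M := hmin M hM
  obtain ⟨v, hv⟩ : ∃ v, v = u.filter fun c => c ≠ m ∧ c ≠ M := ⟨_, rfl⟩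
  have hlt : v.length < u.length := by
    rw [hv]; exact List.length_filter_lt_length_iff_exists.2 ⟨m, hm, by simp⟩
  obtain ⟨N, hN⟩ := exists_pow_absorbs hf v
  set e := f M * f m with he
  have hEM : e * f M = e := by rw [he, hf.comm hmM le_rfl, ← mul_assoc, hf.idem]
  have hEm : e * f m = e := by rw [he, mul_assoc, hf.idem]
  have hee : e * e = e := by conv_lhs => rw [he, ← mul_assoc, ← he, hEM, hEm]
  have hcl : ∀ c ∈ u, Commute e (f c) := fun c hc => hf.comm (hu c hc).1 (hu c hc).2
  have hcomm : Commute e (u.map f).prod := hf.commute_prod hu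
  have hvu : ∀ c ∈ v, c ∈ u := fun c hc => (List.mem_filter.1 (hv ▸ hc)).1
  have hcommv : Commute e (v.map f).prod := hf.commute_prod fun c hc => hu c (hvu c hc)
  have hfilter : e * (u.map f).prod = e * (v.map f).prod := by
    rw [hv]
    refine List.mul_prod_map_eq_mul_prod_map_filter (fun c => c ≠ m ∧ c ≠ M) hcl
      fun c hc => ?_
    rcases eq_or_ne c m with rfl | h
    · exact hEm
    · obtain rfl : c = M := by_contra fun h' => hc ⟨h, h'⟩
      exact hEM
  have hpow : ∀ n : ℕ, e * (u.map f).prod ^ n = e * (v.map f).prod ^ n := by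
    intro n
    induction n with
    | zero => simp
    | succ n ih =>
      rw [pow_succ, ← mul_assoc, ih, (hcommv.pow_right n).eq, mul_assoc, hfilter, ← mul_assoc,
        ← (hcommv.pow_right n).eq, mul_assoc, ← pow_succ]
  have hsq : e * (u.map f).prod ^ 2 = (u.map f).prod ^ 2 := by
    obtain ⟨u₁, u₂, h₁⟩ := List.append_of_mem hM
    obtain ⟨u₃, u₄, h₂⟩ := List.append_of_mem hm
    obtain ⟨y, hy⟩ := hf.exists_mul_prod_mul_eq (m := m) (M := M) (u₂ ++ u₃) fun c hc => by
      rcases List.mem_append.1 hc with hc | hc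
      · exact hu c (by simp [h₁, hc])
      · exact hu c (by simp [h₂, hc])
    have hc₁ : Commute e (u₁.map f).prod := hf.commute_prod fun c hc => hu c (by simp [h₁, hc])
    have key : (u.map f).prod ^ 2 = e * ((u₁.map f).prod * y * (u₄.map f).prod) :=
      calc (u.map f).prod ^ 2
          = ((u₁ ++ M :: u₂).map f).prod * ((u₃ ++ m :: u₄).map f).prod := by
            rw [← h₁, ← h₂, sq]
        _ = (u₁.map f).prod * (f M * ((u₂ ++ u₃).map f).prod * f m) * (u₄.map f).prod := by
            simp [mul_assoc]
        _ = e * ((u₁.map f).prod * y * (u₄.map f).prod) := by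
            rw [hy, ← he, ← mul_assoc, ← hc₁.eq]; simp only [mul_assoc]
    rw [key, ← mul_assoc, hee]
  have hmain : (u.map f).prod ^ (N + 2) = e * (v.map f).prod ^ (N + 2) := by
    rw [← hpow, pow_add, ← mul_assoc, (hcomm.pow_right N).eq, mul_assoc, hsq]
  refine ⟨N + 2, fun c hc => ?_⟩
  have hright : e * (v.map f).prod ^ (N + 2) * f c = e * (v.map f).prod ^ (N + 2) ∧
      e * (f c * (v.map f).prod ^ (N + 2)) = e * (v.map f).prod ^ (N + 2) := by
    by_cases hcv : c ∈ v
    · constructor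
      · rw [add_comm, pow_add, mul_assoc e, mul_assoc _ _ (f c), (hN c hcv).2]
      · rw [pow_add, ← mul_assoc (f c), (hN c hcv).1]
    · have habs : e * f c = e := by
        rcases eq_or_ne c m with rfl | h
        · exact hEm
        · obtain rfl : c = M := by_contra fun h' => hcv (by simp [hv, hc, h, h'])
          exact hEM
      constructor
      · rw [(hcommv.pow_right _).eq, mul_assoc, habs]
      · rw [← mul_assoc, habs]
  rw [hmain]
  exact ⟨by rw [← mul_assoc, ← (hcl c hc).eq, mul_assoc, hright.2], hright.1⟩
termination_by u.length

end IsChinese2Map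

theorem List.prod_mul_eq_of_forall {Q : Type*} [Monoid Q] {l : List Q} {x : Q}
    (h : ∀ c ∈ l, c * x = x) : l.prod * x = x := by
  induction l with
  | nil => simp
  | cons c l ih =>
    rw [List.prod_cons, mul_assoc, ih fun d hd => h d (by simp [hd]), h c (by simp)]

theorem List.mul_prod_eq_of_forall {Q : Type*} [Monoid Q] {l : List Q} {x : Q}
    (h : ∀ c ∈ l, x * c = x) : x * l.prod = x := by
  induction l with
  | nil => simp
  | cons c l ih =>
    rw [List.prod_cons, ← mul_assoc, h c (by simp), ih fun d hd => h d (by simp [hd])]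

/-- The 2-Chinese monoid `Ch(A, 2)` is 𝒥-trivial: two elements generating the same
two-sided principal ideal are equal. -/
theorem chinese2_J_trivial {A : Type*} [LinearOrder A] [Fintype A]
    (x y : (chinese2Con A).Quotient)
    (hxy : ∃ p q : (chinese2Con A).Quotient, p * x * q = y)
    (hyx : ∃ r s : (chinese2Con A).Quotient, r * y * s = x) :
    x = y := by
  obtain ⟨p, q, rfl⟩ := hxy
  obtain ⟨r, s, hx⟩ := hyx
  let f : A → (chinese2Con A).Quotient := fun a => ((FreeMonoid.of a : FreeMonoid A) : _)
  have hf : IsChinese2Map f := isChinese2Map_of A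
  have hsurj : ∀ z : (chinese2Con A).Quotient, ∃ w : List A, (w.map f).prod = z := by
    intro z
    induction z using Con.induction_on with | H w =>
    induction w using FreeMonoid.inductionOn' with
    | one => exact ⟨[], rfl⟩
    | of_mul a w ih =>
      obtain ⟨l, hl⟩ := ih
      exact ⟨a :: l, by rw [List.map_cons, List.prod_cons, hl]; rfl⟩
  obtain ⟨P, rfl⟩ := hsurj p
  obtain ⟨Q, rfl⟩ := hsurj q
  obtain ⟨R, rfl⟩ := hsurj r
  obtain ⟨S, rfl⟩ := hsurj s
  have hstep : ((R ++ P).map f).prod * x * ((Q ++ S).map f).prod = x := by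
    conv_rhs => rw [← hx]
    simp [mul_assoc]
  have hiter : ∀ n : ℕ,
      ((R ++ P).map f).prod ^ n * x * ((Q ++ S).map f).prod ^ n = x := by
    intro n
    induction n with
    | zero => simp
    | succ n ih =>
      conv_rhs => rw [← ih, ← hstep]
      rw [pow_succ, pow_succ']
      simp only [mul_assoc]
  have hP : (P.map f).prod * x = x := by
    obtain ⟨N, hN⟩ := hf.exists_pow_absorbs (R ++ P)
    refine List.prod_mul_eq_of_forall fun z hz => ?_
    obtain ⟨c, hc, rfl⟩ := List.mem_map.1 hz
    rw [← hiter N, ← mul_assoc, ← mul_assoc, (hN c (by simp [hc])).1]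
  have hQ : x * (Q.map f).prod = x := by
    obtain ⟨N, hN⟩ := hf.exists_pow_absorbs (Q ++ S)
    refine List.mul_prod_eq_of_forall fun z hz => ?_
    obtain ⟨c, hc, rfl⟩ := List.mem_map.1 hz
    rw [← hiter N, mul_assoc, (hN c (by simp [hc])).2]
  rw [hP, hQ]
end

section
/- Let A be a finite totally ordered alphabet. Every ≡_{Sylv(A)}-equivalence class contains a gathered element: for every word W ∈ A* there exists a word G ∈ A* with G ≡_{Sylv(A)} W such that for every word W' with W' ≡_{Sylv(A)} G and every factorization W' = U'·a·a·V' (a a letter, U',V' words), there is a factorization G = U·a·a·V in which U contains the same number of occurrences of a as U'. -/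
/-- The defining relations of the sylvester monoid: `a·c·W·b = c·a·W·b`
for all letters `a ≤ b < c` and all words `W`. -/
def sylvRel {A : Type*} [LinearOrder A] (U V : FreeMonoid A) : Prop :=
  ∃ (a b c : A) (W : FreeMonoid A), a ≤ b ∧ b < c ∧
    U = FreeMonoid.of a * FreeMonoid.of c * W * FreeMonoid.of b ∧
    V = FreeMonoid.of c * FreeMonoid.of a * W * FreeMonoid.of b

/-- The congruence on the free monoid defining the sylvester monoid `Sylv(A)`. -/
def sylvCon (A : Type*) [LinearOrder A] : Con (FreeMonoid A) :=
  conGen sylvRel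

/-- A word `W` is gathered (w.r.t. the sylvester monoid) if for every word `W'`
equivalent to `W` and every factorization `W' = U'·a·a·V'`, there is a factorization
`W = U·a·a·V` in which `U` has the same number of occurrences of `a` as `U'`. -/
def Gathered {A : Type*} [LinearOrder A] (W : FreeMonoid A) : Prop :=
  ∀ (W' U' V' : FreeMonoid A) (a : A),
    sylvCon A W' W → W' = U' * FreeMonoid.of a * FreeMonoid.of a * V' →
    ∃ U V : FreeMonoid A,
      W = U * FreeMonoid.of a * FreeMonoid.of a * V ∧
      U.toList.count a = U'.toList.count a

section SylvesterReading

variable {A : Type*} [LinearOrder A]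

/-- The right-left-root reading of the binary search tree obtained by inserting the letters of
a list from head to last, equal letters going to the left. -/
def postorderReading : List A → List A
  | [] => []
  | b :: w => postorderReading (w.filter (fun x => decide (b < x))) ++
      postorderReading (w.filter (fun x => decide (x ≤ b))) ++ [b]
termination_by w => w.length
decreasing_by
  all_goals
    simp only [List.length_cons, List.length_unattach, Nat.lt_succ_iff]
    exact (List.length_filter_le _ _).trans List.length_attach.le

theorem list_induction_filter {P : List A → Prop} (nil : P [])
    (cons : ∀ b w, P (w.filter (fun x => decide (b < x))) →
      P (w.filter (fun x => decide (x ≤ b))) → P (b :: w)) (w : List A) : P w := by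
  induction hn : w.length using Nat.strong_induction_on generalizing w with
  | _ n ih =>
  cases w with
  | nil => exact nil
  | cons b w =>
    have hlt (p : A → Bool) : (w.filter p).length < n :=
      hn ▸ Nat.lt_succ_of_le (List.length_filter_le p w)
    exact cons b w (ih _ (hlt _) _ rfl) (ih _ (hlt _) _ rfl)

theorem postorderReading_perm (w : List A) : (postorderReading w).Perm w := by
  induction w using list_induction_filter with
  | nil => simp [postorderReading]
  | cons b w ih₁ ih₂ =>
    rw [postorderReading]
    refine (List.perm_append_singleton _ _).trans (List.Perm.cons b ?_)
    refine (ih₁.append ih₂).trans ?_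
    have h := List.filter_append_perm (fun x => decide (b < x)) w
    simpa [← not_lt] using h

/-- Congruence of two words given as lists. -/
def sylvList (l m : List A) : Prop :=
  sylvCon A (FreeMonoid.ofList l) (FreeMonoid.ofList m)

theorem sylvList.refl (l : List A) : sylvList l l := (sylvCon A).refl _

theorem sylvList.trans {l m n : List A} (h : sylvList l m) (h' : sylvList m n) : sylvList l n :=
  Con.trans _ h h'

theorem sylvList.append {l m l' m' : List A} (h : sylvList l m) (h' : sylvList l' m') :
    sylvList (l ++ l') (m ++ m') :=
  Con.mul _ h h'

theorem sylvList.swap {a b c : A} (hab : a ≤ b) (hbc : b < c) (w : List A) :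
    sylvList (a :: c :: (w ++ [b])) (c :: a :: (w ++ [b])) :=
  ConGen.Rel.of _ _ ⟨a, b, c, FreeMonoid.ofList w, hab, hbc, rfl, rfl⟩

theorem sylvList.cons {l m : List A} (a : A) (h : sylvList l m) : sylvList (a :: l) (a :: m) :=
  (sylvList.refl [a]).append h

theorem sylvList.move {a b : A} (hab : a ≤ b) (w : List A) :
    ∀ F : List A, (∀ c ∈ F, b < c) → sylvList (a :: (F ++ w ++ [b])) (F ++ a :: (w ++ [b]))
  | [], _ => sylvList.refl _
  | c :: F, hF => by
    refine sylvList.trans (sylvList.swap hab (hF c (by simp)) (F ++ w)) ?_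
    exact (sylvList.move hab w F fun x hx => hF x (by simp [hx])).cons c

theorem sylvList.partition (b : A) (w : List A) :
    sylvList (w ++ [b])
      (w.filter (fun x => decide (b < x)) ++ w.filter (fun x => decide (x ≤ b)) ++ [b]) := by
  induction w with
  | nil => exact sylvList.refl _
  | cons x w ih =>
    rcases lt_or_ge b x with hx | hx
    · simpa [hx, not_le.mpr hx] using ih.cons x
    · have h := (ih.cons x).trans (sylvList.move hx (w.filter (fun x => decide (x ≤ b)))
        (w.filter (fun x => decide (b < x))) (by simp))
      simpa [hx, not_lt.mpr hx] using h

theorem postorderReading_sylvList (w : List A) : sylvList w.reverse (postorderReading w) := by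
  induction w using list_induction_filter with
  | nil => simpa [postorderReading] using sylvList.refl _
  | cons b w ih₁ ih₂ =>
    rw [postorderReading, List.reverse_cons]
    refine (sylvList.partition b w.reverse).trans ?_
    simp only [List.filter_reverse]
    exact (ih₁.append ih₂).append (sylvList.refl _)

theorem postorderReading_swap {a b c : A} (hab : a ≤ b) (hbc : b < c) (Y w X : List A) :
    postorderReading (Y ++ b :: (w ++ c :: a :: X)) =
      postorderReading (Y ++ b :: (w ++ a :: c :: X)) := by
  induction hn : Y.length using Nat.strong_induction_on generalizing Y w X with
  | _ n ih =>
  cases Y with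
  | nil =>
    simp [postorderReading, hab, hbc, not_le.mpr hbc, not_lt.mpr hab]
  | cons d Y =>
    have key (p : A → Bool) (hp : p a = true → p c = true → p b = true) :
        postorderReading ((Y ++ b :: (w ++ c :: a :: X)).filter p) =
          postorderReading ((Y ++ b :: (w ++ a :: c :: X)).filter p) := by
      by_cases ha : p a = true
      · by_cases hc : p c = true
        · have h := ih (Y.filter p).length
            (by have := List.length_filter_le p Y; simp at hn; omega)
            (Y.filter p) (w.filter p) (X.filter p) rfl
          simpa [List.filter_cons, ha, hc, hp ha hc] using h
        · simp [List.filter_cons, hc]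
      · simp [List.filter_cons, ha]
    simp only [List.cons_append, postorderReading]
    rw [key, key]
    · simpa using fun _ h => hbc.le.trans h
    · simpa using fun h _ => lt_of_lt_of_le h hab

theorem postorderReading_eq_of_sylvCon {u v : FreeMonoid A} (h : sylvCon A u v) :
    postorderReading u.toList.reverse = postorderReading v.toList.reverse := by
  let r : Con (FreeMonoid A) :=
    { r := fun u v => ∀ X Y : FreeMonoid A, postorderReading (X * u * Y).toList.reverse =
        postorderReading (X * v * Y).toList.reverse
      iseqv := ⟨fun _ _ _ => rfl, fun h X Y => (h X Y).symm,
        fun h h' X Y => (h X Y).trans (h' X Y)⟩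
      mul' := by
        intro u v u' v' h h' X Y
        have h₁ := h X (u' * Y)
        have h₂ := h' (X * v) Y
        simp only [mul_assoc] at h₁ h₂ ⊢
        exact h₁.trans h₂ }
  have hle : sylvCon A ≤ r := by
    refine Con.conGen_le.mpr ?_
    rintro _ _ ⟨a, b, c, w, hab, hbc, rfl, rfl⟩ X Y
    have h := postorderReading_swap hab hbc Y.toList.reverse w.toList.reverse X.toList.reverse
    simpa using h
  simpa using hle h 1 1

theorem postorderReading_adjacent (a : A) (V U : List A) :
    ∃ U₁ V₁ : List A, postorderReading (V ++ a :: a :: U) = U₁ ++ a :: a :: V₁ ∧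
      U₁.count a = U.count a := by
  induction hn : V.length using Nat.strong_induction_on generalizing V U with
  | _ n ih =>
  cases V with
  | nil =>
    refine ⟨postorderReading (U.filter (fun x => decide (a < x))) ++
      postorderReading (U.filter (fun x => decide (x ≤ a))), [], ?_, ?_⟩
    · have h : U.filter (fun x => decide (a < x) && decide (x ≤ a)) = [] := by
        simp +contextual
      simp [postorderReading, List.filter_filter, h]
    · simp [(postorderReading_perm _).count_eq, List.count_eq_zero, List.count_filter]
  | cons d V =>
    have key (p : A → Bool) (hp : p a = true) :
        ∃ U₁ V₁ : List A, postorderReading ((V ++ a :: a :: U).filter p) = U₁ ++ a :: a :: V₁ ∧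
          U₁.count a = U.count a := by
      have h := ih (V.filter p).length
        (by have := List.length_filter_le p V; simp at hn; omega) (V.filter p) (U.filter p) rfl
      simpa [List.filter_cons, hp, List.count_filter] using h
    rw [List.cons_append, postorderReading]
    rcases lt_or_ge d a with hd | hd
    · obtain ⟨U₁, V₁, h, hc⟩ := key (fun x => decide (d < x)) (by simpa using hd)
      rw [h]
      exact ⟨U₁, V₁ ++ postorderReading ((V ++ a :: a :: U).filter (fun x => decide (x ≤ d))) ++
        [d], by simp, hc⟩
    · obtain ⟨U₁, V₁, h, hc⟩ := key (fun x => decide (x ≤ d)) (by simpa using hd)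
      rw [h]
      refine ⟨postorderReading ((V ++ a :: a :: U).filter (fun x => decide (d < x))) ++ U₁,
        V₁ ++ [d], by simp, ?_⟩
      rw [List.count_append, hc, (postorderReading_perm _).count_eq, List.count_eq_zero.mpr,
        zero_add]
      intro hm
      exact absurd (by simpa using (List.mem_filter.mp hm).2) (not_lt.mpr hd)

end SylvesterReading

/-- Every `≡_{Sylv(A)}`-equivalence class contains a gathered element. -/
theorem sylvester_gathered_exists {A : Type*} [LinearOrder A] [Fintype A]
    (W : FreeMonoid A) :
    ∃ G : FreeMonoid A, sylvCon A G W ∧ Gathered G := by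
  have hG : sylvCon A (FreeMonoid.ofList (postorderReading W.toList.reverse)) W := by
    have h := postorderReading_sylvList W.toList.reverse
    rw [List.reverse_reverse] at h
    exact Con.symm _ h
  refine ⟨_, hG, ?_⟩
  rintro W' U' V' a hW' rfl
  have heq := postorderReading_eq_of_sylvCon (Con.trans _ hW' hG)
  obtain ⟨U, V, h, hc⟩ := postorderReading_adjacent a V'.toList.reverse U'.toList.reverse
  refine ⟨FreeMonoid.ofList U, FreeMonoid.ofList V, ?_, by simpa using hc⟩
  apply FreeMonoid.toList.injective
  rw [← heq]
  simpa using h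
end
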